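/- Let 𝒜 be an elliptic homogeneous constant-coefficient differential operator of order k on ℝ^n, let u ∈ BV^𝒜_loc(ℝ^n), and let 1 ≤ p < n/(n−1). Then for ℒ^n-almost every x ∈ ℝ^n, the weak derivative D^{k−1}u is L^p-differentiable at x (i.e., D^{k−1}u ∈ t^{1,p}(x)), with approximate gradient ∇^k u(x) := ∇(D^{k−1}u)(x) ∈ V ⊙^k ℝ^n satisfying 𝒜^{ac}u(x) = A(∇^k u(x)), where 𝒜^{ac}u := d(𝒜u)/dℒ^n is the density of the absolutely continuous part of the measure 𝒜u. -/

import Mathlib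

open MeasureTheory Metric Filter
open scoped ENNReal RealInnerProductSpace Topology

noncomputable section

/-- Euclidean space `ℝ^n`. -/
abbrev Euc (n : ℕ) : Type := EuclideanSpace ℝ (Fin n)

/-- The `i`-th standard basis vector of `ℝ^n`. -/
def stdVec (n : ℕ) (i : Fin n) : Euc n := EuclideanSpace.single i (1 : ℝ)

/-- Coefficients `A_I : V →ₗ W` (indexed by `I : Fin k → Fin n`) of a homogeneous linear
constant-coefficient differential operator `𝒜 u = ∑_I A_I ∂_I u` of order `k` on `ℝ^n`. -/
abbrev CoeffOp (n k : ℕ) (V W : Type*) [NormedAddCommGroup V] [InnerProductSpace ℝ V]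
    [NormedAddCommGroup W] [InnerProductSpace ℝ W] : Type _ :=
  (Fin k → Fin n) → (V →ₗ[ℝ] W)

variable {V W F : Type*}
  [NormedAddCommGroup V] [InnerProductSpace ℝ V] [FiniteDimensional ℝ V]
  [NormedAddCommGroup W] [InnerProductSpace ℝ W] [FiniteDimensional ℝ W]

/-- The coefficients represent a linear map on symmetric tensors `V ⊙^k ℝ^n`. -/
def IsSymmetricOp (n k : ℕ) (A : CoeffOp n k V W) : Prop :=
  ∀ (I : Fin k → Fin n) (σ : Equiv.Perm (Fin k)), A (I ∘ σ) = A I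

/-- The symbol `𝒜[ξ] v = A (v ⊗^k ξ) = ∑_I (∏ i, ξ_{I i}) A_I v`. -/
def symbolMap (n k : ℕ) (A : CoeffOp n k V W) (ξ : Euc n) : V →ₗ[ℝ] W :=
  ∑ I : Fin k → Fin n, (∏ i, ξ (I i)) • A I

/-- Ellipticity: the symbol is injective for all `ξ ≠ 0`. -/
def IsElliptic (n k : ℕ) (A : CoeffOp n k V W) : Prop :=
  ∀ ξ : Euc n, ξ ≠ 0 → Function.Injective (symbolMap n k A ξ)

/-- Van Schaftingen's cancellation condition: `⋂_{ξ ∈ 𝕊^{n-1}} im 𝒜[ξ] = {0}`. -/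
def IsCanceling (n k : ℕ) (A : CoeffOp n k V W) : Prop :=
  (⋂ ξ ∈ sphere (0 : Euc n) 1, (LinearMap.range (symbolMap n k A ξ) : Set W)) = {0}

/-- Inverse of an endomorphism (junk value when not invertible), via matrix inversion. -/
def linInv (f : V →ₗ[ℝ] V) : V →ₗ[ℝ] V :=
  letI b := Module.finBasis ℝ V
  Matrix.toLin b b ((LinearMap.toMatrix b b f)⁻¹)

/-- `𝒜†[ξ] = (𝒜*[ξ] 𝒜[ξ])⁻¹ 𝒜*[ξ]`. -/
def Adagger (n k : ℕ) (A : CoeffOp n k V W) (ξ : Euc n) : W →ₗ[ℝ] V :=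
  linInv (LinearMap.adjoint (symbolMap n k A ξ) ∘ₗ symbolMap n k A ξ) ∘ₗ
    LinearMap.adjoint (symbolMap n k A ξ)

/-- Condition (WC): for every `w ∈ ⋂_{ξ ∈ 𝕊^{n-1}} im 𝒜[ξ]`,
`∫_{𝕊^{n-1}} 𝒜†[ξ] w ⊗^{k-n} ξ dℋ^{n-1}(ξ) = 0`, written componentwise in the
tensor coordinates indexed by `J : Fin (k-n) → Fin n`. -/
def IsWeaklyCanceling (n k : ℕ) (A : CoeffOp n k V W) : Prop :=
  ∀ w : W, (∀ ξ ∈ sphere (0 : Euc n) 1, w ∈ LinearMap.range (symbolMap n k A ξ)) →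
    ∀ J : Fin (k - n) → Fin n,
      (∫ ξ in sphere (0 : Euc n) 1,
        (∏ i, ξ (J i)) • (Adagger n k A ξ w) ∂(μH[(n : ℝ) - 1])) = 0

section TestFun

variable [NormedAddCommGroup F] [NormedSpace ℝ F]

/-- Compactly supported smooth test function. -/
def IsTestFun (n : ℕ) (φ : Euc n → F) : Prop :=
  ContDiff ℝ (⊤ : ℕ∞) φ ∧ HasCompactSupport φ

/-- Iterated directional derivative `∂_{I 0} ⋯ ∂_{I (m-1)} φ (x)`. -/
def dirDeriv (n m : ℕ) (I : Fin m → Fin n) (φ : Euc n → F) (x : Euc n) : F :=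
  iteratedFDeriv ℝ m φ x (fun i => stdVec n (I i))

/-- Smooth functions of degree-`≤ j` polynomial type. -/
def IsPolyDeg (n : ℕ) (j : ℕ) (P : Euc n → F) : Prop :=
  ContDiff ℝ (⊤ : ℕ∞) P ∧ ∀ x, iteratedFDeriv ℝ (j + 1) P x = 0

end TestFun

/-- Pointwise application of the operator `𝒜` to a smooth map. -/
def Aapply (n k : ℕ) (A : CoeffOp n k V W) (u : Euc n → V) (x : Euc n) : W :=
  ∑ I : Fin k → Fin n, A I (dirDeriv n k I u x)

/-- `𝒜 u = f σ` (a `W`-valued measure with total-variation measure `σ` and polar density `f`)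
in the sense of distributions. -/
def HasDistribA (n k : ℕ) (A : CoeffOp n k V W) (u : Euc n → V) (σ : Measure (Euc n))
    (f : Euc n → W) : Prop :=
  ∀ φ : Euc n → W, IsTestFun n φ →
    ((-1 : ℝ) ^ k) * (∑ I : Fin k → Fin n,
        ∫ x, ⟪u x, LinearMap.adjoint (A I) (dirDeriv n k I φ x)⟫) =
      ∫ x, ⟪f x, φ x⟫ ∂σ

/-- `u ∈ BV^𝒜_loc(ℝ^n)`: `u` is locally integrable and `𝒜 u` is a `W`-valued Radon measure,
given by its polar decomposition `f σ` with `σ` locally finite and `‖f‖ = 1` σ-a.e. -/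
def MemBVAloc (n k : ℕ) (A : CoeffOp n k V W) (u : Euc n → V) : Prop :=
  LocallyIntegrable u volume ∧
    ∃ (σ : Measure (Euc n)) (f : Euc n → W), IsLocallyFiniteMeasure σ ∧
      LocallyIntegrable f σ ∧ (∀ᵐ x ∂σ, ‖f x‖ = 1) ∧ HasDistribA n k A u σ f

/-- `v` is the family of weak derivatives of order `m` of `u` (componentwise, indexed by
`I : Fin m → Fin n`). -/
def IsWeakDerivFamily (n m : ℕ) (u : Euc n → V) (v : (Fin m → Fin n) → Euc n → V) : Prop :=
  (∀ I, LocallyIntegrable (v I) volume) ∧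
    ∀ (I : Fin m → Fin n) (φ : Euc n → ℝ), IsTestFun n φ →
      ∫ x, (dirDeriv n m I φ x) • u x = ((-1 : ℝ) ^ m) • ∫ x, φ x • v I x

/-- `Q r = o(r^a)` as `r ↓ 0`. -/
def SmallO (Q : ℝ → ℝ≥0∞) (a : ℝ) : Prop :=
  Tendsto (fun r => Q r / ENNReal.ofReal (r ^ a)) (𝓝[>] (0 : ℝ)) (𝓝 0)

section Spaces

variable [NormedAddCommGroup F] [NormedSpace ℝ F]

/-- `f ∈ t^{j,p}(x)`: there is a polynomial `P` of degree at most `j` with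
`(⨍_{B_r(x)} |f - P|^p)^{1/p} = o(r^j)` as `r ↓ 0`. -/
def MemT (n : ℕ) (j : ℕ) (p : ℝ) (f : Euc n → F) (x : Euc n) : Prop :=
  ∃ P : Euc n → F, IsPolyDeg n j P ∧
    SmallO (fun r => ((volume (ball x r))⁻¹ *
      ∫⁻ y in ball x r, (‖f y - P y‖₊ : ℝ≥0∞) ^ p) ^ (1 / p)) (j : ℝ)

/-- `f ∈ t^{j,∞}(x)`: there is a polynomial `P` of degree at most `j` with
`‖f - P‖_{L^∞(B_r(x))} = o(r^j)` as `r ↓ 0`. -/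
def MemTInf (n : ℕ) (j : ℕ) (f : Euc n → F) (x : Euc n) : Prop :=
  ∃ P : Euc n → F, IsPolyDeg n j P ∧
    SmallO (fun r => essSup (fun y => (‖f y - P y‖₊ : ℝ≥0∞))
      (volume.restrict (ball x r))) (j : ℝ)

/-- The Lorentz `L^{p,q}` quasi-norm (for `p, q < ∞`). -/
def lorentzNorm {α : Type*} [MeasurableSpace α] (p q : ℝ) (μ : Measure α) (f : α → F) : ℝ≥0∞ :=
  ENNReal.ofReal p ^ (1 / q) *
    (∫⁻ t in Set.Ioi (0 : ℝ),
      (ENNReal.ofReal t * (μ {x | t < ‖f x‖}) ^ (1 / p)) ^ q * (ENNReal.ofReal t)⁻¹) ^ (1 / q)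

/-- `f` is `L^{p,q}`-differentiable of order `j` at `x`:
`‖f - P‖_{L^{p,q}(B_r(x))} = o(r^{j + n/p})` for a polynomial `P` of degree at most `j`. -/
def MemTLorentz (n : ℕ) (j : ℕ) (p q : ℝ) (f : Euc n → F) (x : Euc n) : Prop :=
  ∃ P : Euc n → F, IsPolyDeg n j P ∧
    SmallO (fun r => lorentzNorm p q (volume.restrict (ball x r)) (fun y => f y - P y))
      ((j : ℝ) + n / p)

/-- `f ∈ L^p_loc`. -/
def LocLp (n : ℕ) (p : ℝ) (f : Euc n → F) : Prop :=
  ∀ K : Set (Euc n), IsCompact K → ∫⁻ x in K, (‖f x‖₊ : ℝ≥0∞) ^ p < ⊤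

end Spaces

end

/-- Combine an index `I : Fin (k-1) → Fin n` with one further direction `b` into an index
`Fin k → Fin n`. -/
def snocIdx (n k : ℕ) (I : Fin (k - 1) → Fin n) (b : Fin n) : Fin k → Fin n :=
  fun i => if h : (i : ℕ) < k - 1 then I ⟨i, h⟩ else b

section Auxiliary

open scoped ContDiff

noncomputable section DiffOp

/-- The space of smooth functions on `ℝ^n`. -/
def SmoothFun (n : ℕ) (F : Type*) [NormedAddCommGroup F] [NormedSpace ℝ F] :
    Submodule ℝ (Euc n → F) where
  carrier := {f | ContDiff ℝ ∞ f}
  add_mem' := fun {a b} ha hb => by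
    change ContDiff ℝ ∞ (a + b)
    exact ContDiff.add (show ContDiff ℝ ∞ a from ha) (show ContDiff ℝ ∞ b from hb)
  zero_mem' := by
    change ContDiff ℝ ∞ (fun _ : Euc n => (0 : F))
    exact contDiff_const
  smul_mem' c f hf := by
    change ContDiff ℝ ∞ (c • f)
    exact ContDiff.const_smul c (show ContDiff ℝ ∞ f from hf)

variable {n : ℕ} {F G : Type*} [NormedAddCommGroup F] [NormedSpace ℝ F]
  [NormedAddCommGroup G] [NormedSpace ℝ G]

theorem smoothFun_contDiff (f : SmoothFun n F) : ContDiff ℝ ∞ (f : Euc n → F) := f.2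

/-- A smooth function as an element of `SmoothFun`. -/
def mkSmooth (f : Euc n → F) (hf : ContDiff ℝ ∞ f) : SmoothFun n F := ⟨f, hf⟩

@[simp] theorem coe_mkSmooth (f : Euc n → F) (hf : ContDiff ℝ ∞ f) :
    (mkSmooth f hf : Euc n → F) = f := rfl

theorem contDiff_fderiv_apply_const {f : Euc n → F} (hf : ContDiff ℝ ∞ f) (v : Euc n) :
    ContDiff ℝ ∞ (fun x => fderiv ℝ f x v) :=
  (hf.fderiv_right (m := ∞) (by simp)).clm_apply contDiff_const

/-- The `i`-th partial derivative on smooth functions. -/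
def partialDeriv (F : Type*) [NormedAddCommGroup F] [NormedSpace ℝ F] (i : Fin n) :
    Module.End ℝ (SmoothFun n F) where
  toFun f := ⟨fun x => fderiv ℝ (f : Euc n → F) x (stdVec n i),
    contDiff_fderiv_apply_const (smoothFun_contDiff f) _⟩
  map_add' f g := by
    ext x
    have hf : DifferentiableAt ℝ (f : Euc n → F) x := ((smoothFun_contDiff f).differentiable (by simp)) x
    have hg : DifferentiableAt ℝ (g : Euc n → F) x := ((smoothFun_contDiff g).differentiable (by simp)) x
    simp [fderiv_add hf hg]
  map_smul' c f := by
    ext x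
    have hf : DifferentiableAt ℝ (f : Euc n → F) x := ((smoothFun_contDiff f).differentiable (by simp)) x
    simp [fderiv_const_smul hf]

theorem fderiv_fderiv_apply_comm {f : Euc n → F} (hf : ContDiff ℝ ∞ f) (v w : Euc n) (x : Euc n) :
    fderiv ℝ (fun y => fderiv ℝ f y v) x w = fderiv ℝ (fun y => fderiv ℝ f y w) x v := by
  have hd : DifferentiableAt ℝ (fderiv ℝ f) x :=
    ((hf.fderiv_right (m := ∞) (by simp)).differentiable (by simp)) x
  have h1 : ∀ v w : Euc n, fderiv ℝ (fun y => fderiv ℝ f y v) x w = fderiv ℝ (fderiv ℝ f) x w v := by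
    intro v w
    rw [fderiv_clm_apply hd (by fun_prop)]
    simp
  rw [h1, h1]
  have : IsSymmSndFDerivAt ℝ f x := by
    apply ContDiffAt.isSymmSndFDerivAt hf.contDiffAt
    simp only [minSmoothness_of_isRCLikeNormedField]
    exact WithTop.coe_le_coe.2 le_top
  exact this.eq w v

theorem partialDeriv_comm (i j : Fin n) :
    partialDeriv F i * partialDeriv F j = partialDeriv F j * partialDeriv F i := by
  ext f x
  exact fderiv_fderiv_apply_comm (smoothFun_contDiff f) _ _ _

open scoped IsMulCommutative in
theorem exists_polyOp (n : ℕ) (F : Type*) [NormedAddCommGroup F] [NormedSpace ℝ F] :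
    ∃ φ : MvPolynomial (Fin n) ℝ →ₐ[ℝ] Module.End ℝ (SmoothFun n F),
      ∀ i, φ (MvPolynomial.X i) = partialDeriv F i := by
  let s : Set (Module.End ℝ (SmoothFun n F)) := Set.range (partialDeriv F)
  have hc : IsMulCommutative (Algebra.adjoin ℝ s) := Algebra.isMulCommutative_adjoin ℝ (by
    rintro _ ⟨i, rfl⟩ _ ⟨j, rfl⟩
    exact partialDeriv_comm i j)
  refine ⟨(Algebra.adjoin ℝ s).val.comp
    (MvPolynomial.aeval (fun i => ⟨partialDeriv F i, Algebra.subset_adjoin ⟨i, rfl⟩⟩)), ?_⟩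
  intro i
  rw [AlgHom.comp_apply, MvPolynomial.aeval_X]
  rfl

/-- The constant coefficient differential operator `q(∂)` acting on smooth functions. -/
def polyOp (n : ℕ) (F : Type*) [NormedAddCommGroup F] [NormedSpace ℝ F] :
    MvPolynomial (Fin n) ℝ →ₐ[ℝ] Module.End ℝ (SmoothFun n F) :=
  (exists_polyOp n F).choose

theorem polyOp_X (i : Fin n) : polyOp n F (MvPolynomial.X i) = partialDeriv F i :=
  (exists_polyOp n F).choose_spec i

open Classical in
/-- `q(∂) f` for a function `f` (zero unless `f` is smooth). -/
def dop (q : MvPolynomial (Fin n) ℝ) (f : Euc n → F) : Euc n → F :=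
  if h : ContDiff ℝ ∞ f then (polyOp n F q (mkSmooth f h) : SmoothFun n F) else 0

theorem dop_of_contDiff (q : MvPolynomial (Fin n) ℝ) {f : Euc n → F} (h : ContDiff ℝ ∞ f) :
    dop q f = (polyOp n F q (mkSmooth f h) : SmoothFun n F) := by
  simp [dop, h]

theorem contDiff_dop (q : MvPolynomial (Fin n) ℝ) (f : Euc n → F) : ContDiff ℝ ∞ (dop q f) := by
  by_cases h : ContDiff ℝ ∞ f
  · rw [dop_of_contDiff q h]; exact smoothFun_contDiff _
  · simp only [dop, h, dif_neg, not_false_iff]; exact contDiff_const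

theorem dop_mul (p q : MvPolynomial (Fin n) ℝ) {f : Euc n → F} (h : ContDiff ℝ ∞ f) :
    dop (p * q) f = dop p (dop q f) := by
  rw [dop_of_contDiff _ h, dop_of_contDiff p (contDiff_dop q f)]
  simp only [map_mul, Module.End.mul_apply]
  congr 2
  apply Subtype.ext
  simp [dop_of_contDiff q h]

theorem dop_X (i : Fin n) {f : Euc n → F} (h : ContDiff ℝ ∞ f) :
    dop (MvPolynomial.X i) f = fun x => fderiv ℝ f x (stdVec n i) := by
  rw [dop_of_contDiff _ h, polyOp_X]; rfl

theorem dop_C (c : ℝ) {f : Euc n → F} (h : ContDiff ℝ ∞ f) :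
    dop (MvPolynomial.C c) f = c • f := by
  rw [dop_of_contDiff _ h, ← MvPolynomial.algebraMap_eq, AlgHom.commutes]
  simp [Algebra.algebraMap_eq_smul_one]

theorem dop_poly_add (p q : MvPolynomial (Fin n) ℝ) (f : Euc n → F) :
    dop (p + q) f = dop p f + dop q f := by
  by_cases h : ContDiff ℝ ∞ f
  · simp [dop_of_contDiff _ h]
  · simp [dop, h]

theorem dop_poly_smul (c : ℝ) (q : MvPolynomial (Fin n) ℝ) (f : Euc n → F) :
    dop (c • q) f = c • dop q f := by
  by_cases h : ContDiff ℝ ∞ f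
  · simp [dop_of_contDiff _ h]
  · simp [dop, h]

theorem dop_poly_sum {ι : Type*} (s : Finset ι) (q : ι → MvPolynomial (Fin n) ℝ) (f : Euc n → F) :
    dop (∑ i ∈ s, q i) f = ∑ i ∈ s, dop (q i) f := by
  by_cases h : ContDiff ℝ ∞ f
  · simp [dop_of_contDiff _ h]
  · simp [dop, h]

theorem dop_add (q : MvPolynomial (Fin n) ℝ) {f g : Euc n → F} (hf : ContDiff ℝ ∞ f)
    (hg : ContDiff ℝ ∞ g) : dop q (f + g) = dop q f + dop q g := by
  have h : ContDiff ℝ ∞ (f + g) := hf.add hg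
  rw [dop_of_contDiff _ hf, dop_of_contDiff _ hg, dop_of_contDiff _ h]
  rw [← Submodule.coe_add, ← map_add]; rfl

theorem dop_smul (q : MvPolynomial (Fin n) ℝ) (c : ℝ) {f : Euc n → F} (hf : ContDiff ℝ ∞ f) :
    dop q (c • f) = c • dop q f := by
  have h : ContDiff ℝ ∞ (c • f) := hf.const_smul c
  rw [dop_of_contDiff _ hf, dop_of_contDiff _ h]
  rw [← Submodule.coe_smul, ← map_smul]; rfl

theorem dop_clm_comp (L : F →L[ℝ] G) (q : MvPolynomial (Fin n) ℝ) :
    ∀ {f : Euc n → F}, ContDiff ℝ ∞ f → dop q (fun x => L (f x)) = fun x => L (dop q f x) := by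
  induction q using MvPolynomial.induction_on with
  | C c =>
    intro f hf
    have hLf : ContDiff ℝ ∞ (fun x => L (f x)) := L.contDiff.comp hf
    rw [dop_C c hf, dop_C c hLf]; ext x; simp
  | add p q hp hq =>
    intro f hf
    ext x
    simp [dop_poly_add, hp hf, hq hf]
  | mul_X p i hp =>
    intro f hf
    have hLf : ContDiff ℝ ∞ (fun x => L (f x)) := L.contDiff.comp hf
    rw [dop_mul _ _ hLf, dop_mul _ _ hf, dop_X _ hLf, dop_X _ hf, ← hp (contDiff_fderiv_apply_const hf _)]
    congr 1
    ext x
    have : HasFDerivAt (fun x => L (f x)) (L.comp (fderiv ℝ f x)) x :=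
      L.hasFDerivAt.comp x ((hf.differentiable (by simp)) x).hasFDerivAt
    rw [this.fderiv]; rfl

theorem dop_congr_of_eventuallyEq (q : MvPolynomial (Fin n) ℝ) {x : Euc n} :
    ∀ {f g : Euc n → F}, ContDiff ℝ ∞ f → ContDiff ℝ ∞ g → f =ᶠ[𝓝 x] g → dop q f =ᶠ[𝓝 x] dop q g := by
  induction q using MvPolynomial.induction_on with
  | C c =>
    intro f g hf hg h
    rw [dop_C c hf, dop_C c hg]
    exact h.const_smul c
  | add p q hp hq =>
    intro f g hf hg h
    rw [dop_poly_add, dop_poly_add]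
    exact (hp hf hg h).add (hq hf hg h)
  | mul_X p i hp =>
    intro f g hf hg h
    rw [dop_mul _ _ hf, dop_mul _ _ hg, dop_X _ hf, dop_X _ hg]
    apply hp (contDiff_fderiv_apply_const hf _) (contDiff_fderiv_apply_const hg _)
    filter_upwards [h.fderiv (𝕜 := ℝ)] with y hy
    rw [hy]

theorem dop_zero (q : MvPolynomial (Fin n) ℝ) : dop q (0 : Euc n → F) = 0 := by
  simpa using dop_smul q (0:ℝ) (f := (0 : Euc n → F)) contDiff_const

theorem tsupport_dop_subset (q : MvPolynomial (Fin n) ℝ) {f : Euc n → F} (hf : ContDiff ℝ ∞ f) :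
    tsupport (dop q f) ⊆ tsupport f := by
  intro x hx
  by_contra hxf
  rw [notMem_tsupport_iff_eventuallyEq] at hxf
  have h0 : ContDiff ℝ ∞ (0 : Euc n → F) := contDiff_const
  have := dop_congr_of_eventuallyEq q hf h0 hxf
  rw [dop_zero, ← notMem_tsupport_iff_eventuallyEq] at this
  exact this hx

theorem HasCompactSupport.dop (q : MvPolynomial (Fin n) ℝ) {f : Euc n → F} (hc : HasCompactSupport f) :
    HasCompactSupport (dop q f) := by
  by_cases hf : ContDiff ℝ ∞ f
  · exact hc.of_isClosed_subset (isClosed_tsupport _) (tsupport_dop_subset q hf)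
  · simp only [_root_.dop, hf, dif_neg, not_false_iff]; exact HasCompactSupport.zero

theorem fderiv_comp_affine (t : ℝ) (y v : Euc n) {f : Euc n → F} (hf : ContDiff ℝ ∞ f) (x : Euc n) :
    fderiv ℝ (fun x => f (y + t • x)) x v = t • fderiv ℝ f (y + t • x) v := by
  have h1 : HasFDerivAt (fun x : Euc n => y + t • x) (t • ContinuousLinearMap.id ℝ (Euc n)) x :=
    ((hasFDerivAt_id x).const_smul t).const_add y
  have := ((hf.differentiable (by simp)) (y + t • x)).hasFDerivAt.comp x h1
  have h2 := this.fderiv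
  simp only [Function.comp_def] at h2
  rw [h2]
  simp

theorem contDiff_comp_affine (t : ℝ) (y : Euc n) {f : Euc n → F} (hf : ContDiff ℝ ∞ f) :
    ContDiff ℝ ∞ (fun x => f (y + t • x)) := by
  exact hf.comp (contDiff_const.add (contDiff_id.const_smul t))

theorem dop_prod_X_comp_affine (l : List (Fin n)) (t : ℝ) (y : Euc n) :
    ∀ {f : Euc n → F}, ContDiff ℝ ∞ f →
    dop (l.map MvPolynomial.X).prod (fun x => f (y + t • x)) =
      fun x => t ^ l.length • dop (l.map MvPolynomial.X).prod f (y + t • x) := by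
  induction l with
  | nil =>
    intro f hf
    have := contDiff_comp_affine t y hf
    simp only [List.map_nil, List.prod_nil, ← map_one (MvPolynomial.C (σ := Fin n) (R := ℝ))]
    rw [dop_C 1 this, dop_C 1 hf]
    simp
  | cons i l ih =>
    intro f hf
    have h1 := contDiff_comp_affine t y hf
    have h2 := contDiff_fderiv_apply_const hf (stdVec n i)
    have h3 := contDiff_comp_affine t y h2
    simp only [List.map_cons, List.prod_cons, List.length_cons]
    rw [mul_comm, dop_mul _ _ h1, dop_mul _ _ hf, dop_X _ h1, dop_X _ hf]
    simp_rw [fderiv_comp_affine t y _ hf]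
    have := dop_smul (l.map MvPolynomial.X).prod t h3
    simp only [Pi.smul_def] at this
    rw [this, ih h2]
    ext x
    simp only [smul_smul, pow_succ']

theorem exists_list_prod_X_eq_monomial (d : Fin n →₀ ℕ) :
    ∃ l : List (Fin n), (l.map (MvPolynomial.X (R := ℝ))).prod = MvPolynomial.monomial d 1 ∧
      l.length = d.degree := by
  induction d using Finsupp.induction_linear with
  | zero => exact ⟨[], by simp, by simp⟩
  | add f g hf hg =>
    obtain ⟨l, hl, hl'⟩ := hf
    obtain ⟨l2, hl2, hl2'⟩ := hg
    exact ⟨l ++ l2, by simp [hl, hl2, MvPolynomial.monomial_mul], by simp [hl', hl2']⟩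
  | single i k =>
    exact ⟨List.replicate k i, by simp [MvPolynomial.X_pow_eq_monomial], by simp⟩

theorem mem_span_list_prod_X {q : MvPolynomial (Fin n) ℝ} {m : ℕ} (hq : q.IsHomogeneous m) :
    q ∈ Submodule.span ℝ {r | ∃ l : List (Fin n), l.length = m ∧
      (l.map (MvPolynomial.X (R := ℝ))).prod = r} := by
  rw [q.as_sum]
  refine Submodule.sum_mem _ fun d hd => ?_
  have hdeg : d.degree = m := by
    have := hq (MvPolynomial.mem_support_iff.1 hd)
    rw [← this, Finsupp.degree_eq_weight_one]; rfl
  obtain ⟨l, hl, hl'⟩ := exists_list_prod_X_eq_monomial d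
  have h2 : MvPolynomial.monomial d (q.coeff d) =
      q.coeff d • (l.map (MvPolynomial.X (R := ℝ))).prod := by
    rw [hl, MvPolynomial.smul_monomial]; simp
  rw [h2]
  exact Submodule.smul_mem _ _ (Submodule.subset_span ⟨l, hl'.trans hdeg, rfl⟩)

theorem dop_poly_zero (f : Euc n → F) : dop (0 : MvPolynomial (Fin n) ℝ) f = 0 := by
  simpa using dop_poly_smul (0 : ℝ) 0 f

/-- Affine changes of variables. -/
theorem dop_comp_affine (q : MvPolynomial (Fin n) ℝ) {m : ℕ} (hq : q.IsHomogeneous m) (t : ℝ)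
    (y : Euc n) {f : Euc n → F} (hf : ContDiff ℝ ∞ f) :
    dop q (fun x => f (y + t • x)) = fun x => t ^ m • dop q f (y + t • x) := by
  have hs := mem_span_list_prod_X hq
  clear hq
  induction hs using Submodule.span_induction with
  | mem r hr =>
    obtain ⟨l, hl, rfl⟩ := hr
    rw [dop_prod_X_comp_affine l t y hf, hl]
  | zero => ext x; simp [dop_poly_zero]
  | add p q _ _ hp hq => ext x; simp [dop_poly_add, hp, hq]
  | smul c p _ hp => ext x; simp only [dop_poly_smul, hp, Pi.smul_apply]; rw [smul_comm]

theorem dirDeriv_eq_dop {m : ℕ} (I : Fin m → Fin n) : ∀ {f : Euc n → F}, ContDiff ℝ ∞ f →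
    dirDeriv n m I f = dop (∏ i, MvPolynomial.X (I i)) f := by
  induction m with
  | zero =>
    intro f hf
    ext x
    simp only [dirDeriv, iteratedFDeriv_zero_apply, Finset.univ_eq_empty, Finset.prod_empty]
    rw [← map_one (MvPolynomial.C (σ := Fin n) (R := ℝ)), dop_C 1 hf]
    simp
  | succ m ih =>
    intro f hf
    ext x
    simp only [dirDeriv]
    rw [iteratedFDeriv_succ_apply_right, Fin.prod_univ_castSucc, dop_mul _ _ hf, dop_X _ hf,
      ← ih (fun i => I i.castSucc) (contDiff_fderiv_apply_const hf _)]
    simp only [dirDeriv]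
    have : (fun x => fderiv ℝ f x (stdVec n (I (Fin.last m)))) =
      (ContinuousLinearMap.apply ℝ F (stdVec n (I (Fin.last m)))) ∘ (fderiv ℝ f) := rfl
    rw [this, ContinuousLinearMap.iteratedFDeriv_comp_left _
      (hf.fderiv_right (m := ∞) (by simp)).contDiffAt (by exact_mod_cast le_top)]
    rfl

end DiffOp

noncomputable section ShiftAverages

variable {n : ℕ} {F G : Type*} [NormedAddCommGroup F] [NormedSpace ℝ F]
  [NormedAddCommGroup G] [NormedSpace ℝ G]

theorem IsTestFun.contDiff {h : Euc n → F} (hh : IsTestFun n h) : ContDiff ℝ ∞ h := hh.1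

theorem IsTestFun.continuous {h : Euc n → F} (hh : IsTestFun n h) : Continuous h :=
  hh.1.continuous

theorem IsTestFun.differentiable {h : Euc n → F} (hh : IsTestFun n h) : Differentiable ℝ h :=
  hh.1.differentiable (by simp)

theorem IsTestFun.exists_bound {h : Euc n → F} (hh : IsTestFun n h) :
    ∃ C : ℝ, 0 ≤ C ∧ ∀ x, ‖h x‖ ≤ C := by
  obtain ⟨C, hC⟩ := hh.2.exists_bound_of_continuous hh.continuous
  exact ⟨C, (norm_nonneg _).trans (hC 0), hC⟩

theorem IsTestFun.integrable {h : Euc n → F} (hh : IsTestFun n h) : Integrable h :=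
  hh.continuous.integrable_of_hasCompactSupport hh.2

theorem IsTestFun.fderiv {h : Euc n → F} (hh : IsTestFun n h) : IsTestFun n (fderiv ℝ h) :=
  ⟨hh.contDiff.fderiv_right (m := ∞) (by simp), hh.2.fderiv (𝕜 := ℝ)⟩

theorem IsTestFun.dop (q : MvPolynomial (Fin n) ℝ) {h : Euc n → F} (hh : IsTestFun n h) :
    IsTestFun n (dop q h) :=
  ⟨contDiff_dop q h, HasCompactSupport.dop q hh.2⟩

theorem IsTestFun.exists_support_subset {h : Euc n → F} (hh : IsTestFun n h) :
    ∃ R : ℝ, 0 < R ∧ ∀ x, h x ≠ 0 → ‖x‖ ≤ R := by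
  obtain ⟨R, hR⟩ := hh.2.isCompact.isBounded.subset_closedBall 0
  refine ⟨max R 1, by positivity, fun x hx => ?_⟩
  have := hR (subset_tsupport _ hx)
  rw [mem_closedBall_zero_iff] at this
  exact this.trans (le_max_left _ _)

theorem isTestFun_of_support {h : Euc n → F} (hh : ContDiff ℝ ∞ h) {R : ℝ}
    (hR : ∀ x, h x ≠ 0 → ‖x‖ ≤ R) : IsTestFun n h := by
  refine ⟨hh, HasCompactSupport.intro (isCompact_closedBall (0 : Euc n) R) fun x hx => ?_⟩
  by_contra h0
  exact hx (by simpa using hR x h0)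

theorem IsTestFun.add {g h : Euc n → F} (hg : IsTestFun n g) (hh : IsTestFun n h) :
    IsTestFun n (g + h) := ⟨hg.1.add hh.1, hg.2.add hh.2⟩

theorem IsTestFun.const_smul (c : ℝ) {h : Euc n → F} (hh : IsTestFun n h) :
    IsTestFun n (c • h) := by
  refine ⟨hh.1.const_smul c, ?_⟩
  exact hh.2.smul_left (f := fun _ => c)

theorem IsTestFun.mul {g h : Euc n → ℝ} (hg : ContDiff ℝ ∞ g) (hh : IsTestFun n h) :
    IsTestFun n (fun x => g x * h x) := ⟨hg.mul hh.1, hh.2.mul_left⟩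

/-- Superposition of translates of `h`. -/
def shiftAvg {Z : Type*} [MeasurableSpace Z] (ν : Measure Z) (g : Z → ℝ) (θ : Z → Euc n)
    (h : Euc n → F) (y : Euc n) : F :=
  ∫ z, g z • h (y - θ z) ∂ν

variable {Z : Type*} [MeasurableSpace Z] {ν : Measure Z} {g : Z → ℝ} {θ : Z → Euc n}

theorem integrable_shiftAvg (hg : Integrable g ν) (hθ : Measurable θ) {h : Euc n → F}
    (hh : IsTestFun n h) (y : Euc n) : Integrable (fun z => g z • h (y - θ z)) ν := by
  obtain ⟨C, -, hC⟩ := hh.exists_bound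
  have hm : AEStronglyMeasurable (fun z => h (y - θ z)) ν :=
    (hh.continuous.stronglyMeasurable_of_hasCompactSupport hh.2).comp_measurable
      (measurable_const.sub hθ) |>.aestronglyMeasurable
  refine (hg.norm.mul_const C).mono' (hg.aestronglyMeasurable.smul hm) ?_
  filter_upwards with z
  rw [norm_smul]
  exact mul_le_mul_of_nonneg_left (hC _) (norm_nonneg _)

theorem hasFDerivAt_shiftAvg (hg : Integrable g ν) (hθ : Measurable θ) {h : Euc n → F}
    (hh : IsTestFun n h) (y : Euc n) :
    HasFDerivAt (shiftAvg ν g θ h) (shiftAvg ν g θ (fderiv ℝ h) y) y := by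
  obtain ⟨C, -, hC⟩ := hh.fderiv.exists_bound
  refine hasFDerivAt_integral_of_dominated_of_fderiv_le (F := fun y z => g z • h (y - θ z))
    (F' := fun y z => g z • fderiv ℝ h (y - θ z)) (bound := fun z => ‖g z‖ * C) univ_mem
    (Eventually.of_forall fun y => (integrable_shiftAvg hg hθ hh y).aestronglyMeasurable)
    (integrable_shiftAvg hg hθ hh y) (integrable_shiftAvg hg hθ hh.fderiv y).aestronglyMeasurable
    ?_ (hg.norm.mul_const C) ?_
  · filter_upwards with z y _
    rw [norm_smul]
    exact mul_le_mul_of_nonneg_left (hC _) (norm_nonneg _)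
  · filter_upwards with z y _
    have := (hh.differentiable (y - θ z)).hasFDerivAt.comp y
      ((hasFDerivAt_id y).sub_const (θ z))
    exact (this.const_smul (g z))

theorem contDiff_shiftAvg (hg : Integrable g ν) (hθ : Measurable θ) {h : Euc n → F}
    (hh : IsTestFun n h) : ContDiff ℝ ∞ (shiftAvg ν g θ h) := by
  rw [contDiff_infty]
  intro k
  induction k generalizing F with
  | zero =>
    rw [CharP.cast_eq_zero, contDiff_zero, continuous_iff_continuousAt]
    exact fun y => (hasFDerivAt_shiftAvg hg hθ hh y).continuousAt
  | succ k ih =>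
    push_cast
    rw [contDiff_succ_iff_hasFDerivAt]
    exact ⟨_, ih hh.fderiv, hasFDerivAt_shiftAvg hg hθ hh⟩

theorem shiftAvg_clm_apply (hg : Integrable g ν) (hθ : Measurable θ) [CompleteSpace F]
    [CompleteSpace G]
    (L : F →L[ℝ] G) {h : Euc n → F} (hh : IsTestFun n h) (y : Euc n) :
    L (shiftAvg ν g θ h y) = shiftAvg ν g θ (fun x => L (h x)) y := by
  unfold shiftAvg
  rw [← L.integral_comp_comm (integrable_shiftAvg hg hθ hh y)]
  simp

theorem shiftAvg_smul (c : ℝ) (h : Euc n → F) (y : Euc n) :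
    shiftAvg ν g θ (c • h) y = c • shiftAvg ν g θ h y := by
  unfold shiftAvg
  rw [← integral_smul]
  simp only [Pi.smul_apply, smul_comm c]

theorem shiftAvg_add (hg : Integrable g ν) (hθ : Measurable θ) {h k : Euc n → F}
    (hh : IsTestFun n h) (hk : IsTestFun n k) (y : Euc n) :
    shiftAvg ν g θ (h + k) y = shiftAvg ν g θ h y + shiftAvg ν g θ k y := by
  unfold shiftAvg
  rw [← integral_add (integrable_shiftAvg hg hθ hh y) (integrable_shiftAvg hg hθ hk y)]
  simp

theorem shiftAvg_sub (hg : Integrable g ν) (hθ : Measurable θ) {h k : Euc n → F}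
    (hh : IsTestFun n h) (hk : IsTestFun n k) (y : Euc n) :
    shiftAvg ν g θ (h - k) y = shiftAvg ν g θ h y - shiftAvg ν g θ k y := by
  unfold shiftAvg
  rw [← integral_sub (integrable_shiftAvg hg hθ hh y) (integrable_shiftAvg hg hθ hk y)]
  simp [smul_sub]

theorem dop_shiftAvg (hg : Integrable g ν) (hθ : Measurable θ) (q : MvPolynomial (Fin n) ℝ) :
    ∀ {h : Euc n → ℝ}, IsTestFun n h → dop q (shiftAvg ν g θ h) = shiftAvg ν g θ (dop q h) := by
  induction q using MvPolynomial.induction_on with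
  | C c =>
    intro h hh
    rw [dop_C c (contDiff_shiftAvg hg hθ hh), dop_C c hh.contDiff]
    ext y
    rw [shiftAvg_smul, Pi.smul_apply]
  | add p q hp hq =>
    intro h hh
    ext y
    rw [dop_poly_add, dop_poly_add, shiftAvg_add hg hθ (hh.dop p) (hh.dop q), hp hh, hq hh]
    rfl
  | mul_X p i hp =>
    intro h hh
    have h1 : (fun x => fderiv ℝ (shiftAvg ν g θ h) x (stdVec n i)) =
        shiftAvg ν g θ (dop (MvPolynomial.X i) h) := by
      ext y
      rw [(hasFDerivAt_shiftAvg hg hθ hh y).fderiv, dop_X _ hh.contDiff]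
      exact shiftAvg_clm_apply hg hθ (ContinuousLinearMap.apply ℝ ℝ (stdVec n i)) hh.fderiv y
    rw [dop_mul _ _ (contDiff_shiftAvg hg hθ hh), dop_mul _ _ hh.contDiff,
      dop_X _ (contDiff_shiftAvg hg hθ hh), h1, hp (hh.dop _)]

theorem isTestFun_shiftAvg (hg : Integrable g ν) (hθ : Measurable θ) {h : Euc n → F}
    (hh : IsTestFun n h) {R : ℝ} (hR : ∀ᵐ z ∂ν, g z ≠ 0 → ‖θ z‖ ≤ R) :
    IsTestFun n (shiftAvg ν g θ h) := by
  obtain ⟨S, -, hS⟩ := hh.exists_support_subset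
  refine isTestFun_of_support (contDiff_shiftAvg hg hθ hh) (R := R + S) fun y hy => ?_
  by_contra hlt
  apply hy
  unfold shiftAvg
  rw [integral_eq_zero_of_ae]
  filter_upwards [hR] with z hz
  by_cases hgz : g z = 0
  · simp [hgz]
  · by_cases hz2 : h (y - θ z) = 0
    · simp [hz2]
    · exfalso
      have h1 := hS _ hz2
      have h2 := hz hgz
      have h3 : ‖y‖ ≤ ‖y - θ z‖ + ‖θ z‖ := by simpa using norm_add_le (y - θ z) (θ z)
      linarith

/-- Integration by parts for constant coefficient operators. -/
theorem integral_dop_mul {q : MvPolynomial (Fin n) ℝ} {m : ℕ} (hq : q.IsHomogeneous m)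
    {f g : Euc n → ℝ} (hf : IsTestFun n f) (hg : ContDiff ℝ ∞ g) :
    ∫ x, dop q f x * g x = (-1) ^ m * ∫ x, f x * dop q g x := by
  have hI : ∀ {f g : Euc n → ℝ}, IsTestFun n f → ContDiff ℝ ∞ g →
      Integrable (fun x => f x * g x) := by
    intro f g hf hg
    exact (hf.continuous.mul hg.continuous).integrable_of_hasCompactSupport hf.2.mul_right
  have hs := mem_span_list_prod_X hq
  clear hq
  induction hs using Submodule.span_induction with
  | mem r hr =>
    obtain ⟨l, hl, rfl⟩ := hr
    subst hl
    induction l generalizing f g with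
    | nil =>
      simp only [List.map_nil, List.prod_nil, ← map_one (MvPolynomial.C (σ := Fin n) (R := ℝ))]
      rw [dop_C 1 hf.contDiff, dop_C 1 hg]
      simp
    | cons i l ih =>
      simp only [List.map_cons, List.prod_cons, List.length_cons]
      have hg1 := contDiff_fderiv_apply_const hg (stdVec n i)
      have hf1 : IsTestFun n (fun x => fderiv ℝ f x (stdVec n i)) := by
        rw [← dop_X i hf.contDiff]; exact hf.dop _
      have e1 : dop (MvPolynomial.X i * (l.map MvPolynomial.X).prod) f =
          dop (l.map MvPolynomial.X).prod (fun x => fderiv ℝ f x (stdVec n i)) := by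
        rw [mul_comm, dop_mul _ _ hf.contDiff, dop_X _ hf.contDiff]
      rw [e1, ih hf1 hg, dop_mul _ _ hg, dop_X _ (contDiff_dop _ _),
        integral_mul_fderiv_eq_neg_fderiv_mul_of_integrable]
      · rw [pow_succ]; ring
      · exact hI hf1 (contDiff_dop _ _)
      · exact hI hf (contDiff_fderiv_apply_const (contDiff_dop _ _) _)
      · exact hI hf (contDiff_dop _ _)
      · exact fun x _ => hf.differentiable x
      · exact fun x _ => (contDiff_dop _ g).differentiable (by simp) x
  | zero => simp [dop_poly_zero]
  | add p q _ _ hp hq =>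
    simp only [dop_poly_add, Pi.add_apply, add_mul, mul_add]
    rw [integral_add (hI (hf.dop _) hg) (hI (hf.dop _) hg),
      integral_add (hI hf (contDiff_dop _ _)) (hI hf (contDiff_dop _ _)), hp, hq]
    ring
  | smul c p _ hp =>
    simp only [dop_poly_smul, Pi.smul_apply, smul_eq_mul, mul_assoc, mul_left_comm _ c]
    rw [integral_const_mul, integral_const_mul, hp]
    ring

/-- The radial derivative `x · ∇ f`. -/
def radial (f : Euc n → F) (x : Euc n) : F := fderiv ℝ f x x

theorem contDiff_radial {f : Euc n → F} (hf : ContDiff ℝ ∞ f) : ContDiff ℝ ∞ (radial f) :=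
  (hf.fderiv_right (m := ∞) (by simp)).clm_apply contDiff_id

theorem fderiv_radial {f : Euc n → F} (hf : ContDiff ℝ ∞ f) (v x : Euc n) :
    fderiv ℝ (radial f) x v = radial (fun y => fderiv ℝ f y v) x + fderiv ℝ f x v := by
  have hd : DifferentiableAt ℝ (fderiv ℝ f) x :=
    ((hf.fderiv_right (m := ∞) (by simp)).differentiable (by simp)) x
  have h1 : fderiv ℝ (radial f) x v = fderiv ℝ (fderiv ℝ f) x v x + fderiv ℝ f x v := by
    unfold radial
    rw [fderiv_clm_apply hd (by fun_prop)]
    simp [add_comm]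
  rw [h1, radial, fderiv_fderiv_apply_comm hf v x x]
  congr 1
  rw [fderiv_clm_apply hd (by fun_prop)]
  simp

theorem radial_add {f g : Euc n → F} (hf : ContDiff ℝ ∞ f) (hg : ContDiff ℝ ∞ g) :
    radial (f + g) = radial f + radial g := by
  ext x
  simp [radial, fderiv_add (hf.differentiable (by simp) x) (hg.differentiable (by simp) x)]

theorem radial_smul (c : ℝ) {f : Euc n → F} (hf : ContDiff ℝ ∞ f) :
    radial (c • f) = c • radial f := by
  ext x
  simp [radial, fderiv_const_smul (hf.differentiable (by simp) x)]

/-- Euler commutator identity. -/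
theorem dop_radial {q : MvPolynomial (Fin n) ℝ} {m : ℕ} (hq : q.IsHomogeneous m)
    {f : Euc n → F} (hf : ContDiff ℝ ∞ f) :
    dop q (radial f) = radial (dop q f) + (m : ℝ) • dop q f := by
  have hs := mem_span_list_prod_X hq
  clear hq
  induction hs using Submodule.span_induction with
  | mem r hr =>
    obtain ⟨l, hl, rfl⟩ := hr
    subst hl
    induction l generalizing f with
    | nil =>
      simp only [List.map_nil, List.prod_nil, ← map_one (MvPolynomial.C (σ := Fin n) (R := ℝ))]
      rw [dop_C 1 hf, dop_C 1 (contDiff_radial hf)]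
      simp
    | cons i l ih =>
      simp only [List.map_cons, List.prod_cons, List.length_cons]
      have hf1 := contDiff_fderiv_apply_const hf (stdVec n i)
      have h2 : (fun x => fderiv ℝ (radial f) x (stdVec n i)) =
          radial (fun x => fderiv ℝ f x (stdVec n i)) + fun x => fderiv ℝ f x (stdVec n i) := by
        ext x; exact fderiv_radial hf _ _
      rw [mul_comm, dop_mul _ _ (contDiff_radial hf), dop_mul _ _ hf, dop_X _ hf,
        dop_X _ (contDiff_radial hf), h2, dop_add _ (contDiff_radial hf1) hf1, ih hf1]
      push_cast
      rw [add_smul, one_smul, add_assoc]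
  | zero =>
    simp only [dop_poly_zero]
    ext x; simp [radial]
  | add p q _ _ hp hq =>
    simp only [dop_poly_add, hp, hq, radial_add (contDiff_dop _ _) (contDiff_dop _ _), smul_add]
    abel
  | smul c p _ hp =>
    simp only [dop_poly_smul, hp, radial_smul _ (contDiff_dop _ _), smul_add]
    rw [smul_comm]

theorem radial_eq_sum (f : Euc n → F) (x : Euc n) :
    radial f x = ∑ i, x i • fderiv ℝ f x (stdVec n i) := by
  have : x = ∑ i, x i • stdVec n i := by
    ext j
    simp [stdVec, Pi.single_apply]
  conv_lhs => rw [radial]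
  conv_lhs => arg 2; rw [this]
  simp

/-- Integration by parts for the divergence `n φ + x · ∇ φ`. -/
theorem integral_radial_mul {f g : Euc n → ℝ} (hf : IsTestFun n f) (hg : ContDiff ℝ ∞ g) :
    ∫ x, (n * f x + radial f x) * g x = - ∫ x, f x * radial g x := by
  have hI : ∀ {f g : Euc n → ℝ}, IsTestFun n f → ContDiff ℝ ∞ g →
      Integrable (fun x => f x * g x) := by
    intro f g hf hg
    exact (hf.continuous.mul hg.continuous).integrable_of_hasCompactSupport hf.2.mul_right
  have hc : ∀ i : Fin n, ContDiff ℝ ∞ (fun x : Euc n => x i) := fun i =>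
    (EuclideanSpace.proj (𝕜 := ℝ) i).contDiff
  have hcf : ∀ i : Fin n, IsTestFun n (fun x : Euc n => x i * f x) := fun i => hf.mul (hc i)
  have hd : ∀ (i : Fin n) (x : Euc n), fderiv ℝ (fun x : Euc n => x i * f x) x (stdVec n i) =
      f x + x i * fderiv ℝ f x (stdVec n i) := by
    intro i x
    have h1 : HasFDerivAt (fun x : Euc n => x i) (EuclideanSpace.proj (𝕜 := ℝ) i) x :=
      (EuclideanSpace.proj (𝕜 := ℝ) i).hasFDerivAt
    have h2 : HasFDerivAt (fun x : Euc n => x i * f x) _ x :=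
      h1.mul (hf.differentiable x).hasFDerivAt
    rw [h2.fderiv]
    simp [stdVec]
    ring
  have key : ∀ i : Fin n, ∫ x, (x i * f x) * fderiv ℝ g x (stdVec n i) =
      - ∫ x, (f x + x i * fderiv ℝ f x (stdVec n i)) * g x := by
    intro i
    have hdd : IsTestFun n (fun x => fderiv ℝ (fun x : Euc n => x i * f x) x (stdVec n i)) := by
      rw [← dop_X i (hcf i).contDiff]; exact (hcf i).dop _
    rw [integral_mul_fderiv_eq_neg_fderiv_mul_of_integrable]
    · simp_rw [hd]
    · exact hI hdd hg
    · exact hI (hcf i) (contDiff_fderiv_apply_const hg _)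
    · exact hI (hcf i) hg
    · exact fun x _ => (hcf i).differentiable x
    · exact fun x _ => hg.differentiable (by simp) x
  have h1 : ∀ x, f x * radial g x = ∑ i, (x i * f x) * fderiv ℝ g x (stdVec n i) := by
    intro x
    rw [radial_eq_sum, Finset.mul_sum]
    refine Finset.sum_congr rfl fun i _ => ?_
    simp only [smul_eq_mul]; ring
  have h2 : ∀ x, (n * f x + radial f x) * g x =
      ∑ i, (f x + x i * fderiv ℝ f x (stdVec n i)) * g x := by
    intro x
    rw [radial_eq_sum, ← Finset.sum_mul, Finset.sum_add_distrib]
    simp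
  simp_rw [h1, h2]
  rw [integral_finsetSum, integral_finsetSum, ← Finset.sum_neg_distrib]
  · refine Finset.sum_congr rfl fun i _ => ?_
    rw [key i, neg_neg]
  · exact fun i _ => hI (hcf i) (contDiff_fderiv_apply_const hg _)
  · intro i _
    have hdd : IsTestFun n (fun x => fderiv ℝ (fun x : Euc n => x i * f x) x (stdVec n i)) := by
      rw [← dop_X i (hcf i).contDiff]; exact (hcf i).dop _
    have := hI hdd hg
    simpa only [hd] using this

end ShiftAverages

noncomputable section Representation

variable {n : ℕ}

/-- Averages of translates of `h` at scale `t` with weight `κ`. -/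
def avg (κ : Euc n → ℝ) (t : ℝ) (h : Euc n → ℝ) : Euc n → ℝ :=
  shiftAvg volume κ (fun x => t • x) h

/-- The operator `∫_0^δ t^m avg M t dt`. -/
def eop (M : Euc n → ℝ) (m : ℕ) (δ : ℝ) (h : Euc n → ℝ) : Euc n → ℝ :=
  shiftAvg ((volume.restrict (Set.Ioc 0 δ)).prod volume)
    (fun z : ℝ × Euc n => z.1 ^ m * M z.2) (fun z => z.1 • z.2) h

theorem avg_apply (κ : Euc n → ℝ) (t : ℝ) (h : Euc n → ℝ) (y : Euc n) :
    avg κ t h y = ∫ x, κ x * h (y - t • x) := rfl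

theorem integrable_avg {κ h : Euc n → ℝ} (hκ : IsTestFun n κ) (hh : IsTestFun n h) (t : ℝ)
    (y : Euc n) : Integrable (fun x => κ x * h (y - t • x)) :=
  integrable_shiftAvg hκ.integrable (measurable_const_smul t) hh y

theorem isTestFun_avg {κ h : Euc n → ℝ} (hκ : IsTestFun n κ) (hh : IsTestFun n h) (t : ℝ) :
    IsTestFun n (avg κ t h) := by
  obtain ⟨R, -, hR⟩ := hκ.exists_support_subset
  refine isTestFun_shiftAvg hκ.integrable (measurable_const_smul t) hh (R := |t| * R)
    (Eventually.of_forall fun x hx => ?_)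
  rw [norm_smul]
  exact mul_le_mul_of_nonneg_left (hR x hx) (abs_nonneg t)

theorem integrable_eop_weight {M : Euc n → ℝ} (hM : IsTestFun n M) (m : ℕ) (δ : ℝ) :
    Integrable (fun z : ℝ × Euc n => z.1 ^ m * M z.2)
      ((volume.restrict (Set.Ioc 0 δ)).prod volume) := by
  refine Integrable.mul_prod (f := fun t : ℝ => t ^ m) (g := M) ?_ hM.integrable
  exact ((continuous_pow m).integrableOn_Icc (a := 0) (b := δ)).mono_set Set.Ioc_subset_Icc_self

theorem measurable_scale : Measurable (fun z : ℝ × Euc n => z.1 • z.2) :=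
  (continuous_fst.smul continuous_snd).measurable

theorem isTestFun_eop {M h : Euc n → ℝ} (hM : IsTestFun n M) (hh : IsTestFun n h) (m : ℕ)
    (δ : ℝ) : IsTestFun n (eop M m δ h) := by
  obtain ⟨R, hR0, hR⟩ := hM.exists_support_subset
  refine isTestFun_shiftAvg (integrable_eop_weight hM m δ) measurable_scale hh (R := |δ| * R) ?_
  have : ∀ᵐ z : ℝ × Euc n ∂((volume.restrict (Set.Ioc 0 δ)).prod volume), z.1 ∈ Set.Ioc 0 δ := by
    refine Measure.quasiMeasurePreserving_fst.ae ?_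
    exact ae_restrict_mem measurableSet_Ioc
  filter_upwards [this] with z hz hz2
  have hM0 : M z.2 ≠ 0 := right_ne_zero_of_mul hz2
  rw [norm_smul, Real.norm_eq_abs]
  refine mul_le_mul (abs_le_abs_of_nonneg hz.1.le hz.2) (hR _ hM0) (norm_nonneg _) (abs_nonneg _)

theorem dop_eop {M h : Euc n → ℝ} (hM : IsTestFun n M) (hh : IsTestFun n h) (m : ℕ)
    (δ : ℝ) (q : MvPolynomial (Fin n) ℝ) : dop q (eop M m δ h) = eop M m δ (dop q h) :=
  dop_shiftAvg (integrable_eop_weight hM m δ) measurable_scale q hh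

theorem eop_apply {M h : Euc n → ℝ} (hM : IsTestFun n M) (hh : IsTestFun n h) (m : ℕ)
    (δ : ℝ) (y : Euc n) :
    eop M m δ h y = ∫ t in Set.Ioc 0 δ, t ^ m * avg M t h y := by
  unfold eop
  rw [shiftAvg, integral_prod]
  · refine integral_congr_ae (Eventually.of_forall fun t => ?_)
    simp only [avg_apply, smul_eq_mul, mul_assoc]
    rw [integral_const_mul]
  · exact integrable_shiftAvg (integrable_eop_weight hM m δ) measurable_scale hh y

/-- Transferring a homogeneous operator from `h` to the kernel. -/
theorem pow_mul_avg_dop {q : MvPolynomial (Fin n) ℝ} {m : ℕ} (hq : q.IsHomogeneous m)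
    {M h : Euc n → ℝ} (hM : IsTestFun n M) (hh : IsTestFun n h) (t : ℝ) (y : Euc n) :
    t ^ m * avg M t (dop q h) y = avg (dop q M) t h y := by
  have h1 : ∀ x, h (y - t • x) = (fun x => h (y + (-t) • x)) x := by
    intro x; simp [sub_eq_add_neg]
  rw [avg_apply, avg_apply]
  simp_rw [h1]
  rw [integral_dop_mul hq hM (contDiff_comp_affine (-t) y hh.contDiff),
    dop_comp_affine q hq (-t) y hh.contDiff, ← integral_const_mul, ← integral_const_mul]
  refine integral_congr_ae (Eventually.of_forall fun x => ?_)
  simp only [smul_eq_mul]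
  rw [neg_pow]
  have : ((-1 : ℝ) ^ m) * (-1) ^ m = 1 := by rw [← mul_pow]; simp
  simp only [sub_eq_add_neg, neg_smul]
  linear_combination (-(t ^ m * M x * dop q h (y + -(t • x)))) * this

theorem eop_dop_eq {q : MvPolynomial (Fin n) ℝ} {m : ℕ} (hq : q.IsHomogeneous m)
    {M h : Euc n → ℝ} (hM : IsTestFun n M) (hh : IsTestFun n h) (δ : ℝ) (y : Euc n) :
    eop M m δ (dop q h) y = ∫ t in Set.Ioc 0 δ, avg (dop q M) t h y := by
  rw [eop_apply hM (hh.dop q)]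
  refine integral_congr_ae (Eventually.of_forall fun t => ?_)
  exact pow_mul_avg_dop hq hM hh t y

theorem avg_one_dop {q : MvPolynomial (Fin n) ℝ} {m : ℕ} (hq : q.IsHomogeneous m)
    {M h : Euc n → ℝ} (hM : IsTestFun n M) (hh : IsTestFun n h) (y : Euc n) :
    avg M 1 (dop q h) y = avg (dop q M) 1 h y := by
  rw [← pow_mul_avg_dop hq hM hh]; simp

theorem avg_zero (κ h : Euc n → ℝ) (y : Euc n) : avg κ 0 h y = (∫ x, κ x) * h y := by
  rw [avg_apply, ← integral_mul_const]; simp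

/-- A pair of test functions with `Q(∂) M = div (x φ)`. -/
structure IsKernelPair (Q : MvPolynomial (Fin n) ℝ) (M φ : Euc n → ℝ) : Prop where
  hM : IsTestFun n M
  hφ : IsTestFun n φ
  integral_eq : ∫ x, φ x = 1
  dop_eq : ∀ x, dop Q M x = n * φ x + radial φ x

theorem hasDerivAt_avg {φ h : Euc n → ℝ} (hφ : IsTestFun n φ) (hh : IsTestFun n h)
    (y : Euc n) (t : ℝ) :
    HasDerivAt (fun t => avg φ t h y) (∫ x, φ x * (- fderiv ℝ h (y - t • x) x)) t := by
  obtain ⟨C, hC0, hC⟩ := hh.fderiv.exists_bound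
  have hb : Integrable (fun x => ‖φ x‖ * (C * ‖x‖)) := by
    have : Continuous (fun x => ‖φ x‖ * (C * ‖x‖)) := by
      have := hφ.continuous; fun_prop
    refine this.integrable_of_hasCompactSupport ?_
    exact (hφ.2.norm).mul_right
  have hc : Continuous (fun x => φ x * (- fderiv ℝ h (y - t • x) x)) := by
    have h1 := hφ.continuous
    have h2 := hh.fderiv.continuous
    have h3 : Continuous (fun x => fderiv ℝ h (y - t • x) x) :=
      (h2.comp (by fun_prop)).clm_apply continuous_id
    exact h1.mul h3.neg
  refine (hasDerivAt_integral_of_dominated_loc_of_deriv_le (F := fun t x => φ x * h (y - t • x))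
    (F' := fun t x => φ x * (- fderiv ℝ h (y - t • x) x)) (bound := fun x => ‖φ x‖ * (C * ‖x‖))
    univ_mem (Eventually.of_forall fun t => (integrable_avg hφ hh t y).aestronglyMeasurable)
    (integrable_avg hφ hh t y) hc.aestronglyMeasurable ?_ hb ?_).2
  · filter_upwards with x s _
    rw [norm_mul, norm_neg]
    refine mul_le_mul_of_nonneg_left ?_ (norm_nonneg _)
    exact (ContinuousLinearMap.le_opNorm _ _).trans
      (mul_le_mul_of_nonneg_right (hC _) (norm_nonneg _))
  · filter_upwards with x s _
    have h1 : HasDerivAt (fun s : ℝ => y - s • x) (-x) s := by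
      simpa using ((hasDerivAt_id s).smul_const x).const_sub y
    have h2 := (hh.differentiable (y - s • x)).hasFDerivAt.comp_hasDerivAt s h1
    simpa using h2.const_mul (φ x)

variable {Q : MvPolynomial (Fin n) ℝ} {m : ℕ} {M φ : Euc n → ℝ}

theorem IsKernelPair.deriv_eq (hK : IsKernelPair Q M φ) (hQ : Q.IsHomogeneous (m + 1))
    {h : Euc n → ℝ} (hh : IsTestFun n h) (y : Euc n) {t : ℝ} (ht : t ≠ 0) :
    ∫ x, φ x * (- fderiv ℝ h (y - t • x) x) = - (t ^ m * avg M t (dop Q h) y) := by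
  have hg := contDiff_comp_affine (-t) y hh.contDiff
  have h1 := integral_radial_mul hK.hφ hg
  have h2 := pow_mul_avg_dop hQ hK.hM hh t y
  have h3 : avg (dop Q M) t h y = ∫ x, (n * φ x + radial φ x) * h (y + (-t) • x) := by
    rw [avg_apply]
    simp_rw [hK.dop_eq]
    simp [sub_eq_add_neg]
  have h4 : ∀ x, radial (fun x => h (y + (-t) • x)) x = t * (- fderiv ℝ h (y - t • x) x) := by
    intro x
    rw [radial, fderiv_comp_affine _ _ _ hh.contDiff]
    simp [sub_eq_add_neg]
  simp_rw [h4, mul_left_comm _ t] at h1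
  rw [integral_const_mul] at h1
  rw [h3, h1, pow_succ] at h2
  apply mul_left_cancel₀ ht
  linear_combination h2

theorem IsKernelPair.eop_dop (hK : IsKernelPair Q M φ) (hQ : Q.IsHomogeneous (m + 1))
    {h : Euc n → ℝ} (hh : IsTestFun n h) {δ : ℝ} (hδ : 0 ≤ δ) (y : Euc n) :
    eop M m δ (dop Q h) y = h y - avg φ δ h y := by
  rw [eop_apply hK.hM (hh.dop Q), ← intervalIntegral.integral_of_le hδ]
  have hcont : Continuous (fun t : ℝ => t ^ m * avg M t (dop Q h) y) := by
    have : Continuous (fun t : ℝ => avg M t (dop Q h) y) :=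
      continuous_iff_continuousAt.2 fun t => (hasDerivAt_avg hK.hM (hh.dop Q) y t).continuousAt
    fun_prop
  have := intervalIntegral.integral_eq_sub_of_hasDerivAt_of_le (f := fun t => - avg φ t h y)
    (f' := fun t => t ^ m * avg M t (dop Q h) y) hδ
    (continuous_iff_continuousAt.2 fun t => (hasDerivAt_avg hK.hφ hh y t).continuousAt).neg.continuousOn
    (fun t ht => by
      have := (hasDerivAt_avg hK.hφ hh y t).neg
      rw [hK.deriv_eq hQ hh y ht.1.ne', neg_neg] at this
      exact this) (hcont.intervalIntegrable _ _)
  rw [this, avg_zero, hK.integral_eq]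
  ring

theorem IsKernelPair.dop_eop_one (hK : IsKernelPair Q M φ) (hQ : Q.IsHomogeneous (m + 1))
    {h : Euc n → ℝ} (hh : IsTestFun n h) :
    dop Q (eop M m 1 h) = h - avg φ 1 h := by
  rw [dop_eop hK.hM hh]
  ext y
  exact hK.eop_dop hQ hh zero_le_one y

theorem IsKernelPair.eop_one_sub (hK : IsKernelPair Q M φ) (hQ : Q.IsHomogeneous (m + 1))
    {k : Euc n → ℝ} (hk : IsTestFun n k) {δ : ℝ} (hδ : 0 ≤ δ) (y : Euc n) :
    eop M m 1 k y - eop M m δ k y =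
      avg φ δ (eop M m 1 k) y - eop M m δ (avg φ 1 k) y := by
  have h1 := hK.eop_dop hQ (isTestFun_eop hK.hM hk m 1) hδ y
  rw [hK.dop_eop_one hQ hk] at h1
  unfold eop at h1
  rw [shiftAvg_sub (integrable_eop_weight hK.hM m δ) measurable_scale hk
    (isTestFun_avg hK.hφ hk 1)] at h1
  unfold eop
  linarith

end Representation

noncomputable section FourierKernel

open LineDeriv FourierTransform
open scoped SchwartzMap

variable {n : ℕ}

/-- Evaluation of a polynomial at a point of Euclidean space. -/
def pev (q : MvPolynomial (Fin n) ℝ) (ξ : Euc n) : ℝ := MvPolynomial.eval (fun i => ξ i) q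

theorem inner_stdVec (ξ : Euc n) (i : Fin n) : ⟪ξ, stdVec n i⟫ = ξ i := by
  simp [stdVec, EuclideanSpace.inner_single_right]

theorem hasTemperateGrowth_inner (v : Euc n) :
    Function.HasTemperateGrowth (fun ξ : Euc n => ⟪ξ, v⟫) := by fun_prop

theorem schwartz_contDiff (f : 𝓢(Euc n, ℂ)) : ContDiff ℝ ∞ (f : Euc n → ℂ) := f.smooth'

theorem dop_X_schwartz (i : Fin n) (f : 𝓢(Euc n, ℂ)) :
    dop (MvPolynomial.X i) (f : Euc n → ℂ) = (∂_{stdVec n i} f : 𝓢(Euc n, ℂ)) := by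
  rw [dop_X i (schwartz_contDiff f)]; rfl

theorem exists_schwartz_fourier_dop {q : MvPolynomial (Fin n) ℝ} {m : ℕ} (hq : q.IsHomogeneous m)
    (f : 𝓢(Euc n, ℂ)) : ∃ g : 𝓢(Euc n, ℂ), (g : Euc n → ℂ) = dop q f ∧
      ∀ ξ, 𝓕 g ξ = (2 * Real.pi * Complex.I) ^ m * (pev q ξ : ℂ) * 𝓕 f ξ := by
  have hs := mem_span_list_prod_X hq
  clear hq
  induction hs using Submodule.span_induction with
  | mem r hr =>
    obtain ⟨l, rfl, rfl⟩ := hr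
    induction l generalizing f with
    | nil =>
      refine ⟨f, ?_, by simp [pev]⟩
      simp only [List.map_nil, List.prod_nil, ← map_one (MvPolynomial.C (σ := Fin n) (R := ℝ))]
      rw [dop_C 1 (schwartz_contDiff f)]; simp
    | cons i l ih =>
      obtain ⟨g, hg, hg2⟩ := ih (∂_{stdVec n i} f)
      refine ⟨g, ?_, fun ξ => ?_⟩
      · simp only [List.map_cons, List.prod_cons]
        rw [hg, mul_comm, dop_mul _ _ (schwartz_contDiff f), dop_X_schwartz]
      · rw [hg2, SchwartzMap.fourier_lineDerivOp_eq]
        rw [smul_apply,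
          SchwartzMap.smulLeftCLM_apply_apply (hasTemperateGrowth_inner _), inner_stdVec]
        simp [pev, pow_succ]
        ring
  | zero => exact ⟨0, by simp [dop_poly_zero], by simp [pev]⟩
  | add p q _ _ hp hq =>
    obtain ⟨a, ha, ha2⟩ := hp
    obtain ⟨b, hb, hb2⟩ := hq
    refine ⟨a + b, by rw [dop_poly_add, ← ha, ← hb]; rfl, fun ξ => ?_⟩
    rw [FourierAdd.fourier_add, add_apply, ha2, hb2]
    simp [pev]; ring
  | smul c p _ hp =>
    obtain ⟨a, ha, ha2⟩ := hp
    refine ⟨c • a, by rw [dop_poly_smul, ← ha]; rfl, fun ξ => ?_⟩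
    rw [FourierTransform.fourier_smul, smul_apply, ha2]
    simp [pev]; ring

theorem exists_schwartz_dop_fourier {q : MvPolynomial (Fin n) ℝ} {m : ℕ} (hq : q.IsHomogeneous m)
    (f : 𝓢(Euc n, ℂ)) : ∃ g : 𝓢(Euc n, ℂ), dop q (𝓕 f : 𝓢(Euc n, ℂ)) = (𝓕 g : 𝓢(Euc n, ℂ)) ∧
      ∀ ξ, g ξ = (-(2 * Real.pi * Complex.I)) ^ m * (pev q ξ : ℂ) * f ξ := by
  have hs := mem_span_list_prod_X hq
  clear hq
  induction hs using Submodule.span_induction with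
  | mem r hr =>
    obtain ⟨l, rfl, rfl⟩ := hr
    induction l generalizing f with
    | nil =>
      refine ⟨f, ?_, by simp [pev]⟩
      simp only [List.map_nil, List.prod_nil, ← map_one (MvPolynomial.C (σ := Fin n) (R := ℝ))]
      rw [dop_C 1 (schwartz_contDiff (𝓕 f))]; simp
    | cons i l ih =>
      obtain ⟨g, hg, hg2⟩ := ih (-(2 * Real.pi * Complex.I) •
        SchwartzMap.smulLeftCLM ℂ (fun x => ⟪x, stdVec n i⟫) f)
      refine ⟨g, ?_, fun ξ => ?_⟩
      · simp only [List.map_cons, List.prod_cons]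
        rw [mul_comm, dop_mul _ _ (schwartz_contDiff (𝓕 f)), dop_X_schwartz,
          SchwartzMap.lineDerivOp_fourier_eq, hg]
      · rw [hg2, smul_apply,
          SchwartzMap.smulLeftCLM_apply_apply (hasTemperateGrowth_inner _), inner_stdVec]
        simp [pev, pow_succ]
        ring
  | zero => 
    refine ⟨0, ?_, by simp [pev]⟩
    rw [FourierTransform.fourier_zero, dop_poly_zero]; rfl
  | add p q _ _ hp hq =>
    obtain ⟨a, ha, ha2⟩ := hp
    obtain ⟨b, hb, hb2⟩ := hq
    refine ⟨a + b, by rw [dop_poly_add, ha, hb, FourierAdd.fourier_add]; rfl, fun ξ => ?_⟩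
    rw [add_apply, ha2, hb2]
    simp [pev]; ring
  | smul c p _ hp =>
    obtain ⟨a, ha, ha2⟩ := hp
    refine ⟨c • a, by rw [dop_poly_smul, ha, FourierTransform.fourier_smul]; rfl, fun ξ => ?_⟩
    rw [smul_apply, ha2]
    simp [pev]; ring

theorem pev_smul {q : MvPolynomial (Fin n) ℝ} {m : ℕ} (hq : q.IsHomogeneous m) (t : ℝ) (ξ : Euc n) :
    pev q (t • ξ) = t ^ m * pev q ξ := by
  have hs := mem_span_list_prod_X hq
  clear hq
  induction hs using Submodule.span_induction with
  | mem r hr =>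
    obtain ⟨l, rfl, rfl⟩ := hr
    induction l with
    | nil => simp [pev]
    | cons i l ih =>
      simp only [pev, List.map_cons, List.prod_cons, map_mul, MvPolynomial.eval_X,
        List.length_cons] at ih ⊢
      rw [ih]
      simp only [PiLp.smul_apply, smul_eq_mul]
      ring
  | zero => simp [pev]
  | add p q _ _ hp hq =>
    simp only [pev, map_add] at hp hq ⊢
    rw [hp, hq]; ring
  | smul c p _ hp =>
    simp only [pev, MvPolynomial.smul_eval] at hp ⊢
    rw [hp]; ring

theorem continuous_pev (q : MvPolynomial (Fin n) ℝ) : Continuous (pev q) := by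
  have : Continuous (fun ξ : Euc n => (fun i => ξ i : Fin n → ℝ)) := by fun_prop
  exact (MvPolynomial.continuous_eval q).comp this

theorem contDiff_pev (q : MvPolynomial (Fin n) ℝ) : ContDiff ℝ ∞ (pev q) := by
  unfold pev
  induction q using MvPolynomial.induction_on with
  | C c => simpa using contDiff_const
  | add p q hp hq => simpa using hp.add hq
  | mul_X p i hp =>
    simp only [map_mul, MvPolynomial.eval_X]
    exact hp.mul (by fun_prop)

theorem exists_abs_pev_le {Q R : MvPolynomial (Fin n) ℝ} {m : ℕ} (hQ : Q.IsHomogeneous m)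
    (hR : R.IsHomogeneous m) (hell : ∀ ξ : Euc n, ξ ≠ 0 → pev Q ξ ≠ 0) (hm : m ≠ 0) :
    ∃ C : ℝ, 0 ≤ C ∧ ∀ ξ, |pev R ξ| ≤ C * |pev Q ξ| := by
  have hc : ContinuousOn (fun ξ => |pev R ξ| / |pev Q ξ|) (sphere (0 : Euc n) 1) := by
    refine (continuous_pev R).abs.continuousOn.div (continuous_pev Q).abs.continuousOn ?_
    intro ξ hξ
    have : ξ ≠ 0 := by rintro rfl; simp at hξ
    simpa using hell ξ this
  obtain ⟨C, hC⟩ := (isCompact_sphere (0 : Euc n) 1).exists_bound_of_continuousOn hc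
  refine ⟨max C 0, le_max_right _ _, fun ξ => ?_⟩
  rcases eq_or_ne ξ 0 with rfl | hξ
  · have h1 := pev_smul hR 0 0
    have h2 := pev_smul hQ 0 0
    simp [hm] at h1 h2
    simp [h1, h2]
  · have hn : ‖ξ‖ ≠ 0 := by simpa using hξ
    have h1 := hC (‖ξ‖⁻¹ • ξ) (by simp [norm_smul, hn])
    rw [pev_smul hR, pev_smul hQ, abs_mul, abs_mul, mul_div_mul_left _ _ (by positivity)] at h1
    have hQ0 : 0 < |pev Q ξ| := by simpa using hell ξ hξ
    rw [Real.norm_of_nonneg (by positivity), div_le_iff₀ hQ0] at h1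
    exact h1.trans (by gcongr; exact le_max_left _ _)

/-- Test functions as Schwartz maps. -/
def IsTestFun.schwartz {h : Euc n → ℂ} (hh : IsTestFun n h) : 𝓢(Euc n, ℂ) :=
  hh.2.toSchwartzMap hh.1

theorem IsTestFun.ofReal {h : Euc n → ℝ} (hh : IsTestFun n h) :
    IsTestFun n (fun x => (h x : ℂ)) :=
  ⟨Complex.ofRealCLM.contDiff.comp hh.1, hh.2.comp_left (g := fun x : ℝ => (x : ℂ)) (by simp)⟩

theorem exists_l2_bound {Q R : MvPolynomial (Fin n) ℝ} {m : ℕ} (hQ : Q.IsHomogeneous m)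
    (hR : R.IsHomogeneous m) (hell : ∀ ξ : Euc n, ξ ≠ 0 → pev Q ξ ≠ 0) (hm : m ≠ 0) :
    ∃ C : ℝ, 0 ≤ C ∧ ∀ z : Euc n → ℝ, IsTestFun n z →
      ∫ x, (dop R z x) ^ 2 ≤ C * ∫ x, (dop Q z x) ^ 2 := by
  obtain ⟨C, hC0, hC⟩ := exists_abs_pev_le hQ hR hell hm
  refine ⟨C ^ 2, by positivity, fun z hz => ?_⟩
  obtain ⟨a, ha, ha2⟩ := exists_schwartz_fourier_dop hQ hz.ofReal.schwartz
  obtain ⟨b, hb, hb2⟩ := exists_schwartz_fourier_dop hR hz.ofReal.schwartz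
  have key : ∀ (P : MvPolynomial (Fin n) ℝ) (g : 𝓢(Euc n, ℂ)),
      (g : Euc n → ℂ) = dop P hz.ofReal.schwartz → ∫ x, (dop P z x) ^ 2 = ∫ ξ, ‖𝓕 g ξ‖ ^ 2 := by
    intro P g hg
    rw [SchwartzMap.integral_norm_sq_fourier]
    refine integral_congr_ae (Eventually.of_forall fun x => ?_)
    have h1 : (hz.ofReal.schwartz : Euc n → ℂ) = fun x => Complex.ofRealCLM (z x) := rfl
    simp only
    rw [hg, h1, dop_clm_comp Complex.ofRealCLM P hz.1]
    simp
  rw [key Q a ha, key R b hb, ← integral_const_mul]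
  have hI : ∀ g : 𝓢(Euc n, ℂ), Integrable (fun ξ => ‖g ξ‖ ^ 2) := by
    intro g
    exact (memLp_two_iff_integrable_sq_norm (g.continuous.aestronglyMeasurable)).1 (g.memLp 2 _)
  refine integral_mono (hI _) ((hI _).const_mul _) fun ξ => ?_
  simp only
  rw [ha2, hb2, ← mul_pow]
  refine pow_le_pow_left₀ (norm_nonneg _) ?_ 2
  rw [norm_mul, norm_mul, norm_mul, norm_mul, Complex.norm_real, Complex.norm_real,
    Real.norm_eq_abs, Real.norm_eq_abs]
  have h1 := hC ξ
  calc _ ≤ ‖(2 * Real.pi * Complex.I) ^ m‖ * (C * |pev Q ξ|) * ‖𝓕 hz.ofReal.schwartz ξ‖ :=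
        mul_le_mul_of_nonneg_right (mul_le_mul_of_nonneg_left h1 (norm_nonneg _)) (norm_nonneg _)
    _ = _ := by ring

end FourierKernel

noncomputable section SchwartzKernel

open LineDeriv FourierTransform
open scoped SchwartzMap

variable {n : ℕ}

theorem radial_fourier (f : 𝓢(Euc n, ℂ)) (r : 𝓢(Euc n, ℂ)) (hr : ∀ x, r x = radial f x) (x : Euc n) :
    n * 𝓕 f x + radial (𝓕 f : 𝓢(Euc n, ℂ)) x = - 𝓕 r x := by
  let s : Fin n → 𝓢(Euc n, ℂ) := fun i => SchwartzMap.smulLeftCLM ℂ (fun x => ⟪x, stdVec n i⟫) f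
  have hs : ∀ i x, s i x = x i * f x := by
    intro i x
    simp only [s]
    rw [SchwartzMap.smulLeftCLM_apply_apply (hasTemperateGrowth_inner _), inner_stdVec]
    simp
  have h1 : ∑ i, ∂_{stdVec n i} (s i) = (n : ℂ) • f + r := by
    ext x
    have h2 : ∀ i, (∂_{stdVec n i} (s i)) x = f x + x i * fderiv ℝ f x (stdVec n i) := by
      intro i
      rw [SchwartzMap.lineDerivOp_apply_eq_fderiv]
      have h3 : (s i : Euc n → ℂ) = fun x => (x i) • f x := by
        ext x; rw [hs]; simp
      have h4 : HasFDerivAt (fun x : Euc n => x i) (EuclideanSpace.proj i : Euc n →L[ℝ] ℝ) x :=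
        (EuclideanSpace.proj (𝕜 := ℝ) i).hasFDerivAt
      have h5 := h4.smul ((schwartz_contDiff f).differentiable (by simp) x).hasFDerivAt
      have h6 : fderiv ℝ (fun x : Euc n => x i • f x) x = _ := h5.fderiv
      rw [h3, h6]
      simp [stdVec]
      ring
    simp only [sum_apply, add_apply, smul_apply, h2, hr,
      radial_eq_sum, Finset.sum_add_distrib]
    simp
  have h2 : 𝓕 ((n : ℂ) • f + r) = ∑ i, 𝓕 (∂_{stdVec n i} (s i)) := by
    rw [← h1]
    exact map_sum (SchwartzMap.fourierTransformCLM ℂ) _ _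
  have h3 : 𝓕 ((n : ℂ) • f + r) x = - radial (𝓕 f : 𝓢(Euc n, ℂ)) x := by
    rw [h2, radial_eq_sum, sum_apply, ← Finset.sum_neg_distrib]
    refine Finset.sum_congr rfl fun i _ => ?_
    rw [SchwartzMap.fourier_lineDerivOp_eq, smul_apply,
      SchwartzMap.smulLeftCLM_apply_apply (hasTemperateGrowth_inner _), inner_stdVec,
      ← SchwartzMap.lineDerivOp_apply_eq_fderiv, SchwartzMap.lineDerivOp_fourier_eq,
      FourierTransform.fourier_smul, smul_apply]
    simp only [s, smul_eq_mul, Complex.real_smul]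
    ring
  rw [FourierAdd.fourier_add, FourierTransform.fourier_smul, add_apply, smul_apply] at h3
  rw [smul_eq_mul] at h3
  linear_combination h3

theorem integral_fourier (f : 𝓢(Euc n, ℂ)) : ∫ x, 𝓕 f x = f 0 := by
  have h : (𝓕⁻ (𝓕 f : 𝓢(Euc n, ℂ)) : 𝓢(Euc n, ℂ)) 0 = f 0 :=
    congrArg (fun g : 𝓢(Euc n, ℂ) => g 0) (fourierInv_fourier_eq f)
  rw [← h, SchwartzMap.fourierInv_coe, Real.fourierInv_eq]
  simp

theorem exists_schwartz_pair {Q : MvPolynomial (Fin n) ℝ} {d : ℕ} (hQ : Q.IsHomogeneous d)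
    (hell : ∀ ξ : Euc n, ξ ≠ 0 → pev Q ξ ≠ 0) :
    ∃ M φ : 𝓢(Euc n, ℝ), (∀ x, dop Q M x = n * φ x + radial φ x) ∧ ∫ x, φ x = 1 := by
  let b : ContDiffBump (0 : Euc n) := ⟨1, 2, one_pos, one_lt_two⟩
  have hbt : IsTestFun n (b : Euc n → ℝ) := ⟨b.contDiff, b.hasCompactSupport⟩
  let θ := hbt.ofReal.schwartz
  have hθ : ∀ x, θ x = (b x : ℂ) := fun x => rfl
  have hrt : IsTestFun n (radial (θ : Euc n → ℂ)) := by
    refine ⟨contDiff_radial (schwartz_contDiff θ), ?_⟩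
    have : HasCompactSupport (fderiv ℝ (θ : Euc n → ℂ)) := hbt.ofReal.fderiv.2
    refine this.mono ?_
    intro x hx
    rw [Function.mem_support] at hx ⊢
    contrapose! hx
    simp [radial, hx]
  have hr0 : ∀ x ∈ ball (0 : Euc n) 1, radial (θ : Euc n → ℂ) x = 0 := by
    intro x hx
    have : (θ : Euc n → ℂ) =ᶠ[𝓝 x] fun _ => 1 := by
      filter_upwards [isOpen_ball.mem_nhds hx] with y hy
      rw [hθ, b.one_of_mem_closedBall (ball_subset_closedBall hy)]; simp
    simp [radial, this.fderiv_eq]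
  let c : ℂ := (-(2 * Real.pi * Complex.I)) ^ d
  have hc : c ≠ 0 := pow_ne_zero _ (by simp [Real.pi_ne_zero])
  have hgt : IsTestFun n (fun ξ => - (c⁻¹ * ((pev Q ξ : ℂ))⁻¹ * radial (θ : Euc n → ℂ) ξ)) := by
    refine ⟨?_, ?_⟩
    · rw [contDiff_iff_contDiffAt]
      intro x
      rcases eq_or_ne x 0 with rfl | hx
      · have : (fun ξ => - (c⁻¹ * ((pev Q ξ : ℂ))⁻¹ * radial (θ : Euc n → ℂ) ξ)) =ᶠ[𝓝 0]
            fun _ => 0 := by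
          filter_upwards [ball_mem_nhds (0 : Euc n) one_pos] with y hy
          simp [hr0 y hy]
        exact contDiffAt_const.congr_of_eventuallyEq this
      · have h1 : ContDiffAt ℝ ∞ (fun ξ => ((pev Q ξ : ℂ))⁻¹) x := by
          refine ContDiffAt.inv ?_ (by simpa using hell x hx)
          exact (Complex.ofRealCLM.contDiff.comp (contDiff_pev Q)).contDiffAt
        exact ((contDiffAt_const.mul h1).mul hrt.1.contDiffAt).neg
    · refine hrt.2.mono ?_
      intro x hx
      rw [Function.mem_support] at hx ⊢
      contrapose! hx
      simp [hx]
  obtain ⟨g, hg1, hg2⟩ := exists_schwartz_dop_fourier hQ hgt.schwartz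
  have hgr : g = - hrt.schwartz := by
    ext ξ
    have h1 : hgt.schwartz ξ = - (c⁻¹ * ((pev Q ξ : ℂ))⁻¹ * radial (θ : Euc n → ℂ) ξ) := rfl
    have h2 : (- hrt.schwartz) ξ = - radial (θ : Euc n → ℂ) ξ := rfl
    rw [hg2, h1, h2]
    rcases eq_or_ne ξ 0 with rfl | hξ
    · simp [hr0]
    · have h3 : (pev Q ξ : ℂ) ≠ 0 := by simpa using hell ξ hξ
      change c * _ * _ = _
      field_simp
  refine ⟨(𝓕 hgt.schwartz).postcompCLM Complex.reCLM, (𝓕 θ).postcompCLM Complex.reCLM, ?_, ?_⟩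
  · intro x
    have h1 := radial_fourier θ hrt.schwartz (fun x => rfl) x
    have h2 : dop Q (𝓕 hgt.schwartz : 𝓢(Euc n, ℂ)) x =
        n * 𝓕 θ x + radial (𝓕 θ : 𝓢(Euc n, ℂ)) x := by
      rw [hg1, h1, hgr, FourierTransform.fourier_neg]
      rfl
    have h3 : ((SchwartzMap.postcompCLM Complex.reCLM (𝓕 hgt.schwartz) : 𝓢(Euc n, ℝ)) : Euc n → ℝ)
      = fun x => Complex.reCLM (𝓕 hgt.schwartz x) := rfl
    have h4 : ((SchwartzMap.postcompCLM Complex.reCLM (𝓕 θ) : 𝓢(Euc n, ℝ)) : Euc n → ℝ)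
      = fun x => Complex.reCLM (𝓕 θ x) := rfl
    have h5 : HasFDerivAt (fun x => Complex.reCLM (𝓕 θ x))
      (Complex.reCLM.comp (fderiv ℝ (𝓕 θ : 𝓢(Euc n, ℂ)) x)) x :=
      Complex.reCLM.hasFDerivAt.comp x
        ((schwartz_contDiff (𝓕 θ)).differentiable (by simp) x).hasFDerivAt
    rw [h3, dop_clm_comp Complex.reCLM Q (schwartz_contDiff (𝓕 hgt.schwartz)), h4]
    simp only [h2]
    simp only [radial, h5.fderiv]
    simp
  · have h4 : ∀ x, (SchwartzMap.postcompCLM Complex.reCLM (𝓕 θ) : 𝓢(Euc n, ℝ)) x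
      = Complex.reCLM (𝓕 θ x) := fun x => rfl
    simp_rw [h4]
    rw [ContinuousLinearMap.integral_comp_comm _ (SchwartzMap.integrable (𝓕 θ)),
      integral_fourier, hθ, b.one_of_mem_closedBall (by simp [b.rIn_pos.le])]
    simp

end SchwartzKernel

noncomputable section TailIntegral

open scoped SchwartzMap

universe uF
variable {n : ℕ} {F : Type uF} [NormedAddCommGroup F] [NormedSpace ℝ F]

/-- `∫_1^∞ s^a g(s x) ds`. -/
def tailInt (a : ℤ) (g : Euc n → F) (x : Euc n) : F := ∫ s in Set.Ioi (1 : ℝ), s ^ a • g (s • x)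

theorem exists_tail_bound (a : ℤ) (g : 𝓢(Euc n, F)) {N : ℕ} (hN : a + 2 ≤ N) :
    ∃ C : ℝ, 0 ≤ C ∧ ∀ x : Euc n, x ≠ 0 → ∀ s ∈ Set.Ioi (1 : ℝ),
      ‖s ^ a • g (s • x)‖ ≤ C * (‖x‖ ^ N)⁻¹ * s ^ (-2 : ℝ) := by
  obtain ⟨C, hC⟩ := g.decay' N 0
  have hC' : ∀ x, ‖x‖ ^ N * ‖g x‖ ≤ C := by
    intro x
    have h := hC x
    rwa [norm_iteratedFDeriv_zero] at h
  have hC0 : 0 ≤ C := by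
    refine le_trans ?_ (hC' 0); positivity
  refine ⟨C, hC0, fun x hx s hs => ?_⟩
  have hs1 : (1 : ℝ) < s := hs
  have hs0 : 0 < s := by linarith
  have hx0 : 0 < ‖x‖ := norm_pos_iff.2 hx
  have h1 := hC' (s • x)
  rw [norm_smul, Real.norm_of_nonneg hs0.le, mul_pow] at h1
  have h2 : ‖g (s • x)‖ ≤ C * (‖x‖ ^ N)⁻¹ * (s ^ N)⁻¹ := by
    rw [← div_eq_mul_inv, ← div_eq_mul_inv, le_div_iff₀ (by positivity), le_div_iff₀ (by positivity)]
    linarith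
  rw [norm_smul, Real.norm_of_nonneg (by positivity)]
  have h3 : s ^ a * (s ^ N)⁻¹ ≤ s ^ (-2 : ℝ) := by
    have : s ^ (-2 : ℝ) = s ^ (-2 : ℤ) := by
      rw [← Real.rpow_intCast]; norm_num
    rw [this, ← zpow_natCast, ← zpow_neg, ← zpow_add₀ hs0.ne']
    exact zpow_le_zpow_right₀ hs1.le (by omega)
  calc s ^ a * ‖g (s • x)‖ ≤ s ^ a * (C * (‖x‖ ^ N)⁻¹ * (s ^ N)⁻¹) := by gcongr
    _ = C * (‖x‖ ^ N)⁻¹ * (s ^ a * (s ^ N)⁻¹) := by ring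
    _ ≤ _ := by gcongr

theorem integrableOn_rpow_neg_two : IntegrableOn (fun s : ℝ => s ^ (-2 : ℝ)) (Set.Ioi 1) :=
  integrableOn_Ioi_rpow_of_lt (by norm_num) one_pos

theorem aestronglyMeasurable_tail (a : ℤ) (g : 𝓢(Euc n, F)) (x : Euc n) :
    AEStronglyMeasurable (fun s : ℝ => s ^ a • g (s • x)) (volume.restrict (Set.Ioi 1)) := by
  refine ContinuousOn.aestronglyMeasurable ?_ measurableSet_Ioi
  have h1 : ContinuousOn (fun s : ℝ => s ^ a) (Set.Ioi 1) := fun s hs =>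
    (continuousAt_zpow₀ s a (Or.inl (by have : (1:ℝ) < s := hs; linarith))).continuousWithinAt
  have h2 : Continuous (fun s : ℝ => g (s • x)) := g.continuous.comp (by fun_prop)
  exact h1.smul h2.continuousOn

theorem integrableOn_tail (a : ℤ) (g : 𝓢(Euc n, F)) {x : Euc n} (hx : x ≠ 0) :
    IntegrableOn (fun s : ℝ => s ^ a • g (s • x)) (Set.Ioi 1) := by
  obtain ⟨C, -, hC⟩ := exists_tail_bound a g (N := (a + 2).toNat) (Int.self_le_toNat _)
  refine Integrable.mono' (integrableOn_rpow_neg_two.const_mul (C * (‖x‖ ^ (a + 2).toNat)⁻¹))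
    (aestronglyMeasurable_tail a g x) ?_
  filter_upwards [ae_restrict_mem measurableSet_Ioi] with s hs
  exact hC x hx s hs

theorem exists_tailInt_bound (a : ℤ) (g : 𝓢(Euc n, F)) {N : ℕ} (hN : a + 2 ≤ N) :
    ∃ C : ℝ, 0 ≤ C ∧ ∀ x : Euc n, x ≠ 0 → ‖tailInt a g x‖ ≤ C * (‖x‖ ^ N)⁻¹ := by
  obtain ⟨C, hC0, hC⟩ := exists_tail_bound a g hN
  have h0 : 0 ≤ ∫ s in Set.Ioi (1 : ℝ), s ^ (-2 : ℝ) :=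
    setIntegral_nonneg measurableSet_Ioi fun s hs => by
      have : (1:ℝ) < s := hs
      positivity
  refine ⟨C * ∫ s in Set.Ioi (1 : ℝ), s ^ (-2 : ℝ), by positivity, fun x hx => ?_⟩
  have := norm_integral_le_of_norm_le
    (integrableOn_rpow_neg_two.const_mul (C * (‖x‖ ^ N)⁻¹)) (f := fun s : ℝ => s ^ a • g (s • x)) ?_
  · rw [integral_const_mul] at this
    unfold tailInt
    linarith
  · filter_upwards [ae_restrict_mem measurableSet_Ioi] with s hs
    exact hC x hx s hs

theorem hasFDerivAt_tailInt (a : ℤ) (g : 𝓢(Euc n, F)) {x : Euc n} (hx : x ≠ 0) :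
    HasFDerivAt (tailInt a g) (tailInt (a + 1) (SchwartzMap.fderivCLM ℝ (Euc n) F g) x) x := by
  obtain ⟨C, hC0, hC⟩ := exists_tail_bound (a + 1) (SchwartzMap.fderivCLM ℝ (Euc n) F g)
    (N := (a + 1 + 2).toNat) (Int.self_le_toNat _)
  set N := (a + 1 + 2).toNat
  have hx0 : 0 < ‖x‖ := norm_pos_iff.2 hx
  have hball : ∀ y ∈ ball x (‖x‖ / 2), ‖x‖ / 2 ≤ ‖y‖ := by
    intro y hy
    rw [mem_ball, dist_eq_norm] at hy
    have := norm_sub_norm_le x y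
    rw [norm_sub_rev] at this
    linarith
  refine hasFDerivAt_integral_of_dominated_of_fderiv_le (F := fun y s => s ^ a • g (s • y))
    (F' := fun y s => s ^ (a + 1) • SchwartzMap.fderivCLM ℝ (Euc n) F g (s • y))
    (bound := fun s => C * ((‖x‖ / 2) ^ N)⁻¹ * s ^ (-2 : ℝ)) (ball_mem_nhds x (half_pos hx0))
    (Eventually.of_forall fun y => aestronglyMeasurable_tail a g y)
    (integrableOn_tail a g hx) (aestronglyMeasurable_tail (a + 1) _ x) ?_
    (integrableOn_rpow_neg_two.const_mul _) ?_
  · filter_upwards [ae_restrict_mem measurableSet_Ioi] with s hs y hy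
    have h1 := hball y hy
    have hy0 : y ≠ 0 := by
      rintro rfl
      simp at h1; linarith
    refine (hC y hy0 s hs).trans ?_
    have hs1 : (1:ℝ) < s := hs
    gcongr
  · filter_upwards [ae_restrict_mem measurableSet_Ioi] with s hs y _
    have hs0 : s ≠ 0 := by have hs1 : (1:ℝ) < s := hs; linarith
    have h1 : HasFDerivAt (fun y : Euc n => s • y) (s • ContinuousLinearMap.id ℝ (Euc n)) y :=
      (hasFDerivAt_id y).const_smul s
    have h2 := ((g.differentiable (s • y)).hasFDerivAt.comp y h1).const_smul (s ^ a)
    refine h2.congr_fderiv ?_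
    ext v
    simp [zpow_add₀ hs0, mul_smul]

theorem contDiffOn_tailInt (a : ℤ) (g : 𝓢(Euc n, F)) :
    ContDiffOn ℝ ∞ (tailInt a g) {0}ᶜ := by
  rw [contDiffOn_infty]
  intro k
  induction k generalizing F a with
  | zero =>
    rw [CharP.cast_eq_zero, contDiffOn_zero]
    exact fun x hx => (hasFDerivAt_tailInt a g hx).continuousAt.continuousWithinAt
  | succ k ih =>
    push_cast
    rw [contDiffOn_succ_iff_fderiv_of_isOpen isOpen_compl_singleton]
    refine ⟨fun x hx => (hasFDerivAt_tailInt a g hx).differentiableAt.differentiableWithinAt,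
      by simp, ?_⟩
    exact (ih (a + 1) (SchwartzMap.fderivCLM ℝ (Euc n) F g)).congr
      fun x hx => (hasFDerivAt_tailInt a g hx).fderiv

variable [CompleteSpace F]

theorem integral_tail_deriv (a : ℤ) (g : 𝓢(Euc n, F)) {x : Euc n} (hx : x ≠ 0) :
    ∫ s in Set.Ioi (1 : ℝ), (((a + 1 : ℝ) * s ^ a) • g (s • x) +
      s ^ (a + 1) • (SchwartzMap.fderivCLM ℝ (Euc n) F g (s • x)) x) = - g x := by
  have hd : ∀ s ∈ Set.Ici (1 : ℝ), HasDerivAt (fun s : ℝ => s ^ (a + 1) • g (s • x))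
      (((a + 1 : ℝ) * s ^ a) • g (s • x) +
        s ^ (a + 1) • (SchwartzMap.fderivCLM ℝ (Euc n) F g (s • x)) x) s := by
    intro s hs
    have hs0 : s ≠ 0 := by have hs1 : (1:ℝ) ≤ s := hs; linarith
    have h1 : HasDerivAt (fun s : ℝ => s • x) x s := by
      simpa using (hasDerivAt_id s).smul_const x
    have h2 := (g.differentiable (s • x)).hasFDerivAt.comp_hasDerivAt s h1
    have h3 := hasDerivAt_zpow (a + 1) s (Or.inl hs0)
    have h4 := h3.smul h2
    refine h4.congr_deriv ?_
    simp [add_comm]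
  have hlim : Tendsto (fun s : ℝ => s ^ (a + 1) • g (s • x)) atTop (𝓝 0) := by
    obtain ⟨C, hC0, hC⟩ := exists_tail_bound (a + 1) g (N := (a + 1 + 2).toNat)
      (Int.self_le_toNat _)
    have h1 : Tendsto (fun s : ℝ => C * (‖x‖ ^ (a + 1 + 2).toNat)⁻¹ * s ^ (-2 : ℝ)) atTop (𝓝 0) := by
      simpa using (tendsto_rpow_neg_atTop (y := 2) two_pos).const_mul
        (C * (‖x‖ ^ (a + 1 + 2).toNat)⁻¹)
    refine squeeze_zero_norm' ?_ h1
    filter_upwards [Ioi_mem_atTop 1] with s hs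
    exact hC x hx s hs
  have hi : IntegrableOn (fun s : ℝ => ((a + 1 : ℝ) * s ^ a) • g (s • x) +
      s ^ (a + 1) • (SchwartzMap.fderivCLM ℝ (Euc n) F g (s • x)) x) (Set.Ioi 1) := by
    refine Integrable.add ?_ ?_
    · simp only [mul_smul]
      exact (integrableOn_tail a g hx).smul (a + 1 : ℝ)
    · have := integrableOn_tail (a + 1) (SchwartzMap.fderivCLM ℝ (Euc n) F g) hx
      exact (ContinuousLinearMap.integrable_comp (ContinuousLinearMap.apply ℝ F x) this)
  rw [integral_Ioi_of_hasDerivAt_of_tendsto' hd hi hlim]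
  simp

theorem radial_tailInt (a : ℤ) (g : 𝓢(Euc n, F)) {x : Euc n} (hx : x ≠ 0) :
    (a + 1 : ℝ) • tailInt a g x + radial (tailInt a g) x = - g x := by
  rw [← integral_tail_deriv a g hx, integral_add]
  · congr 1
    · simp_rw [mul_smul]
      rw [integral_smul]; rfl
    · rw [radial, (hasFDerivAt_tailInt a g hx).fderiv, tailInt]
      rw [← ContinuousLinearMap.apply_apply (𝕜 := ℝ) x, ← ContinuousLinearMap.integral_comp_comm _
        (integrableOn_tail (a + 1) (SchwartzMap.fderivCLM ℝ (Euc n) F g) hx)]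
      rfl
  · simp only [mul_smul]
    exact (integrableOn_tail a g hx).smul (a + 1 : ℝ)
  · have := integrableOn_tail (a + 1) (SchwartzMap.fderivCLM ℝ (Euc n) F g) hx
    exact (ContinuousLinearMap.integrable_comp (ContinuousLinearMap.apply ℝ F x) this)

theorem tailInt_radial (g r : 𝓢(Euc n, F)) (hr : ∀ x, r x = (n : ℝ) • g x + radial g x)
    {x : Euc n} (hx : x ≠ 0) : tailInt ((n : ℤ) - 1) r x = - g x := by
  rw [← integral_tail_deriv ((n : ℤ) - 1) g hx]
  refine setIntegral_congr_fun measurableSet_Ioi fun s hs => ?_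
  have hs0 : s ≠ 0 := by have hs1 : (1:ℝ) < s := hs; linarith
  simp only [hr, radial, map_smul, smul_add, smul_smul, SchwartzMap.fderivCLM_apply,
    sub_add_cancel]
  congr 2
  · push_cast; ring
  · rw [← zpow_add_one₀ hs0, sub_add_cancel]

end TailIntegral

noncomputable section KernelPair

open LineDeriv
open scoped SchwartzMap

variable {n : ℕ}

theorem smoothFun_schwartz (f : 𝓢(Euc n, ℝ)) : ContDiff ℝ ∞ (f : Euc n → ℝ) := f.smooth'

theorem exists_schwartz_dop_tailInt {q : MvPolynomial (Fin n) ℝ} {d : ℕ} (hq : q.IsHomogeneous d)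
    (a : ℤ) (g : 𝓢(Euc n, ℝ)) : ∃ g' : 𝓢(Euc n, ℝ), (g' : Euc n → ℝ) = dop q g ∧
      ∀ f : Euc n → ℝ, ContDiff ℝ ∞ f → ∀ x, x ≠ 0 → f =ᶠ[𝓝 x] tailInt a g →
        dop q f =ᶠ[𝓝 x] tailInt (a + d) g' := by
  have hs := mem_span_list_prod_X hq
  clear hq
  induction hs using Submodule.span_induction with
  | mem r hr =>
    obtain ⟨l, rfl, rfl⟩ := hr
    induction l generalizing a g with
    | nil =>
      simp only [List.map_nil, List.prod_nil, ← map_one (MvPolynomial.C (σ := Fin n) (R := ℝ))]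
      refine ⟨g, by rw [dop_C 1 (smoothFun_schwartz g)]; simp, fun f hf x hx h => ?_⟩
      rw [dop_C 1 hf]
      simpa using h
    | cons i l ih =>
      obtain ⟨g', hg, hg2⟩ := ih (a + 1) (∂_{stdVec n i} g)
      simp only [List.map_cons, List.prod_cons]
      refine ⟨g', ?_, fun f hf x hx h => ?_⟩
      · rw [hg, mul_comm, dop_mul _ _ (smoothFun_schwartz g), dop_X _ (smoothFun_schwartz g)]
        rfl
      · rw [mul_comm, dop_mul _ _ hf, dop_X _ hf]
        have h1 := hg2 _ (contDiff_fderiv_apply_const hf (stdVec n i)) x hx ?_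
        · have : a + 1 + (l.length : ℤ) = a + ((i :: l).length : ℤ) := by
            push_cast [List.length_cons]; ring
          rwa [this] at h1
        · filter_upwards [h.eventually_nhds, isOpen_compl_singleton.mem_nhds hx] with y hy hy0
          rw [Filter.EventuallyEq.fderiv_eq hy, (hasFDerivAt_tailInt a g hy0).fderiv, tailInt,
            ← ContinuousLinearMap.apply_apply (𝕜 := ℝ) (stdVec n i),
            ← ContinuousLinearMap.integral_comp_comm _
            (integrableOn_tail (a + 1) (SchwartzMap.fderivCLM ℝ (Euc n) ℝ g) hy0)]
          rfl
  | zero =>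
    refine ⟨0, by rw [dop_poly_zero]; rfl, fun f hf x hx h => ?_⟩
    rw [dop_poly_zero]
    refine Eventually.of_forall fun y => ?_
    simp [tailInt]
  | add p q _ _ hp hq =>
    obtain ⟨b, hb, hb2⟩ := hp
    obtain ⟨c, hc, hc2⟩ := hq
    refine ⟨b + c, by rw [dop_poly_add, ← hb, ← hc]; rfl, fun f hf x hx h => ?_⟩
    rw [dop_poly_add]
    filter_upwards [hb2 f hf x hx h, hc2 f hf x hx h, isOpen_compl_singleton.mem_nhds hx]
      with y h1 h2 hy0
    rw [Pi.add_apply, h1, h2, tailInt, tailInt, tailInt,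
      ← integral_add (integrableOn_tail _ b hy0) (integrableOn_tail _ c hy0)]
    simp [mul_add]
  | smul c p _ hp =>
    obtain ⟨b, hb, hb2⟩ := hp
    refine ⟨c • b, by rw [dop_poly_smul, ← hb]; rfl, fun f hf x hx h => ?_⟩
    rw [dop_poly_smul]
    filter_upwards [hb2 f hf x hx h] with y h1
    rw [Pi.smul_apply, h1, tailInt, tailInt, ← integral_smul]
    congr 1; ext s; simp; ring

/-- A cut-off tail integral is smooth. -/
theorem contDiff_cutoff_tailInt (b : ContDiffBump (0 : Euc n)) (a : ℤ) (g : 𝓢(Euc n, ℝ)) :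
    ContDiff ℝ ∞ (fun x => (1 - b x) * tailInt a g x) := by
  rw [contDiff_iff_contDiffAt]
  intro x
  rcases eq_or_ne x 0 with rfl | hx
  · have : (fun x => (1 - b x) * tailInt a g x) =ᶠ[𝓝 0] fun _ => 0 := by
      filter_upwards [ball_mem_nhds (0 : Euc n) b.rIn_pos] with y hy
      rw [b.one_of_mem_closedBall (ball_subset_closedBall hy)]; simp
    exact contDiffAt_const.congr_of_eventuallyEq this
  · exact (contDiffAt_const.sub b.contDiffAt).mul
      ((contDiffOn_tailInt a g).contDiffAt (isOpen_compl_singleton.mem_nhds hx))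

theorem exists_bound_cutoff_tailInt (b : ContDiffBump (0 : Euc n)) (a : ℤ) (g : 𝓢(Euc n, ℝ)) :
    ∃ C : ℝ, 0 ≤ C ∧ ∀ x, |(1 - b x) * tailInt a g x| ≤ C := by
  obtain ⟨C, hC0, hC⟩ := exists_tailInt_bound a g (N := (a + 2).toNat) (Int.self_le_toNat _)
  have hb := b.rIn_pos
  refine ⟨C * (b.rIn ^ (a + 2).toNat)⁻¹, by positivity, fun x => ?_⟩
  by_cases hx : ‖x‖ ≤ b.rIn
  · rw [b.one_of_mem_closedBall (by simpa using hx)]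
    simp only [sub_self, zero_mul, abs_zero]
    positivity
  · push Not at hx
    have hx0 : x ≠ 0 := by rintro rfl; simp at hx; linarith
    have h1 := hC x hx0
    rw [abs_mul]
    have h2 : |1 - b x| ≤ 1 := by
      rw [abs_of_nonneg (by linarith [b.le_one (x := x)])]
      linarith [b.nonneg (x := x)]
    calc _ ≤ 1 * ‖tailInt a g x‖ := by rw [Real.norm_eq_abs]; gcongr
      _ ≤ C * (‖x‖ ^ (a + 2).toNat)⁻¹ := by linarith
      _ ≤ _ := by gcongr

theorem exists_decay_cutoff_tailInt (b : ContDiffBump (0 : Euc n)) (a : ℤ) (g : 𝓢(Euc n, ℝ)) :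
    ∃ C : ℝ, 0 ≤ C ∧ ∀ x, |(1 - b x) * tailInt a g x| ≤ C * ((1 + ‖x‖) ^ (n + 1))⁻¹ := by
  set N := max (a + 2).toNat (n + 1) with hN
  obtain ⟨C, hC0, hC⟩ := exists_tailInt_bound a g (N := N) (by
    have := Int.self_le_toNat (a + 2); omega)
  obtain ⟨K, hK0, hK⟩ := exists_bound_cutoff_tailInt b a g
  refine ⟨max K C * 2 ^ (n + 1), by positivity, fun x => ?_⟩
  rw [← div_eq_mul_inv, le_div_iff₀ (by positivity)]
  by_cases hx : ‖x‖ ≤ 1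
  · have h1 : (1 + ‖x‖) ^ (n + 1) ≤ 2 ^ (n + 1) := by gcongr; linarith
    exact mul_le_mul ((hK x).trans (le_max_left _ _)) h1 (by positivity) (by positivity)
  · push Not at hx
    have hx0 : x ≠ 0 := by rintro rfl; simp at hx; linarith
    have h2 : |1 - b x| ≤ 1 := by
      rw [abs_of_nonneg (by linarith [b.le_one (x := x)])]
      linarith [b.nonneg (x := x)]
    have h3 : (1 + ‖x‖) ^ (n + 1) ≤ 2 ^ (n + 1) * ‖x‖ ^ N := by
      calc (1 + ‖x‖) ^ (n + 1) ≤ (2 * ‖x‖) ^ (n + 1) := by gcongr; linarith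
        _ = 2 ^ (n + 1) * ‖x‖ ^ (n + 1) := by rw [mul_pow]
        _ ≤ _ := by gcongr; exacts [hx.le, le_max_right _ _]
    have h4 : |(1 - b x) * tailInt a g x| ≤ C * (‖x‖ ^ N)⁻¹ := by
      rw [abs_mul]
      calc _ ≤ 1 * ‖tailInt a g x‖ := by rw [Real.norm_eq_abs]; gcongr
        _ ≤ C * (‖x‖ ^ N)⁻¹ := by linarith [hC x hx0]
    calc _ ≤ C * (‖x‖ ^ N)⁻¹ * (2 ^ (n + 1) * ‖x‖ ^ N) := by gcongr
      _ = C * 2 ^ (n + 1) := by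
        have : 0 < ‖x‖ := by linarith
        field_simp
      _ ≤ _ := by gcongr; exact le_max_right _ _

theorem integrable_cutoff_tailInt (b : ContDiffBump (0 : Euc n)) (a : ℤ) (g : 𝓢(Euc n, ℝ)) :
    Integrable (fun x => (1 - b x) * tailInt a g x) := by
  obtain ⟨C, hC0, hC⟩ := exists_decay_cutoff_tailInt b a g
  have h1 : Integrable (fun x : Euc n => (1 + ‖x‖) ^ (-((n : ℝ) + 1))) :=
    integrable_one_add_norm (by simp)
  refine (h1.const_mul C).mono' (contDiff_cutoff_tailInt b a g).continuous.aestronglyMeasurable ?_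
  refine Eventually.of_forall fun x => ?_
  rw [Real.norm_eq_abs]
  refine (hC x).trans (le_of_eq ?_)
  rw [Real.rpow_neg (by positivity), ← Nat.cast_add_one, Real.rpow_natCast]

/-- The integral of `q(∂) f` vanishes for integrable `f` when `q(∂) f` is integrable. -/
theorem integral_dop_eq_zero {q : MvPolynomial (Fin n) ℝ} {d : ℕ} (hq : q.IsHomogeneous (d + 1))
    {f : Euc n → ℝ} (hf : ContDiff ℝ ∞ f) (hi : Integrable f) (hqi : Integrable (dop q f)) :
    ∫ x, dop q f x = 0 := by
  let b : ContDiffBump (0 : Euc n) := ⟨1, 2, one_pos, one_lt_two⟩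
  have hb : IsTestFun n (b : Euc n → ℝ) := ⟨b.contDiff, b.hasCompactSupport⟩
  obtain ⟨C, hC0, hC⟩ := (hb.dop q).exists_bound
  have h1 : Tendsto (fun k : ℕ => ∫ x, b ((0 : Euc n) + (1 / ((k : ℝ) + 1)) • x) * dop q f x) atTop
      (𝓝 (∫ x, dop q f x)) := by
    refine tendsto_integral_of_dominated_convergence (fun x => ‖dop q f x‖) (fun k => ?_) hqi.norm
      (fun k => Eventually.of_forall fun x => ?_) (Eventually.of_forall fun x => ?_)
    · exact ((b.continuous.comp (by fun_prop)).mul (contDiff_dop q f).continuous).aestronglyMeasurable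
    · rw [norm_mul, Real.norm_of_nonneg b.nonneg]
      exact mul_le_of_le_one_left (norm_nonneg _) b.le_one
    · have h2 : Tendsto (fun k : ℕ => b ((0 : Euc n) + (1 / ((k : ℝ) + 1)) • x)) atTop
          (𝓝 (b ((0 : Euc n) + (0 : ℝ) • x))) := by
        refine (b.continuous.tendsto _).comp ?_
        exact tendsto_const_nhds.add (tendsto_one_div_add_atTop_nhds_zero_nat.smul_const x)
      have h3 : b ((0 : Euc n) + (0 : ℝ) • x) = 1 := by
        rw [b.one_of_mem_closedBall]; simp [b.rIn_pos.le]
      rw [h3] at h2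
      simpa using h2.mul_const (dop q f x)
  have h2 : Tendsto (fun k : ℕ => ∫ x, b ((0 : Euc n) + (1 / ((k : ℝ) + 1)) • x) * dop q f x) atTop
      (𝓝 0) := by
    have h3 : Tendsto (fun k : ℕ => (1 / ((k : ℝ) + 1)) * (C * ∫ x, ‖f x‖)) atTop (𝓝 0) := by
      simpa using tendsto_one_div_add_atTop_nhds_zero_nat.mul_const (C * ∫ x, ‖f x‖)
    refine squeeze_zero_norm (fun k => ?_) h3
    set t : ℝ := 1 / ((k : ℝ) + 1) with ht
    have ht0 : 0 < t := by positivity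
    have ht1 : t ≤ 1 := by
      rw [ht, div_le_one (by positivity)]; linarith [(Nat.cast_nonneg k : (0:ℝ) ≤ k)]
    have hbt : IsTestFun n (fun x => b ((0 : Euc n) + t • x)) := by
      refine isTestFun_of_support (contDiff_comp_affine t 0 hb.1) (R := 2 / t) fun x hx => ?_
      by_contra hlt
      push Not at hlt
      apply hx
      refine b.zero_of_le_dist ?_
      rw [zero_add, dist_zero_right, norm_smul, Real.norm_of_nonneg ht0.le]
      rw [div_lt_iff₀ ht0] at hlt
      change (2 : ℝ) ≤ _
      linarith
    have h4 := integral_dop_mul hq hbt hf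
    have h5 : ∫ x, b ((0 : Euc n) + t • x) * dop q f x =
        (-1) ^ (d + 1) * ∫ x, dop q (fun x => b ((0 : Euc n) + t • x)) x * f x := by
      rw [h4, ← mul_assoc, ← mul_pow]; simp
    rw [h5, norm_mul, norm_pow, norm_neg, norm_one, one_pow, one_mul, dop_comp_affine q hq t 0 hb.1]
    have h6 := norm_integral_le_of_norm_le (hi.norm.const_mul (t * C))
      (f := fun x => t ^ (d + 1) • dop q b ((0 : Euc n) + t • x) * f x)
      (Eventually.of_forall fun x => ?_)
    · rw [integral_const_mul] at h6
      linarith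
    · rw [norm_mul, norm_smul, norm_pow, Real.norm_of_nonneg ht0.le]
      gcongr
      · exact pow_le_of_le_one ht0.le ht1 (by simp)
      · exact hC _
  exact tendsto_nhds_unique h1 h2

theorem exists_isKernelPair {Q : MvPolynomial (Fin n) ℝ} {m : ℕ} (hQ : Q.IsHomogeneous (m + 1))
    (hell : ∀ ξ : Euc n, ξ ≠ 0 → pev Q ξ ≠ 0) : ∃ M φ, IsKernelPair Q M φ := by
  obtain ⟨M₀, φ₀, hM₀, hφ₀⟩ := exists_schwartz_pair hQ hell
  let b : ContDiffBump (0 : Euc n) := ⟨1, 2, one_pos, one_lt_two⟩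
  let a : ℤ := n - (m + 1) - 1
  let E : Euc n → ℝ := fun x => (1 - b x) * tailInt a M₀ x
  have hE : ContDiff ℝ ∞ E := contDiff_cutoff_tailInt b a M₀
  have hEi : Integrable E := integrable_cutoff_tailInt b a M₀
  obtain ⟨g, hg, hg2⟩ := exists_schwartz_dop_tailInt hQ a M₀
  have hφs := smoothFun_schwartz φ₀
  have hMs := smoothFun_schwartz M₀
  have hout : ∀ x : Euc n, ¬ ‖x‖ ≤ 2 → x ≠ 0 ∧ E =ᶠ[𝓝 x] tailInt a M₀ := by
    intro x hx
    push Not at hx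
    refine ⟨by rintro rfl; simp at hx; linarith, ?_⟩
    have : {y : Euc n | 2 < ‖y‖} ∈ 𝓝 x := (isOpen_lt continuous_const continuous_norm).mem_nhds hx
    filter_upwards [this] with y hy
    have : b y = 0 := b.zero_of_le_dist (by rw [dist_zero_right]; exact le_of_lt hy)
    simp [E, this]
  let c : ℝ := n - (m + 1)
  have hM : IsTestFun n ((M₀ : Euc n → ℝ) + c • E + radial E) := by
    refine isTestFun_of_support ((hMs.add (hE.const_smul c)).add (contDiff_radial hE)) (R := 2)
      fun x hx => ?_
    by_contra h2
    obtain ⟨hx0, h3⟩ := hout x h2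
    apply hx
    have h4 := radial_tailInt a M₀ hx0
    simp only [Pi.add_apply, Pi.smul_apply, h3.eq_of_nhds]
    rw [radial, h3.fderiv_eq]
    rw [radial] at h4
    have : (a + 1 : ℝ) = c := by simp [a, c]
    rw [this] at h4
    linarith
  have hφ : IsTestFun n ((φ₀ : Euc n → ℝ) + dop Q E) := by
    refine isTestFun_of_support (hφs.add (contDiff_dop Q E)) (R := 2) fun x hx => ?_
    by_contra h2
    obtain ⟨hx0, h3⟩ := hout x h2
    apply hx
    have h4 := (hg2 E hE x hx0 h3).eq_of_nhds
    have h5 := tailInt_radial φ₀ g (fun x => by rw [hg, hM₀]; rfl) hx0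
    have : a + ((m + 1 : ℕ) : ℤ) = (n : ℤ) - 1 := by simp only [a]; push_cast; ring
    rw [this] at h4
    simp only [Pi.add_apply, h4, h5]
    ring
  have hqi : Integrable (dop Q E) := by
    have := hφ.integrable.sub φ₀.integrable
    simpa using this
  refine ⟨_, _, hM, hφ, ?_, fun x => ?_⟩
  · simp only [Pi.add_apply]
    rw [integral_add φ₀.integrable hqi, hφ₀, integral_dop_eq_zero hQ hE hEi hqi, add_zero]
  · have hcE : ContDiff ℝ ∞ (c • E) := hE.const_smul c
    have hMc : ContDiff ℝ ∞ ((M₀ : Euc n → ℝ) + c • E) := hMs.add hcE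
    rw [dop_add Q hMc (contDiff_radial hE), dop_add Q hMs hcE,
      dop_smul Q c hE, dop_radial hQ hE, radial_add hφs (contDiff_dop Q E)]
    simp only [Pi.add_apply, Pi.smul_apply, hM₀, smul_eq_mul, c]
    push_cast
    ring

end KernelPair

noncomputable section EllipticInverse

set_option linter.unusedSectionVars false

variable {n k : ℕ}

theorem homogeneousComponent_mul_of_isHomogeneous {a : MvPolynomial (Fin n) ℝ}
    (ha : a.IsHomogeneous k) (p : MvPolynomial (Fin n) ℝ) (l : ℕ) :
    MvPolynomial.homogeneousComponent (k + l) (a * p) =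
      a * MvPolynomial.homogeneousComponent l p := by
  conv_lhs => rw [← MvPolynomial.sum_homogeneousComponent p, Finset.mul_sum, map_sum]
  have h1 : ∀ i, MvPolynomial.homogeneousComponent (k + l)
      (a * MvPolynomial.homogeneousComponent i p) =
      if k + l = k + i then a * MvPolynomial.homogeneousComponent i p else 0 := fun i =>
    (MvPolynomial.homogeneousComponent_of_mem
      (ha.mul (MvPolynomial.homogeneousComponent_isHomogeneous i p)))
  simp only [h1, add_right_inj]
  rw [Finset.sum_ite_eq]
  split_ifs with h
  · rfl
  · rw [MvPolynomial.homogeneousComponent_eq_zero, mul_zero]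
    simpa using h

theorem isHomogeneous_det {ι : Type*} [Fintype ι] [DecidableEq ι]
    (N : Matrix ι ι (MvPolynomial (Fin n) ℝ)) {d : ℕ} (hN : ∀ i j, (N i j).IsHomogeneous d) :
    N.det.IsHomogeneous (Fintype.card ι * d) := by
  rw [Matrix.det_apply]
  refine MvPolynomial.IsHomogeneous.sum _ _ _ fun τ _ => ?_
  have h : (∏ i, N (τ i) i).IsHomogeneous (Fintype.card ι * d) := by
    have := MvPolynomial.IsHomogeneous.prod Finset.univ (fun i => N (τ i) i) (fun _ => d)
      (fun i _ => hN _ _)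
    simpa using this
  rcases Int.units_eq_one_or (Equiv.Perm.sign τ) with h1 | h1 <;> rw [h1]
  · simpa using h
  · simpa using h.neg

theorem isHomogeneous_prod_X (I : Fin k → Fin n) :
    (∏ i, MvPolynomial.X (I i) : MvPolynomial (Fin n) ℝ).IsHomogeneous k := by
  have := MvPolynomial.IsHomogeneous.prod Finset.univ
    (fun i => (MvPolynomial.X (I i) : MvPolynomial (Fin n) ℝ)) (fun _ => 1)
    (fun i _ => MvPolynomial.isHomogeneous_X _ _)
  simpa using this

variable {V W ι κ : Type*} [NormedAddCommGroup V] [InnerProductSpace ℝ V] [FiniteDimensional ℝ V]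
  [NormedAddCommGroup W] [InnerProductSpace ℝ W] [FiniteDimensional ℝ W]
  [Fintype ι] [Fintype κ] [DecidableEq ι] [DecidableEq κ]

/-- The matrix of the symbol, with polynomial entries. -/
def symMatrix (A : CoeffOp n k V W) (bV : OrthonormalBasis ι ℝ V) (bW : OrthonormalBasis κ ℝ W) :
    Matrix κ ι (MvPolynomial (Fin n) ℝ) :=
  fun j i => ∑ I : Fin k → Fin n, ⟪bW j, A I (bV i)⟫ • ∏ l, MvPolynomial.X (I l)

theorem isHomogeneous_symMatrix (A : CoeffOp n k V W) (bV : OrthonormalBasis ι ℝ V)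
    (bW : OrthonormalBasis κ ℝ W) (j : κ) (i : ι) : (symMatrix A bV bW j i).IsHomogeneous k := by
  refine MvPolynomial.IsHomogeneous.sum _ _ _ fun I _ => ?_
  rw [MvPolynomial.smul_eq_C_mul]
  exact (isHomogeneous_prod_X I).C_mul _

theorem pev_symMatrix (A : CoeffOp n k V W) (bV : OrthonormalBasis ι ℝ V)
    (bW : OrthonormalBasis κ ℝ W) (ξ : Euc n) (j : κ) (i : ι) :
    pev (symMatrix A bV bW j i) ξ = ⟪bW j, symbolMap n k A ξ (bV i)⟫ := by
  simp only [pev, symMatrix, symbolMap, map_sum, LinearMap.sum_apply, inner_sum]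
  refine Finset.sum_congr rfl fun I _ => ?_
  rw [MvPolynomial.smul_eval, map_prod, LinearMap.smul_apply, inner_smul_right]
  simp [mul_comm]

theorem pev_det_ne_zero {A : CoeffOp n k V W} (hA : IsElliptic n k A) (bV : OrthonormalBasis ι ℝ V)
    (bW : OrthonormalBasis κ ℝ W) {ξ : Euc n} (hξ : ξ ≠ 0) :
    pev ((symMatrix A bV bW).transpose * symMatrix A bV bW).det ξ ≠ 0 := by
  rw [pev, RingHom.map_det, RingHom.mapMatrix_apply, Matrix.map_mul, Matrix.transpose_map]
  set N : Matrix κ ι ℝ := (symMatrix A bV bW).map (MvPolynomial.eval fun i => ξ i) with hN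
  intro h0
  obtain ⟨x, hx0, hx⟩ := Matrix.exists_mulVec_eq_zero_iff.2 h0
  have h1 : x ∈ (N.transpose * N).mulVecLin.ker := hx
  rw [Matrix.ker_mulVecLin_transpose_mul_self] at h1
  have h2 : N.mulVec x = 0 := h1
  have h3 : symbolMap n k A ξ (∑ i, x i • bV i) = 0 := by
    refine (bW.repr.map_eq_zero_iff).1 ?_
    ext j
    rw [bW.repr_apply_apply, map_sum, inner_sum]
    have := congrFun h2 j
    rw [Matrix.mulVec, dotProduct] at this
    simp only [map_smul, inner_smul_right]
    refine Eq.trans ?_ this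
    refine Finset.sum_congr rfl fun i _ => ?_
    rw [← pev_symMatrix, mul_comm]
    rfl
  have h4 := hA ξ hξ (h3.trans (map_zero _).symm)
  apply hx0
  ext i
  have h5 := congrArg (fun z => ⟪bV i, z⟫) h4
  simpa [inner_sum, inner_smul_right, bV.inner_eq_ite] using h5

theorem exists_elliptic_inverse {A : CoeffOp n k V W} (hA : IsElliptic n k A)
    (hk : 1 ≤ k) (bV : OrthonormalBasis ι ℝ V) (bW : OrthonormalBasis κ ℝ W) (i₀ : ι) :
    ∃ (l : ℕ) (Q : MvPolynomial (Fin n) ℝ) (p : κ → MvPolynomial (Fin n) ℝ),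
      1 ≤ l ∧ Q.IsHomogeneous (k + l) ∧ (∀ ξ, ξ ≠ 0 → pev Q ξ ≠ 0) ∧
      (∀ j, (p j).IsHomogeneous l) ∧
      ∀ i, ∑ j, symMatrix A bV bW j i * p j = if i = i₀ then Q else 0 := by
  set a := symMatrix A bV bW with ha
  set N := a.transpose * a with hN
  have hNh : ∀ i j, (N i j).IsHomogeneous (2 * k) := by
    intro i j
    rw [hN, Matrix.mul_apply]
    refine MvPolynomial.IsHomogeneous.sum _ _ _ fun s _ => ?_
    rw [two_mul]
    exact (isHomogeneous_symMatrix A bV bW _ _).mul (isHomogeneous_symMatrix A bV bW _ _)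
  have hc : 1 ≤ Fintype.card ι := Fintype.card_pos_iff.2 ⟨i₀⟩
  obtain ⟨l, hl⟩ : ∃ l, Fintype.card ι * (2 * k) = k + l :=
    Nat.exists_eq_add_of_le (by nlinarith)
  refine ⟨l, N.det, fun j => MvPolynomial.homogeneousComponent l ((a * N.adjugate) j i₀), ?_,
    hl ▸ isHomogeneous_det N hNh, fun ξ hξ => pev_det_ne_zero hA bV bW hξ,
    fun j => MvPolynomial.homogeneousComponent_isHomogeneous _ _, fun i => ?_⟩
  · nlinarith
  · have h1 : ∑ j, a j i * (a * N.adjugate) j i₀ = if i = i₀ then N.det else 0 := by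
      have : (a.transpose * (a * N.adjugate)) i i₀ = (N.det • (1 : Matrix ι ι _)) i i₀ := by
        rw [← Matrix.mul_assoc, ← hN, Matrix.mul_adjugate]
      rw [Matrix.mul_apply] at this
      simpa [Matrix.one_apply] using this
    have h2 := congrArg (MvPolynomial.homogeneousComponent (k + l)) h1
    rw [map_sum] at h2
    simp only [homogeneousComponent_mul_of_isHomogeneous (isHomogeneous_symMatrix A bV bW _ _),
      ha] at h2
    rw [h2]
    split_ifs
    · exact MvPolynomial.homogeneousComponent_eq_self (hl ▸ isHomogeneous_det N hNh)
    · simp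

theorem integrable_locallyIntegrable_mul {F : Type*} [NormedAddCommGroup F] [NormedSpace ℝ F]
    {ν : Measure (Euc n)} {w : Euc n → F} (hw : LocallyIntegrable w ν) {h : Euc n → ℝ}
    (hh : IsTestFun n h) : Integrable (fun x => h x • w x) ν :=
  hw.integrable_smul_left_of_hasCompactSupport hh.continuous hh.2

theorem integral_inner_dop_eq {A : CoeffOp n k V W} {u : Euc n → V}
    {σ : Measure (Euc n)} {f : Euc n → W} (hu : LocallyIntegrable u volume)
    (hf : LocallyIntegrable f σ) (hAu : HasDistribA n k A u σ f)
    (bV : OrthonormalBasis ι ℝ V) (bW : OrthonormalBasis κ ℝ W) {i₀ : ι}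
    {Q : MvPolynomial (Fin n) ℝ} {p : κ → MvPolynomial (Fin n) ℝ}
    (hp : ∀ i, ∑ j, symMatrix A bV bW j i * p j = if i = i₀ then Q else 0)
    {ζ : Euc n → ℝ} (hζ : IsTestFun n ζ) :
    ∫ x, dop Q ζ x * ⟪bV i₀, u x⟫ =
      (-1) ^ k * ∑ j, ∫ x, dop (p j) ζ x * ⟪bW j, f x⟫ ∂σ := by
  have hζ' := hζ.contDiff
  let L : κ → ℝ →L[ℝ] W := fun j => (ContinuousLinearMap.id ℝ ℝ).smulRight (bW j)
  have hs : ∀ j, IsTestFun n (fun x => L j (dop (p j) ζ x)) := fun j =>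
    ⟨(L j).contDiff.comp (contDiff_dop _ _), (hζ.dop (p j)).2.comp_left (map_zero _)⟩
  have hsum : ∀ s : Finset κ, IsTestFun n (fun x => ∑ j ∈ s, L j (dop (p j) ζ x)) ∧
      ∀ q : MvPolynomial (Fin n) ℝ, dop q (fun x => ∑ j ∈ s, L j (dop (p j) ζ x)) =
        fun x => ∑ j ∈ s, L j (dop q (dop (p j) ζ) x) := by
    intro s
    induction s using Finset.induction_on with
    | empty =>
      refine ⟨⟨contDiff_const, HasCompactSupport.zero⟩, fun q => ?_⟩
      exact (dop_zero (F := W) q)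
    | insert j s hj ih =>
      have he : (fun x => ∑ j ∈ insert j s, L j (dop (p j) ζ x)) =
          (fun x => L j (dop (p j) ζ x)) + fun x => ∑ j ∈ s, L j (dop (p j) ζ x) := by
        ext x; rw [Finset.sum_insert hj]; rfl
      refine ⟨he ▸ (hs j).add ih.1, fun q => ?_⟩
      rw [he, dop_add q (hs j).contDiff ih.1.contDiff, ih.2,
        dop_clm_comp (L j) q (contDiff_dop (p j) ζ)]
      ext x
      rw [Finset.sum_insert hj]; rfl
  have h1 := hAu _ (hsum Finset.univ).1
  have h2 : ∀ x, ⟪f x, ∑ j, L j (dop (p j) ζ x)⟫ = ∑ j, dop (p j) ζ x * ⟪bW j, f x⟫ := by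
    intro x
    rw [inner_sum]
    refine Finset.sum_congr rfl fun j _ => ?_
    simp [L, inner_smul_right, real_inner_comm]
  have hfi : ∀ j, Integrable (fun x => dop (p j) ζ x * ⟪bW j, f x⟫) σ := fun j => by
    have := (integrable_locallyIntegrable_mul hf (hζ.dop (p j))).const_inner (𝕜 := ℝ) (bW j)
    simpa [inner_smul_right] using this
  have h3 : ∫ x, ⟪f x, ∑ j, L j (dop (p j) ζ x)⟫ ∂σ =
      ∑ j, ∫ x, dop (p j) ζ x * ⟪bW j, f x⟫ ∂σ := by
    simp only [h2]
    exact integral_finsetSum _ fun j _ => hfi j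
  rw [h3] at h1
  rw [← h1, ← mul_assoc, ← pow_add, Even.neg_one_pow ⟨k, rfl⟩, one_mul]
  have h4 : ∀ (I : Fin k → Fin n) x,
      ⟪u x, LinearMap.adjoint (A I) (dirDeriv n k I (fun x => ∑ j, L j (dop (p j) ζ x)) x)⟫ =
      ∑ j, dop ((∏ i, MvPolynomial.X (I i)) * p j) ζ x * ⟪A I (u x), bW j⟫ := by
    intro I x
    rw [LinearMap.adjoint_inner_right, dirDeriv_eq_dop I (hsum Finset.univ).1.contDiff,
      (hsum Finset.univ).2, inner_sum]
    refine Finset.sum_congr rfl fun j _ => ?_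
    simp [L, inner_smul_right, dop_mul _ _ hζ']
  have hui : ∀ (I : Fin k → Fin n) j, Integrable
      (fun x => dop ((∏ i, MvPolynomial.X (I i)) * p j) ζ x * ⟪A I (u x), bW j⟫) := fun I j => by
    have h5 := (integrable_locallyIntegrable_mul hu
      (hζ.dop ((∏ i, MvPolynomial.X (I i)) * p j))).const_inner (𝕜 := ℝ) (LinearMap.adjoint (A I) (bW j))
    refine h5.congr (Eventually.of_forall fun x => ?_)
    simp [inner_smul_right, LinearMap.adjoint_inner_left, real_inner_comm]
  simp only [h4]
  rw [← integral_finsetSum _ fun I _ => integrable_finsetSum _ fun j _ => hui I j]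
  congr 1
  ext x
  rw [Finset.sum_comm]
  have h6 : ∀ (I : Fin k → Fin n) j, ⟪A I (u x), bW j⟫ =
      ∑ i, ⟪bV i, u x⟫ * ⟪bW j, A I (bV i)⟫ := by
    intro I j
    conv_lhs => rw [← bV.sum_repr' (u x)]
    rw [map_sum, sum_inner]
    refine Finset.sum_congr rfl fun i _ => ?_
    rw [map_smul, real_inner_smul_left, real_inner_comm (bW j)]
  simp only [h6, Finset.mul_sum]
  calc dop Q ζ x * ⟪bV i₀, u x⟫
      = ∑ i, dop (∑ j, symMatrix A bV bW j i * p j) ζ x * ⟪bV i, u x⟫ := by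
        rw [Finset.sum_eq_single i₀]
        · rw [hp]; simp
        · intro i _ hi
          rw [hp, if_neg hi, dop_poly_zero]; simp
        · simp
    _ = ∑ i, ∑ j, ∑ I : Fin k → Fin n, dop ((∏ i, MvPolynomial.X (I i)) * p j) ζ x *
          (⟪bV i, u x⟫ * ⟪bW j, A I (bV i)⟫) := by
        refine Finset.sum_congr rfl fun i _ => ?_
        rw [dop_poly_sum, Finset.sum_apply, Finset.sum_mul]
        refine Finset.sum_congr rfl fun j _ => ?_
        simp only [symMatrix, Finset.sum_mul, smul_mul_assoc]
        rw [dop_poly_sum, Finset.sum_apply, Finset.sum_mul]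
        refine Finset.sum_congr rfl fun I _ => ?_
        rw [dop_poly_smul]
        simp only [Pi.smul_apply, smul_eq_mul]
        ring
    _ = _ := by
        rw [Finset.sum_comm]
        refine Finset.sum_congr rfl fun j _ => ?_
        rw [Finset.sum_comm]

end EllipticInverse

noncomputable section IntegralMinkowski

theorem lintegral_rpow_lintegral_le {α β : Type*} [MeasurableSpace α] [MeasurableSpace β]
    {μ : Measure α} {ν : Measure β} [SFinite μ] [SFinite ν] {p : ℝ} (hp : 1 ≤ p)
    {F : α → β → ℝ≥0∞} (hF : Measurable (Function.uncurry F)) {g : β → ℝ≥0∞} (hg : Measurable g)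
    (hg0 : ∀ᵐ y ∂ν, g y ≠ 0) (hgt : ∀ᵐ y ∂ν, g y ≠ ⊤)
    (hFg : ∀ᵐ y ∂ν, ∫⁻ x, F x y ^ p ∂μ ≤ g y ^ p) :
    ∫⁻ x, (∫⁻ y, F x y ∂ν) ^ p ∂μ ≤ (∫⁻ y, g y ∂ν) ^ p := by
  have hFy : ∀ x, Measurable (F x) := fun x => hF.comp measurable_prodMk_left
  rcases hp.eq_or_lt with rfl | hp
  · simp only [ENNReal.rpow_one] at *
    rw [lintegral_lintegral_swap hF.aemeasurable]
    exact lintegral_mono_ae hFg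
  have hpq := Real.HolderConjugate.conjExponent hp
  set q := p.conjExponent
  have hp0 : 0 < p := by linarith
  have hq0 : 0 < q := hpq.symm.pos
  have h1 : ∀ x, (∫⁻ y, F x y ∂ν) ^ p ≤
      (∫⁻ y, F x y ^ p * g y ^ (1 - p) ∂ν) * (∫⁻ y, g y ∂ν) ^ (p - 1) := by
    intro x
    have h2 := ENNReal.lintegral_mul_le_Lp_mul_Lq ν hpq
      (f := fun y => F x y * g y ^ (-(1 / q))) (g := fun y => g y ^ (1 / q))
      ((hFy x).mul (hg.pow_const _)).aemeasurable (hg.pow_const _).aemeasurable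
    have h3 : ∫⁻ y, F x y ∂ν =
        ∫⁻ y, ((fun y => F x y * g y ^ (-(1 / q))) * fun y => g y ^ (1 / q)) y ∂ν := by
      refine lintegral_congr_ae ?_
      filter_upwards [hg0, hgt] with y h0 ht
      rw [Pi.mul_apply, mul_assoc, ← ENNReal.rpow_add _ _ h0 ht, neg_add_cancel,
        ENNReal.rpow_zero, mul_one]
    rw [← h3] at h2
    refine (ENNReal.rpow_le_rpow h2 hp0.le).trans (le_of_eq ?_)
    rw [ENNReal.mul_rpow_of_nonneg _ _ hp0.le, ← ENNReal.rpow_mul, ← ENNReal.rpow_mul,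
      one_div_mul_cancel hp0.ne', ENNReal.rpow_one]
    have hpq' : 1 / q * p = p - 1 := by
      have := hpq.inv_add_inv_eq_one
      field_simp at this ⊢
      nlinarith
    rw [hpq']
    congr 1
    · refine lintegral_congr fun y => ?_
      rw [ENNReal.mul_rpow_of_nonneg _ _ hp0.le, ← ENNReal.rpow_mul, neg_mul, hpq', neg_sub]
    · congr 1
      refine lintegral_congr fun y => ?_
      rw [← ENNReal.rpow_mul, one_div_mul_cancel hq0.ne', ENNReal.rpow_one]
  calc ∫⁻ x, (∫⁻ y, F x y ∂ν) ^ p ∂μ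
      ≤ ∫⁻ x, (∫⁻ y, F x y ^ p * g y ^ (1 - p) ∂ν) * (∫⁻ y, g y ∂ν) ^ (p - 1) ∂μ :=
        lintegral_mono h1
    _ = (∫⁻ x, ∫⁻ y, F x y ^ p * g y ^ (1 - p) ∂ν ∂μ) * (∫⁻ y, g y ∂ν) ^ (p - 1) := by
        rw [lintegral_mul_const]
        exact Measurable.lintegral_prod_right
          ((hF.pow_const p).mul ((hg.comp measurable_snd).pow_const _))
    _ = (∫⁻ y, (∫⁻ x, F x y ^ p ∂μ) * g y ^ (1 - p) ∂ν) * (∫⁻ y, g y ∂ν) ^ (p - 1) := by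
        rw [lintegral_lintegral_swap
          ((hF.pow_const p).mul ((hg.comp measurable_snd).pow_const _)).aemeasurable]
        congr 1
        refine lintegral_congr fun y => ?_
        exact lintegral_mul_const _ ((hF.comp measurable_prodMk_right).pow_const _)
    _ ≤ (∫⁻ y, g y ∂ν) * (∫⁻ y, g y ∂ν) ^ (p - 1) := by
        refine mul_le_mul_left (lintegral_mono_ae ?_) _
        filter_upwards [hFg, hg0, hgt] with y h h0 ht
        refine (mul_le_mul_left h _).trans (le_of_eq ?_)
        rw [← ENNReal.rpow_add _ _ h0 ht]
        simp
    _ = (∫⁻ y, g y ∂ν) ^ p := by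
        conv_lhs => enter [1]; rw [← ENNReal.rpow_one (∫⁻ y, g y ∂ν)]
        rw [← ENNReal.rpow_add_of_nonneg _ _ zero_le_one (by linarith)]
        congr 1; ring

end IntegralMinkowski

noncomputable section LpDifferentiability

variable {n : ℕ}

/-- `L^p`-differentiability of order one at `x`, with approximate gradient `T`. -/
def LpDiffAt (p : ℝ) (w : Euc n → ℝ) (x : Euc n) (T : Fin n → ℝ) : Prop :=
  ∃ c : ℝ, Tendsto (fun r => eLpNorm (fun y => w y - (c + ∑ b, (y b - x b) * T b))
    (ENNReal.ofReal p) (volume.restrict (ball x r)) / ENNReal.ofReal (r ^ (1 + n / p)))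
    (𝓝[>] (0 : ℝ)) (𝓝 0)

theorem continuous_affine (c : ℝ) (x : Euc n) (T : Fin n → ℝ) :
    Continuous fun y : Euc n => c + ∑ b, (y b - x b) * T b := by
  fun_prop

theorem LpDiffAt.add {p : ℝ} (hp : 1 ≤ p) {w w' : Euc n → ℝ} {x : Euc n} {T T' : Fin n → ℝ}
    (h : LpDiffAt p w x T) (h' : LpDiffAt p w' x T') (hw : AEStronglyMeasurable w volume)
    (hw' : AEStronglyMeasurable w' volume) : LpDiffAt p (w + w') x (T + T') := by
  obtain ⟨c, hc⟩ := h
  obtain ⟨c', hc'⟩ := h'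
  refine ⟨c + c', ?_⟩
  have h1 := hc.add hc'
  rw [add_zero] at h1
  refine tendsto_of_tendsto_of_tendsto_of_le_of_le tendsto_const_nhds h1 (fun _ => zero_le)
    fun r => ?_
  simp only
  rw [← ENNReal.add_div]
  refine ENNReal.div_le_div_right ?_ _
  have e : (fun y => (w + w') y - (c + c' + ∑ b, (y b - x b) * (T + T') b)) =
      (fun y => w y - (c + ∑ b, (y b - x b) * T b)) +
        fun y => w' y - (c' + ∑ b, (y b - x b) * T' b) := by
    ext y
    simp only [Pi.add_apply, mul_add, Finset.sum_add_distrib]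
    ring
  rw [e]
  refine eLpNorm_add_le ?_ ?_ ?_
  · exact (hw.sub (continuous_affine c x T).aestronglyMeasurable).restrict
  · exact (hw'.sub (continuous_affine c' x T').aestronglyMeasurable).restrict
  · simpa using ENNReal.ofReal_le_ofReal hp

theorem LpDiffAt.const_mul {p : ℝ} {w : Euc n → ℝ} {x : Euc n} {T : Fin n → ℝ}
    (h : LpDiffAt p w x T) (a : ℝ) : LpDiffAt p (fun y => a * w y) x (fun b => a * T b) := by
  obtain ⟨c, hc⟩ := h
  refine ⟨a * c, ?_⟩
  have h1 := ENNReal.Tendsto.const_mul (a := ‖a‖ₑ) hc (Or.inr (by simp))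
  rw [mul_zero] at h1
  refine h1.congr fun r => ?_
  rw [← mul_div_assoc]
  congr 1
  rw [← eLpNorm_const_smul]
  congr 1
  ext y
  simp only [Pi.smul_apply, smul_eq_mul, mul_sub, mul_add, Finset.mul_sum]
  congr 2
  exact Finset.sum_congr rfl fun b _ => by ring

theorem LpDiffAt.congr {p : ℝ} {w w' : Euc n → ℝ} {x : Euc n} {T : Fin n → ℝ}
    (h : LpDiffAt p w x T) {ρ : ℝ} (hρ : 0 < ρ) (hw : w =ᵐ[volume.restrict (ball x ρ)] w') :
    LpDiffAt p w' x T := by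
  obtain ⟨c, hc⟩ := h
  refine ⟨c, hc.congr' ?_⟩
  filter_upwards [Ioo_mem_nhdsGT hρ] with r hr
  congr 1
  refine eLpNorm_congr_ae ?_
  filter_upwards [ae_restrict_of_ae_restrict_of_subset (ball_subset_ball hr.2.le) hw] with y hy
  rw [hy]

theorem lpDiffAt_zero (p : ℝ) (x : Euc n) : LpDiffAt p (0 : Euc n → ℝ) x 0 :=
  ⟨0, by simp⟩

theorem LpDiffAt.sum {p : ℝ} (hp : 1 ≤ p) {ι : Type*} (s : Finset ι) {w : ι → Euc n → ℝ}
    {x : Euc n} {T : ι → Fin n → ℝ} (h : ∀ j, LpDiffAt p (w j) x (T j))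
    (hw : ∀ j, AEStronglyMeasurable (w j) volume) :
    LpDiffAt p (∑ j ∈ s, w j) x (∑ j ∈ s, T j) := by
  classical
  induction s using Finset.induction_on with
  | empty => simpa using lpDiffAt_zero p x
  | insert j s hj ih =>
    rw [Finset.sum_insert hj, Finset.sum_insert hj]
    exact (h j).add hp ih (hw j) (Finset.aestronglyMeasurable_sum _ fun j _ => hw j)

end LpDifferentiability

noncomputable section ConeKernel

variable {n : ℕ}

/-- `1/p`-th power of the volume of the unit ball. -/
def ballConst (n : ℕ) (p : ℝ) : ℝ := (volume (ball (0 : Euc n) 1)).toReal ^ (1 / p)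

theorem ballConst_pos (n : ℕ) (p : ℝ) : 0 < ballConst n p := by
  refine Real.rpow_pos_of_pos (ENNReal.toReal_pos ?_ ?_) _
  · exact (measure_ball_pos volume 0 one_pos).ne'
  · exact measure_ball_lt_top.ne

theorem volume_ball_euc (x : Euc n) {r : ℝ} (hr : 0 < r) :
    volume (ball x r) = ENNReal.ofReal (r ^ n) * volume (ball (0 : Euc n) 1) := by
  rw [Measure.addHaar_ball_of_pos volume x hr, finrank_euclideanSpace, Fintype.card_fin]

/-- The kernel equal to `t⁻ⁿ` where `|z - y| < ρ t` and zero elsewhere, at `a = (t, y)`. -/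
def coneKer (ρ : ℝ) (z : Euc n) (a : ℝ × Euc n) : ℝ≥0∞ :=
  {b : ℝ × Euc n | dist z b.2 < ρ * b.1}.indicator (fun b => ENNReal.ofReal ((b.1⁻¹) ^ n)) a

theorem measurable_coneKer (ρ : ℝ) : Measurable (Function.uncurry (coneKer (n := n) ρ)) := by
  have h : Function.uncurry (coneKer (n := n) ρ) =
      {q : Euc n × (ℝ × Euc n) | dist q.1 q.2.2 < ρ * q.2.1}.indicator
        (fun q => ENNReal.ofReal ((q.2.1⁻¹) ^ n)) := by
    ext ⟨z, a⟩
    simp [Function.uncurry, coneKer, Set.indicator]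
  rw [h]
  refine Measurable.indicator (by fun_prop) ?_
  exact measurableSet_lt (by fun_prop) (by fun_prop)

theorem measurable_coneKer_left (ρ : ℝ) (z : Euc n) : Measurable (coneKer (n := n) ρ z) := by
  unfold coneKer
  refine Measurable.indicator (by fun_prop) ?_
  exact measurableSet_lt (by fun_prop) (by fun_prop)

theorem lintegral_coneKer_rpow {p : ℝ} (hp : 1 ≤ p) {ρ : ℝ} (hρ : 0 < ρ) {a : ℝ × Euc n}
    (ha : 0 < a.1) : ∫⁻ z, coneKer ρ z a ^ p =
      ENNReal.ofReal (ballConst n p * ρ ^ (n / p) * a.1 ^ (-n + n / p : ℝ)) ^ p := by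
  have hp0 : 0 < p := by linarith
  have h1 : ∀ z, coneKer ρ z a ^ p =
      (ball a.2 (ρ * a.1)).indicator (fun _ => ENNReal.ofReal ((a.1⁻¹) ^ n) ^ p) z := by
    intro z
    by_cases hz : dist z a.2 < ρ * a.1
    · simp [coneKer, Set.indicator, hz]
    · simp [coneKer, Set.indicator, hz, hp0]
  simp only [h1]
  rw [lintegral_indicator_const measurableSet_ball, volume_ball_euc _ (by positivity)]
  have hV : volume (ball (0 : Euc n) 1) = ENNReal.ofReal (ballConst n p ^ p) := by
    rw [ballConst, ← Real.rpow_mul ENNReal.toReal_nonneg, one_div_mul_cancel hp0.ne',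
      Real.rpow_one, ENNReal.ofReal_toReal measure_ball_lt_top.ne]
  have hb := ballConst_pos n p
  rw [hV, ENNReal.ofReal_rpow_of_nonneg (by positivity) hp0.le,
    ENNReal.ofReal_rpow_of_nonneg (by positivity) hp0.le,
    ← ENNReal.ofReal_mul (by positivity), ← ENNReal.ofReal_mul (by positivity)]
  congr 1
  rw [Real.mul_rpow (by positivity) (by positivity), Real.mul_rpow (by positivity) (by positivity),
    ← Real.rpow_mul ha.le, ← Real.rpow_mul hρ.le, inv_pow, Real.inv_rpow (by positivity),
    ← Real.rpow_natCast a.1 n, ← Real.rpow_mul ha.le, mul_pow, ← Real.rpow_natCast ρ n,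
    ← Real.rpow_natCast a.1 n, ← Real.rpow_neg ha.le]
  have e1 : (n / p * p : ℝ) = n := by field_simp
  have e2 : ((-n + n / p) * p : ℝ) = -(n * p) + n := by field_simp
  rw [e1, e2, Real.rpow_add ha]
  ring

theorem lintegral_rpow_coneKer_le {p : ℝ} (hp : 1 ≤ p) {ρ : ℝ} (hρ : 0 < ρ)
    {ν : Measure (ℝ × Euc n)} [SFinite ν] (hν : ∀ᵐ a ∂ν, 0 < a.1) (B : Set (Euc n)) :
    ∫⁻ z in B, (∫⁻ a, coneKer ρ z a ∂ν) ^ p ≤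
      (∫⁻ a, ENNReal.ofReal (ballConst n p * ρ ^ (n / p) * a.1 ^ (-n + n / p : ℝ)) ∂ν) ^ p := by
  have hb := ballConst_pos n p
  refine lintegral_rpow_lintegral_le hp (measurable_coneKer ρ) (by fun_prop) ?_ ?_ ?_
  · filter_upwards [hν] with a ha
    have : 0 < ballConst n p * ρ ^ (n / p) * a.1 ^ (-n + n / p : ℝ) := by positivity
    simpa using this
  · exact Eventually.of_forall fun a => ENNReal.ofReal_ne_top
  · filter_upwards [hν] with a ha
    rw [← lintegral_coneKer_rpow hp hρ ha]
    exact lintegral_mono' Measure.restrict_le_self le_rfl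

theorem rpow_exponent {p : ℝ} (hp : 1 ≤ p) (hp2 : p * ((n : ℝ) - 1) < n) :
    0 < (1 - n + n / p : ℝ) := by
  have : 0 < p := by linarith
  have h : (n : ℝ) - 1 < n / p := by rw [lt_div_iff₀ this]; linarith
  linarith

theorem lintegral_rpow_Ioc {e : ℝ} (he : 0 < 1 + e) {s : ℝ} (hs : 0 ≤ s) :
    ∫⁻ t in Set.Ioc 0 s, ENNReal.ofReal (t ^ e) = ENNReal.ofReal (s ^ (1 + e) / (1 + e)) := by
  have h1 := intervalIntegral.intervalIntegrable_rpow' (a := 0) (b := s) (r := e) (by linarith)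
  rw [← ofReal_integral_eq_lintegral_ofReal]
  · rw [← intervalIntegral.integral_of_le hs, integral_rpow (Or.inl (by linarith)),
      Real.zero_rpow (by linarith), sub_zero, add_comm]
  · exact (intervalIntegrable_iff_integrableOn_Ioc_of_le hs).1 h1
  · filter_upwards [ae_restrict_mem measurableSet_Ioc] with t ht
    exact Real.rpow_nonneg ht.1.le _

theorem lintegral_comp_add_smul (z : Euc n) {t : ℝ} (ht : 0 < t) {G : Euc n → ℝ≥0∞}
    (hG : Measurable G) :
    ∫⁻ y, G (z + t • y) = ENNReal.ofReal ((t⁻¹) ^ n) * ∫⁻ y, G y := by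
  have h1 : Measurable fun y : Euc n => t • y := measurable_const_smul t
  have h2 := lintegral_map (μ := volume) (f := fun y => G (z + y)) (g := fun y : Euc n => t • y)
    (hG.comp (measurable_const_add z)) h1
  rw [← h2, Measure.map_addHaar_smul volume ht.ne', lintegral_smul_measure,
    lintegral_add_left_eq_self G z, finrank_euclideanSpace, Fintype.card_fin, abs_of_pos,
    inv_pow]
  · rfl
  · positivity

theorem enorm_sub_le_lintegral {w : Euc n → ℝ} (hw : ContDiff ℝ ∞ w) (z y : Euc n) :
    ‖w y - w z‖ₑ ≤
      ∫⁻ t in Set.Ioc (0 : ℝ) 1, ‖y - z‖ₑ * ‖fderiv ℝ w (z + t • (y - z))‖ₑ := by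
  have hd : ∀ t : ℝ, HasDerivAt (fun t : ℝ => w (z + t • (y - z)))
      (fderiv ℝ w (z + t • (y - z)) (y - z)) t := by
    intro t
    have h1 : HasDerivAt (fun t : ℝ => z + t • (y - z)) (y - z) t := by
      simpa using ((hasDerivAt_id t).smul_const (y - z)).const_add z
    exact ((hw.differentiable (by simp)) _).hasFDerivAt.comp_hasDerivAt t h1
  have hc : Continuous fun t : ℝ => fderiv ℝ w (z + t • (y - z)) (y - z) :=
    ((hw.continuous_fderiv (by simp)).comp (by fun_prop)).clm_apply continuous_const
  have h2 := intervalIntegral.integral_eq_sub_of_hasDerivAt (a := 0) (b := 1)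
    (fun t _ => hd t) (hc.intervalIntegrable _ _)
  simp only [one_smul, zero_smul, add_zero, add_sub_cancel] at h2
  rw [← h2, intervalIntegral.integral_of_le zero_le_one]
  refine (enorm_integral_le_lintegral_enorm _).trans (lintegral_mono fun t => ?_)
  rw [mul_comm]
  exact ContinuousLinearMap.le_opENorm _ _

theorem setLIntegral_slice_le {w : Euc n → ℝ} (hw : ContDiff ℝ ∞ w) {x z : Euc n} {r : ℝ}
    (hz : z ∈ ball x r) {t : ℝ} (ht : t ∈ Set.Ioc (0 : ℝ) 1) :
    ∫⁻ y in ball x r, ‖y - z‖ₑ * ‖fderiv ℝ w (z + t • (y - z))‖ₑ ≤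
      ENNReal.ofReal (2 * r) * ∫⁻ y in ball x r, coneKer (2 * r) z (t, y) * ‖fderiv ℝ w y‖ₑ := by
  have hDc : Continuous fun y => ‖fderiv ℝ w y‖ₑ := (hw.continuous_fderiv (by simp)).enorm
  set G : Euc n → ℝ≥0∞ := (ball x r ∩ ball z (2 * r * t)).indicator
    fun y => ENNReal.ofReal (2 * r) * ‖fderiv ℝ w y‖ₑ with hG
  have hGm : Measurable G := (hDc.measurable.const_mul _).indicator
    (measurableSet_ball.inter measurableSet_ball)
  have h1 : ∫⁻ y in ball x r, ‖y - z‖ₑ * ‖fderiv ℝ w (z + t • (y - z))‖ₑ ≤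
      ∫⁻ y in ball x r, G (z + t • (y - z)) := by
    refine setLIntegral_mono' measurableSet_ball fun y hy => ?_
    have hyz : dist y z < 2 * r := by
      have := dist_triangle_right y z x
      rw [mem_ball] at hy hz
      linarith
    have hmem : z + t • (y - z) ∈ ball x r ∩ ball z (2 * r * t) := by
      refine ⟨(convex_ball x r).add_smul_sub_mem hz hy ⟨ht.1.le, ht.2⟩, ?_⟩
      rw [mem_ball, dist_eq_norm, add_sub_cancel_left, norm_smul, Real.norm_eq_abs,
        abs_of_pos ht.1, ← dist_eq_norm, mul_comm]
      exact mul_lt_mul_of_pos_right hyz ht.1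
    rw [hG, Set.indicator_of_mem hmem]
    refine mul_le_mul_left ?_ _
    rw [← ofReal_norm, ← dist_eq_norm]
    exact ENNReal.ofReal_le_ofReal hyz.le
  have h2 : ∫⁻ y, G (z + t • (y - z)) = ENNReal.ofReal ((t⁻¹) ^ n) * ∫⁻ y, G y := by
    rw [← lintegral_comp_add_smul z ht.1 hGm]
    exact lintegral_sub_right_eq_self (fun y => G (z + t • y)) z
  have h3 : ENNReal.ofReal ((t⁻¹) ^ n) * ∫⁻ y, G y = ENNReal.ofReal (2 * r) *
      ∫⁻ y in ball x r, coneKer (2 * r) z (t, y) * ‖fderiv ℝ w y‖ₑ := by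
    have hm : Measurable fun y => coneKer (2 * r) z (t, y) * ‖fderiv ℝ w y‖ₑ :=
      ((measurable_coneKer (2 * r)).comp (measurable_prodMk_left.comp measurable_prodMk_left)).mul
        hDc.measurable
    rw [← lintegral_const_mul _ hGm, ← lintegral_const_mul _ hm,
      ← lintegral_indicator measurableSet_ball]
    refine lintegral_congr fun y => ?_
    by_cases h1 : y ∈ ball x r
    · by_cases h2 : y ∈ ball z (2 * r * t)
      · have h3 : dist z y < 2 * r * t := by rwa [dist_comm]
        rw [hG, Set.indicator_of_mem (show y ∈ ball x r ∩ ball z (2 * r * t) from ⟨h1, h2⟩),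
          Set.indicator_of_mem h1, coneKer,
          Set.indicator_of_mem (by exact h3)]
        ring
      · have h3 : ¬ dist z y < 2 * r * t := by rwa [dist_comm]
        rw [hG, Set.indicator_of_notMem (fun h => h2 h.2), Set.indicator_of_mem h1,
          coneKer, Set.indicator_of_notMem (by exact h3)]
        simp
    · rw [hG, Set.indicator_of_notMem (fun h => h1 h.1), Set.indicator_of_notMem h1,
        mul_zero]
  exact h1.trans ((lintegral_mono' Measure.restrict_le_self le_rfl).trans (h2.trans h3).le)

theorem lintegral_enorm_sub_le {w : Euc n → ℝ} (hw : ContDiff ℝ ∞ w) {x z : Euc n} {r : ℝ}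
    (hz : z ∈ ball x r) :
    ∫⁻ y in ball x r, ‖w z - w y‖ₑ ≤ ENNReal.ofReal (2 * r) *
      ∫⁻ a, coneKer (2 * r) z a ∂((volume.restrict (Set.Ioc (0 : ℝ) 1)).prod
        ((volume.restrict (ball x r)).withDensity fun y => ‖fderiv ℝ w y‖ₑ)) := by
  have hDc : Continuous fun y => ‖fderiv ℝ w y‖ₑ := (hw.continuous_fderiv (by simp)).enorm
  have hm : Measurable (coneKer (2 * r) z) :=
    measurable_coneKer_left (2 * r) z
  have hm2 : Measurable (Function.uncurry fun (y : Euc n) (t : ℝ) =>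
      ‖y - z‖ₑ * ‖fderiv ℝ w (z + t • (y - z))‖ₑ) := by
    have h1 : Continuous fun q : Euc n × ℝ => z + q.2 • (q.1 - z) := by fun_prop
    have h2 : Continuous fun q : Euc n × ℝ => ‖q.1 - z‖ₑ := by fun_prop
    exact h2.measurable.mul (hDc.comp h1).measurable
  have h1 : ∫⁻ y in ball x r, ‖w z - w y‖ₑ ≤ ∫⁻ y in ball x r, ∫⁻ t in Set.Ioc (0 : ℝ) 1,
      ‖y - z‖ₑ * ‖fderiv ℝ w (z + t • (y - z))‖ₑ := by
    have h0 : ∀ y, ‖w z - w y‖ₑ ≤ ∫⁻ t in Set.Ioc (0 : ℝ) 1,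
        ‖y - z‖ₑ * ‖fderiv ℝ w (z + t • (y - z))‖ₑ := by
      intro y
      have e : ‖w z - w y‖ₑ = ‖w y - w z‖ₑ := by rw [← enorm_neg (w z - w y), neg_sub]
      exact e.trans_le (enorm_sub_le_lintegral hw z y)
    exact lintegral_mono h0
  have h2 : ∫⁻ y in ball x r, ∫⁻ t in Set.Ioc (0 : ℝ) 1,
      ‖y - z‖ₑ * ‖fderiv ℝ w (z + t • (y - z))‖ₑ ≤
      ∫⁻ t in Set.Ioc (0 : ℝ) 1, ENNReal.ofReal (2 * r) * ∫⁻ y in ball x r,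
          coneKer (2 * r) z (t, y) * ‖fderiv ℝ w y‖ₑ := by
    rw [lintegral_lintegral_swap hm2.aemeasurable]
    exact setLIntegral_mono' measurableSet_Ioc fun t ht => setLIntegral_slice_le hw hz ht
  refine h1.trans (h2.trans (le_of_eq ?_))
  rw [lintegral_const_mul, lintegral_prod _ hm.aemeasurable]
  · congr 1
    refine lintegral_congr fun t => ?_
    have h3 : Measurable fun y => coneKer (2 * r) z (t, y) := hm.comp measurable_prodMk_left
    rw [lintegral_withDensity_eq_lintegral_mul _ hDc.measurable h3]
    exact lintegral_congr fun y => mul_comm _ _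
  · have h3 : Measurable (Function.uncurry fun (t : ℝ) (y : Euc n) =>
        coneKer (2 * r) z (t, y) * ‖fderiv ℝ w y‖ₑ) :=
      hm.mul (hDc.measurable.comp measurable_snd)
    exact h3.lintegral_prod_right

/-- The constant in the Poincaré-type inequality below. -/
def poincareConst (n : ℕ) (p : ℝ) : ℝ :=
  2 * ballConst n p * 2 ^ (n / p) / (1 - n + n / p)

theorem lintegral_rpow_sub_le_of_contDiff {p : ℝ} (hp : 1 ≤ p) (hp2 : p * ((n : ℝ) - 1) < n)
    {w : Euc n → ℝ} (hw : ContDiff ℝ ∞ w) (x : Euc n) {r : ℝ} (hr : 0 < r) :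
    ∫⁻ z in ball x r, (∫⁻ y in ball x r, ‖w z - w y‖ₑ) ^ p ≤
      (ENNReal.ofReal (poincareConst n p * r ^ (1 + n / p)) *
        ∫⁻ y in ball x r, ‖fderiv ℝ w y‖ₑ) ^ p := by
  have hp0 : 0 < p := by linarith
  have hb := ballConst_pos n p
  have he := rpow_exponent hp hp2
  set D : Measure (Euc n) := (volume.restrict (ball x r)).withDensity fun y => ‖fderiv ℝ w y‖ₑ
    with hD
  have hDc : Continuous fun y => ‖fderiv ℝ w y‖ₑ := (hw.continuous_fderiv (by simp)).enorm
  have hν : ∀ᵐ a ∂((volume.restrict (Set.Ioc (0 : ℝ) 1)).prod D), 0 < a.1 := by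
    refine Measure.quasiMeasurePreserving_fst.ae (p := fun t => 0 < t) ?_
    filter_upwards [ae_restrict_mem measurableSet_Ioc] with t ht using ht.1
  calc ∫⁻ z in ball x r, (∫⁻ y in ball x r, ‖w z - w y‖ₑ) ^ p
      ≤ ∫⁻ z in ball x r, (ENNReal.ofReal (2 * r) *
          ∫⁻ a, coneKer (2 * r) z a ∂((volume.restrict (Set.Ioc (0 : ℝ) 1)).prod D)) ^ p :=
        setLIntegral_mono' measurableSet_ball fun z hz =>
          ENNReal.rpow_le_rpow (lintegral_enorm_sub_le hw hz) hp0.le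
    _ = ENNReal.ofReal (2 * r) ^ p * ∫⁻ z in ball x r,
          (∫⁻ a, coneKer (2 * r) z a ∂((volume.restrict (Set.Ioc (0 : ℝ) 1)).prod D)) ^ p := by
        rw [← lintegral_const_mul]
        · simp only [ENNReal.mul_rpow_of_nonneg _ _ hp0.le]
        · exact (Measurable.lintegral_prod_right (measurable_coneKer (2 * r))).pow_const _
    _ ≤ ENNReal.ofReal (2 * r) ^ p * (∫⁻ a, ENNReal.ofReal (ballConst n p * (2 * r) ^ (n / p) *
          a.1 ^ (-n + n / p : ℝ)) ∂((volume.restrict (Set.Ioc (0 : ℝ) 1)).prod D)) ^ p :=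
        mul_le_mul_right (lintegral_rpow_coneKer_le hp (by positivity) hν _) _
    _ = _ := by
        rw [← ENNReal.mul_rpow_of_nonneg _ _ hp0.le]
        congr 1
        rw [lintegral_prod _ (by fun_prop)]
        simp only [lintegral_const]
        rw [lintegral_mul_const _ (by fun_prop), hD, withDensity_apply _ MeasurableSet.univ,
          Measure.restrict_univ, ← mul_assoc]
        congr 1
        have h1 : ∀ t : ℝ, ENNReal.ofReal (ballConst n p * (2 * r) ^ (n / p) *
          t ^ (-n + n / p : ℝ)) = ENNReal.ofReal (ballConst n p * (2 * r) ^ (n / p)) *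
          ENNReal.ofReal (t ^ (-n + n / p : ℝ)) := fun t => ENNReal.ofReal_mul (by positivity)
        simp only [h1]
        rw [lintegral_const_mul _ (by fun_prop), lintegral_rpow_Ioc (by linarith) zero_le_one,
          ← ENNReal.ofReal_mul (by positivity), ← ENNReal.ofReal_mul (by positivity)]
        congr 1
        rw [Real.one_rpow, Real.mul_rpow (by norm_num) hr.le, Real.rpow_add hr, Real.rpow_one,
          poincareConst]
        have e : (1 + (-n + n / p) : ℝ) = 1 - n + n / p := by ring
        rw [e]
        ring

end ConeKernel

noncomputable section Sobolev

variable {n : ℕ}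

/-- Convolution of a test function with a locally integrable function. -/
def tconv (ψ w : Euc n → ℝ) (z : Euc n) : ℝ := ∫ y, ψ (z - y) * w y

theorem tconv_eq (ψ w : Euc n → ℝ) :
    tconv ψ w = convolution ψ w (ContinuousLinearMap.lsmul ℝ ℝ) volume := by
  ext z
  rw [convolution_lsmul_swap]
  rfl

theorem IsTestFun.comp_sub {ψ : Euc n → ℝ} (hψ : IsTestFun n ψ) (z : Euc n) :
    IsTestFun n (fun y => ψ (z - y)) := by
  obtain ⟨R, hR, hs⟩ := hψ.exists_support_subset
  refine isTestFun_of_support (hψ.contDiff.comp (contDiff_const.sub contDiff_id))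
    (R := R + ‖z‖) fun y hy => ?_
  have h1 := hs _ hy
  have h2 := norm_sub_norm_le y z
  rw [norm_sub_rev] at h2
  linarith

theorem contDiff_tconv {ψ w : Euc n → ℝ} (hψ : IsTestFun n ψ) (hw : LocallyIntegrable w) :
    ContDiff ℝ ∞ (tconv ψ w) := by
  rw [tconv_eq]
  exact hψ.2.contDiff_convolution_left _ hψ.1 hw

theorem fderiv_tconv {ψ w : Euc n → ℝ} (hψ : IsTestFun n ψ) (hw : LocallyIntegrable w)
    (z v : Euc n) : fderiv ℝ (tconv ψ w) z v = tconv (fun y => fderiv ℝ ψ y v) w z := by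
  have h1 := hψ.2.hasFDerivAt_convolution_left (ContinuousLinearMap.lsmul ℝ ℝ) (μ := volume)
    (hψ.1.of_le (by simp)) hw z
  rw [tconv_eq, h1.fderiv, convolution_eq_swap, tconv]
  rw [ContinuousLinearMap.integral_apply]
  · simp
  · have h2 : HasCompactSupport fun y => fderiv ℝ ψ (z - y) :=
      hψ.fderiv.2.comp_homeomorph (Homeomorph.subLeft z)
    have h3 : Continuous fun y => fderiv ℝ ψ (z - y) :=
      hψ.fderiv.continuous.comp (continuous_sub_left z)
    have h4 := hw.integrable_smul_right_of_hasCompactSupport h3 h2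
    refine h4.congr (Eventually.of_forall fun y => ?_)
    ext v
    simp [mul_comm]

/-- `H` is the weak gradient of `w`. -/
def IsWeakGrad (w : Euc n → ℝ) (H : Fin n → Euc n → ℝ) : Prop :=
  ∀ (b : Fin n) (h : Euc n → ℝ), IsTestFun n h →
    ∫ x, w x * fderiv ℝ h x (stdVec n b) = -∫ x, H b x * h x

theorem IsWeakGrad.fderiv_tconv {w : Euc n → ℝ} {H : Fin n → Euc n → ℝ} (hwH : IsWeakGrad w H)
    (hw : LocallyIntegrable w) {ψ : Euc n → ℝ} (hψ : IsTestFun n ψ) (z : Euc n) (b : Fin n) :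
    fderiv ℝ (tconv ψ w) z (stdVec n b) = tconv ψ (H b) z := by
  rw [_root_.fderiv_tconv hψ hw, tconv, tconv]
  have h1 := hwH b _ (hψ.comp_sub z)
  have h2 : ∀ y, fderiv ℝ (fun y => ψ (z - y)) y (stdVec n b) =
      -fderiv ℝ ψ (z - y) (stdVec n b) := by
    intro y
    have h3 : HasFDerivAt (fun y => z - y) (-ContinuousLinearMap.id ℝ (Euc n)) y :=
      (hasFDerivAt_id y).const_sub z
    have h4 : HasFDerivAt (fun y => ψ (z - y)) _ y :=
      (hψ.differentiable (z - y)).hasFDerivAt.comp y h3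
    rw [h4.fderiv]
    simp
  simp only [h2, mul_neg, integral_neg, neg_inj] at h1
  simpa only [mul_comm] using h1

theorem lintegral_enorm_tconv_le {ψ : Euc n → ℝ} (hψ : Continuous ψ) {H : Euc n → ℝ}
    (hH : LocallyIntegrable H)
    {r : ℝ} (hs : ∀ y, ψ y ≠ 0 → ‖y‖ ≤ r) (h0 : ∀ y, 0 ≤ ψ y) (h1 : ∫ y, ψ y = 1) (x : Euc n) :
    ∫⁻ z in ball x r, ‖tconv ψ H z‖ₑ ≤ ∫⁻ y in ball x (2 * r), ‖H y‖ₑ := by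
  have hψ1 : ∀ y, ∫⁻ z, ‖ψ (z - y)‖ₑ = 1 := by
    intro y
    rw [lintegral_sub_right_eq_self (fun z => ‖ψ z‖ₑ) y]
    have hi : Integrable ψ := by
      by_contra h
      rw [integral_undef h] at h1
      exact zero_ne_one h1
    have := ofReal_integral_norm_eq_lintegral_enorm hi
    rw [← this]
    simp only [Real.norm_eq_abs, abs_of_nonneg (h0 _), h1, ENNReal.ofReal_one]
  have hm : AEMeasurable (Function.uncurry fun (z y : Euc n) =>
      ‖ψ (z - y)‖ₑ * (ball x (2 * r)).indicator (fun y => ‖H y‖ₑ) y)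
      ((volume.restrict (ball x r)).prod volume) := by
    refine AEMeasurable.mul (by fun_prop) ?_
    have h2 : AEMeasurable ((ball x (2 * r)).indicator fun y => ‖H y‖ₑ) volume :=
      (hH.aestronglyMeasurable.enorm).indicator measurableSet_ball
    exact h2.comp_quasiMeasurePreserving Measure.quasiMeasurePreserving_snd
  calc ∫⁻ z in ball x r, ‖tconv ψ H z‖ₑ
      ≤ ∫⁻ z in ball x r, ∫⁻ y, ‖ψ (z - y)‖ₑ *
          (ball x (2 * r)).indicator (fun y => ‖H y‖ₑ) y := by
        refine setLIntegral_mono' measurableSet_ball fun z hz => ?_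
        refine (enorm_integral_le_lintegral_enorm _).trans (lintegral_mono fun y => ?_)
        simp only
        rw [enorm_mul]
        by_cases hy : y ∈ ball x (2 * r)
        · rw [Set.indicator_of_mem hy]
        · have : ψ (z - y) = 0 := by
            by_contra h
            apply hy
            have h2 := hs _ h
            have h3 := dist_triangle_left y x z
            rw [mem_ball] at hz ⊢
            rw [← dist_eq_norm] at h2
            linarith
          simp [this]
    _ ≤ ∫⁻ y, (ball x (2 * r)).indicator (fun y => ‖H y‖ₑ) y := by
        rw [lintegral_lintegral_swap hm]
        refine lintegral_mono fun y => ?_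
        simp only
        have hm2 : Measurable fun z => ‖ψ (z - y)‖ₑ :=
          (hψ.comp (continuous_sub_right y)).enorm.measurable
        rw [lintegral_mul_const _ hm2]
        calc _ ≤ 1 * (ball x (2 * r)).indicator (fun y => ‖H y‖ₑ) y := by
              refine mul_le_mul_left ?_ _
              rw [← hψ1 y]
              exact lintegral_mono' Measure.restrict_le_self le_rfl
          _ = _ := one_mul _
    _ = _ := lintegral_indicator measurableSet_ball _

theorem lintegral_rpow_sub_le_of_tendsto {p : ℝ} (hp : 1 ≤ p) {w : Euc n → ℝ}
    {g : ℕ → Euc n → ℝ} (hg : ∀ i, Continuous (g i))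
    (hgw : ∀ᵐ z, Tendsto (fun i => g i z) atTop (𝓝 (w z))) (B : Set (Euc n)) {K : ℝ≥0∞}
    (hK : ∀ᶠ i in atTop, ∫⁻ z in B, (∫⁻ y in B, ‖g i z - g i y‖ₑ) ^ p ≤ K) :
    ∫⁻ z in B, (∫⁻ y in B, ‖w z - w y‖ₑ) ^ p ≤ K := by
  have hp0 : 0 < p := by linarith
  have hgw' := ae_restrict_of_ae (s := B) hgw
  have hI : ∀ i, Measurable fun z => ∫⁻ y in B, ‖g i z - g i y‖ₑ := by
    intro i
    have : Measurable (Function.uncurry fun z y => ‖g i z - g i y‖ₑ) :=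
      (((hg i).comp continuous_fst).sub ((hg i).comp continuous_snd)).enorm.measurable
    exact this.lintegral_prod_right
  have h1 : ∀ᵐ z ∂(volume.restrict B), (∫⁻ y in B, ‖w z - w y‖ₑ) ^ p ≤
      liminf (fun i => (∫⁻ y in B, ‖g i z - g i y‖ₑ) ^ p) atTop := by
    filter_upwards [hgw'] with z hz
    have h2 : ∫⁻ y in B, ‖w z - w y‖ₑ ≤ liminf (fun i => ∫⁻ y in B, ‖g i z - g i y‖ₑ) atTop := by
      refine le_trans (lintegral_mono_ae ?_) (lintegral_liminf_le fun i => ?_)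
      · filter_upwards [hgw'] with y hy
        exact (hz.sub hy).enorm.liminf_eq.ge
      · exact (continuous_const.sub (hg i)).enorm.measurable
    have h3 := (ENNReal.orderIsoRpow p hp0).liminf_apply (f := atTop)
      (u := fun i => ∫⁻ y in B, ‖g i z - g i y‖ₑ)
    simp only [ENNReal.orderIsoRpow_apply] at h3
    rw [← h3]
    exact ENNReal.rpow_le_rpow h2 hp0.le
  refine (lintegral_mono_ae h1).trans ((lintegral_liminf_le fun i => (hI i).pow_const p).trans ?_)
  exact liminf_le_of_frequently_le' hK.frequently

theorem IsWeakGrad.lintegral_rpow_sub_le {p : ℝ} (hp : 1 ≤ p) (hp2 : p * ((n : ℝ) - 1) < n)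
    {w : Euc n → ℝ} {H : Fin n → Euc n → ℝ} (hwH : IsWeakGrad w H) (hw : LocallyIntegrable w)
    (hH : ∀ b, LocallyIntegrable (H b)) (x : Euc n) {r : ℝ} (hr : 0 < r) :
    ∫⁻ z in ball x r, (∫⁻ y in ball x r, ‖w z - w y‖ₑ) ^ p ≤
      (ENNReal.ofReal (poincareConst n p * r ^ (1 + n / p)) *
        ∑ b, ∫⁻ y in ball x (2 * r), ‖H b y‖ₑ) ^ p := by
  have hp0 : 0 < p := by linarith
  let φ : ℕ → ContDiffBump (0 : Euc n) := fun i =>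
    ⟨1 / ((i : ℝ) + 1), 2 * (1 / ((i : ℝ) + 1)), by positivity, by
      have : 0 < 1 / ((i : ℝ) + 1) := by positivity
      linarith⟩
  have hφ0 : Tendsto (fun i => (φ i).rOut) atTop (𝓝 0) := by
    have := tendsto_one_div_add_atTop_nhds_zero_nat (𝕜 := ℝ)
    have h2 := this.const_mul 2
    rw [mul_zero] at h2
    exact h2
  have hφ1 : ∀ᶠ i in atTop, (φ i).rOut ≤ 2 * (φ i).rIn := Eventually.of_forall fun i => le_rfl
  have hψ : ∀ i, IsTestFun n ((φ i).normed volume) := fun i =>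
    ⟨(φ i).contDiff_normed, (φ i).hasCompactSupport_normed⟩
  have hlim := ContDiffBump.ae_convolution_tendsto_right_of_locallyIntegrable hφ0 hφ1 hw
  simp only [← tconv_eq] at hlim
  refine lintegral_rpow_sub_le_of_tendsto hp (fun i => (contDiff_tconv (hψ i) hw).continuous)
    hlim _ ?_
  filter_upwards [hφ0.eventually (gt_mem_nhds hr)] with i hi
  have hc := contDiff_tconv (hψ i) hw
  refine (lintegral_rpow_sub_le_of_contDiff hp hp2 hc x hr).trans ?_
  refine ENNReal.rpow_le_rpow (mul_le_mul_right ?_ _) hp0.le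
  have h1 : ∀ z, ‖fderiv ℝ (tconv ((φ i).normed volume) w) z‖ₑ ≤
      ∑ b, ‖tconv ((φ i).normed volume) (H b) z‖ₑ := by
    intro z
    set L := fderiv ℝ (tconv ((φ i).normed volume) w) z with hL
    have h2 : ‖L‖ ≤ ∑ b, ‖tconv ((φ i).normed volume) (H b) z‖ := by
      refine L.opNorm_le_bound (Finset.sum_nonneg fun b _ => norm_nonneg _) fun v => ?_
      have h3 : v = ∑ b, v b • stdVec n b := by
        ext j
        simp [stdVec, Pi.single_apply]
      conv_lhs => rw [h3]
      rw [map_sum, Finset.sum_mul]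
      refine (norm_sum_le _ _).trans (Finset.sum_le_sum fun b _ => ?_)
      rw [map_smul, hL, hwH.fderiv_tconv hw (hψ i), norm_smul, mul_comm]
      exact mul_le_mul_of_nonneg_left (PiLp.norm_apply_le v b) (norm_nonneg _)
    rw [← ofReal_norm]
    refine (ENNReal.ofReal_le_ofReal h2).trans ?_
    rw [ENNReal.ofReal_sum_of_nonneg fun b _ => norm_nonneg _]
    simp only [ofReal_norm]
    exact le_rfl
  refine (lintegral_mono h1).trans ?_
  rw [lintegral_finsetSum]
  · refine Finset.sum_le_sum fun b _ => ?_
    refine lintegral_enorm_tconv_le (hψ i).continuous (hH b) (fun y hy => ?_)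
      (fun y => (φ i).nonneg_normed y) (φ i).integral_normed x
    have : y ∈ Function.support ((φ i).normed volume) := hy
    rw [(φ i).support_normed_eq, mem_ball_zero_iff] at this
    linarith
  · exact fun b _ => (contDiff_tconv (hψ i) (hH b)).continuous.enorm.measurable

theorem ae_tendsto_lebesgue {F : Type*} [NormedAddCommGroup F] {f : Euc n → F}
    (hf : LocallyIntegrable f) : ∀ᵐ x, Tendsto
      (fun r => (∫⁻ y in ball x r, ‖f y - f x‖ₑ) / ENNReal.ofReal (r ^ n)) (𝓝[>] (0 : ℝ)) (𝓝 0) := by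
  filter_upwards [(Besicovitch.vitaliFamily (volume : Measure (Euc n))).ae_tendsto_lintegral_enorm_sub_div
    hf] with x hx
  have h1 := hx.comp (Besicovitch.tendsto_filterAt volume x)
  have hV0 : volume (ball (0 : Euc n) 1) ≠ 0 := (measure_ball_pos volume 0 one_pos).ne'
  have hVt : volume (ball (0 : Euc n) 1) ≠ ⊤ := measure_ball_lt_top.ne
  have h2 := ENNReal.Tendsto.mul_const (b := volume (ball (0 : Euc n) 1)) h1 (Or.inr hVt)
  rw [zero_mul] at h2
  refine tendsto_of_tendsto_of_tendsto_of_le_of_le' tendsto_const_nhds h2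
    (Eventually.of_forall fun _ => zero_le) ?_
  filter_upwards [self_mem_nhdsWithin] with r hr
  have hr : 0 < r := hr
  simp only [Function.comp]
  rw [Measure.addHaar_closedBall _ _ hr.le, finrank_euclideanSpace, Fintype.card_fin,
    div_eq_mul_inv, div_eq_mul_inv, ENNReal.mul_inv (Or.inr hVt) (Or.inr hV0), mul_assoc, mul_assoc,
    ENNReal.inv_mul_cancel hV0 hVt, mul_one]
  exact mul_le_mul_left (lintegral_mono' (Measure.restrict_mono ball_subset_closedBall le_rfl)
    le_rfl) _

end Sobolev

noncomputable section SobolevDiff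

variable {n : ℕ}

theorem tendsto_div_ofReal_of_le {Q : ℝ → ℝ≥0∞} {g : ℝ → ℝ} (hg : ∀ r, 0 < r → 0 < g r)
    {K : ℝ≥0∞} (hK : K ≠ ⊤)
    (h : ∀ ε : ℝ, 0 < ε → ∀ᶠ r in 𝓝[>] (0 : ℝ), Q r ≤ K * ENNReal.ofReal (ε * g r)) :
    Tendsto (fun r => Q r / ENNReal.ofReal (g r)) (𝓝[>] (0 : ℝ)) (𝓝 0) := by
  rw [ENNReal.tendsto_nhds_zero]
  intro δ hδ
  obtain ⟨ε, hε, hεδ⟩ : ∃ ε : ℝ, 0 < ε ∧ K * ENNReal.ofReal ε ≤ δ := by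
    have h1 : Tendsto (fun ε : ℝ => K * ENNReal.ofReal ε) (𝓝[>] 0) (𝓝 (K * ENNReal.ofReal 0)) :=
      ENNReal.Tendsto.const_mul ((ENNReal.continuous_ofReal.tendsto 0).mono_left
        nhdsWithin_le_nhds) (Or.inr hK)
    rw [ENNReal.ofReal_zero, mul_zero] at h1
    have h2 := (ENNReal.tendsto_nhds_zero.1 h1 δ hδ).and self_mem_nhdsWithin
    obtain ⟨ε, h3, h4⟩ := h2.exists
    exact ⟨ε, h4, h3⟩
  filter_upwards [h ε hε, self_mem_nhdsWithin] with r hr hr0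
  have hr0 := hg r hr0
  refine ENNReal.div_le_of_le_mul (hr.trans ?_)
  rw [ENNReal.ofReal_mul hε.le, ← mul_assoc]
  exact mul_le_mul_left hεδ _

theorem eventually_le_of_tendsto_div {Q : ℝ → ℝ≥0∞} {g : ℝ → ℝ} (hg : ∀ r, 0 < r → 0 < g r)
    (h : Tendsto (fun r => Q r / ENNReal.ofReal (g r)) (𝓝[>] (0 : ℝ)) (𝓝 0)) {ε : ℝ} (hε : 0 < ε) :
    ∀ᶠ r in 𝓝[>] (0 : ℝ), Q r ≤ ENNReal.ofReal (ε * g r) := by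
  filter_upwards [ENNReal.tendsto_nhds_zero.1 h (ENNReal.ofReal ε) (by simpa using hε),
    self_mem_nhdsWithin] with r hr hr0
  have hr0 := hg r hr0
  rw [ENNReal.ofReal_mul hε.le]
  exact (ENNReal.div_le_iff (by simpa using hr0) ENNReal.ofReal_ne_top).1 hr

theorem tendsto_const_mul_nhdsGT {c : ℝ} (hc : 0 < c) :
    Tendsto (fun r : ℝ => c * r) (𝓝[>] (0 : ℝ)) (𝓝[>] (0 : ℝ)) := by
  refine tendsto_nhdsWithin_iff.2 ⟨?_, ?_⟩
  · have : Tendsto (fun r : ℝ => c * r) (𝓝 0) (𝓝 (c * 0)) :=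
      (continuous_const_mul c).tendsto 0
    rw [mul_zero] at this
    exact this.mono_left nhdsWithin_le_nhds
  · filter_upwards [self_mem_nhdsWithin] with r hr
    exact mul_pos hc hr

theorem fderiv_affine (c : ℝ) (x : Euc n) (T : Fin n → ℝ) (y : Euc n) (b : Fin n) :
    fderiv ℝ (fun y : Euc n => c + ∑ b, (y b - x b) * T b) y (stdVec n b) = T b := by
  have h1 : ∀ b : Fin n, HasFDerivAt (fun y : Euc n => (y b - x b) * T b)
      (T b • (EuclideanSpace.proj b : Euc n →L[ℝ] ℝ)) y := by
    intro b
    have h2 : HasFDerivAt (fun y : Euc n => y b) (EuclideanSpace.proj b : Euc n →L[ℝ] ℝ) y :=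
      (EuclideanSpace.proj b : Euc n →L[ℝ] ℝ).hasFDerivAt
    exact (h2.sub_const (x b)).mul_const (T b)
  have h3 : HasFDerivAt (fun y : Euc n => c + ∑ b, (y b - x b) * T b) _ y :=
    (HasFDerivAt.fun_sum fun b (_ : b ∈ Finset.univ) => h1 b).const_add c
  rw [h3.fderiv]
  simp [stdVec]

theorem contDiff_affine (c : ℝ) (x : Euc n) (T : Fin n → ℝ) :
    ContDiff ℝ ∞ fun y : Euc n => c + ∑ b, (y b - x b) * T b := by
  refine contDiff_const.add (ContDiff.sum fun b _ => ContDiff.mul (ContDiff.sub ?_ contDiff_const)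
    contDiff_const)
  exact (EuclideanSpace.proj b : Euc n →L[ℝ] ℝ).contDiff

theorem isWeakGrad_of_contDiff {a : Euc n → ℝ} (ha : ContDiff ℝ ∞ a) :
    IsWeakGrad a fun b y => fderiv ℝ a y (stdVec n b) := by
  intro b h hh
  have h1 := integral_dop_mul (MvPolynomial.isHomogeneous_X ℝ b) hh ha
  rw [dop_X b hh.contDiff, dop_X b ha] at h1
  simp only [pow_one, neg_mul, one_mul] at h1
  simpa only [mul_comm] using h1

theorem IsWeakGrad.sub {w w' : Euc n → ℝ} {H H' : Fin n → Euc n → ℝ} (h : IsWeakGrad w H)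
    (h' : IsWeakGrad w' H') (hw : LocallyIntegrable w) (hw' : LocallyIntegrable w')
    (hH : ∀ b, LocallyIntegrable (H b)) (hH' : ∀ b, LocallyIntegrable (H' b)) :
    IsWeakGrad (fun y => w y - w' y) fun b y => H b y - H' b y := by
  intro b φ hφ
  have hd : IsTestFun n fun x => fderiv ℝ φ x (stdVec n b) := by
    have := hφ.dop (MvPolynomial.X b)
    rwa [dop_X b hφ.contDiff] at this
  have i1 := integrable_locallyIntegrable_mul hw hd
  have i2 := integrable_locallyIntegrable_mul hw' hd
  have i3 := integrable_locallyIntegrable_mul (hH b) hφ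
  have i4 := integrable_locallyIntegrable_mul (hH' b) hφ
  simp only [smul_eq_mul, mul_comm] at i1 i2 i3 i4
  have e1 := h b φ hφ
  have e2 := h' b φ hφ
  simp only [sub_mul]
  rw [integral_sub (by simpa only [mul_comm] using i1) (by simpa only [mul_comm] using i2),
    integral_sub (by simpa only [mul_comm] using i3) (by simpa only [mul_comm] using i4), e1, e2]
  ring

theorem volume_mul_lintegral_le {w : Euc n → ℝ} (hw : AEStronglyMeasurable w volume)
    {A B : Set (Euc n)} (hAB : A ⊆ B) : volume A * ∫⁻ z in B, ‖w z‖ₑ ≤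
      (∫⁻ z in B, ∫⁻ y in B, ‖w z - w y‖ₑ) + volume B * ∫⁻ y in A, ‖w y‖ₑ := by
  have h1 : ∀ z, volume A * ‖w z‖ₑ ≤ (∫⁻ y in B, ‖w z - w y‖ₑ) + ∫⁻ y in A, ‖w y‖ₑ := by
    intro z
    calc volume A * ‖w z‖ₑ = ∫⁻ y in A, ‖w z‖ₑ := by
          rw [lintegral_const, Measure.restrict_apply MeasurableSet.univ, Set.univ_inter, mul_comm]
      _ ≤ ∫⁻ y in A, (‖w z - w y‖ₑ + ‖w y‖ₑ) := by
          refine lintegral_mono fun y => ?_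
          simp only
          calc ‖w z‖ₑ = ‖(w z - w y) + w y‖ₑ := by rw [sub_add_cancel]
            _ ≤ _ := enorm_add_le _ _
      _ = (∫⁻ y in A, ‖w z - w y‖ₑ) + ∫⁻ y in A, ‖w y‖ₑ :=
          lintegral_add_right' _ hw.restrict.enorm
      _ ≤ _ := by
          gcongr
  calc volume A * ∫⁻ z in B, ‖w z‖ₑ ≤ ∫⁻ z in B, volume A * ‖w z‖ₑ := lintegral_const_mul_le _ _
    _ ≤ ∫⁻ z in B, ((∫⁻ y in B, ‖w z - w y‖ₑ) + ∫⁻ y in A, ‖w y‖ₑ) := lintegral_mono h1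
    _ = _ := by
        rw [lintegral_add_right _ measurable_const, lintegral_const,
          Measure.restrict_apply MeasurableSet.univ, Set.univ_inter, mul_comm (volume B)]

theorem rpow_volume_mul_lintegral_le {p : ℝ} (hp : 1 ≤ p) {w : Euc n → ℝ}
    (hw : AEStronglyMeasurable w volume) (B : Set (Euc n)) :
    volume B ^ p * ∫⁻ z in B, ‖w z‖ₑ ^ p ≤ 2 ^ (p - 1) *
      ((∫⁻ z in B, (∫⁻ y in B, ‖w z - w y‖ₑ) ^ p) + (∫⁻ y in B, ‖w y‖ₑ) ^ p * volume B) := by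
  have hp0 : 0 < p := by linarith
  have h1 : ∀ z, volume B ^ p * ‖w z‖ₑ ^ p ≤
      2 ^ (p - 1) * ((∫⁻ y in B, ‖w z - w y‖ₑ) ^ p + (∫⁻ y in B, ‖w y‖ₑ) ^ p) := by
    intro z
    rw [← ENNReal.mul_rpow_of_nonneg _ _ hp0.le]
    refine le_trans (ENNReal.rpow_le_rpow ?_ hp0.le) (ENNReal.rpow_add_le_mul_rpow_add_rpow _ _ hp)
    calc volume B * ‖w z‖ₑ = ∫⁻ y in B, ‖w z‖ₑ := by
          rw [lintegral_const, Measure.restrict_apply MeasurableSet.univ, Set.univ_inter, mul_comm]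
      _ ≤ ∫⁻ y in B, (‖w z - w y‖ₑ + ‖w y‖ₑ) := by
          refine lintegral_mono fun y => ?_
          simp only
          calc ‖w z‖ₑ = ‖(w z - w y) + w y‖ₑ := by rw [sub_add_cancel]
            _ ≤ _ := enorm_add_le _ _
      _ = _ := lintegral_add_right' _ hw.restrict.enorm
  calc volume B ^ p * ∫⁻ z in B, ‖w z‖ₑ ^ p ≤ ∫⁻ z in B, volume B ^ p * ‖w z‖ₑ ^ p :=
        lintegral_const_mul_le _ _
    _ ≤ _ := lintegral_mono h1
    _ = _ := by
        rw [lintegral_const_mul' _ _ (by finiteness), lintegral_add_right _ measurable_const,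
          lintegral_const, Measure.restrict_apply MeasurableSet.univ, Set.univ_inter]

theorem poincareConst_nonneg {p : ℝ} (hp : 1 ≤ p) (hp2 : p * ((n : ℝ) - 1) < n) :
    0 ≤ poincareConst n p := by
  have h1 := rpow_exponent hp hp2
  have h2 := ballConst_pos n p
  unfold poincareConst
  positivity

theorem le_add_of_dyadic_step {ℓ : ℝ → ℝ≥0∞} (hℓ : Tendsto ℓ (𝓝[>] (0 : ℝ)) (𝓝 0)) {K r₀ : ℝ}
    (hK : 0 ≤ K)
    (hstep : ∀ r, 0 < r → r < r₀ → ℓ r ≤ ENNReal.ofReal (K * r) + ℓ (r / 2)) {r : ℝ} (hr : 0 < r)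
    (hr₀ : r < r₀) : ℓ r ≤ ENNReal.ofReal (2 * K * r) := by
  have h1 : ∀ N : ℕ, ∀ r, 0 < r → r < r₀ → ℓ r ≤ ENNReal.ofReal (2 * K * r) + ℓ (r / 2 ^ N) := by
    intro N
    induction N with
    | zero => intro r hr _; simp
    | succ N ih =>
      intro r hr hr₀
      refine (hstep r hr hr₀).trans ?_
      refine (add_le_add_right (ih (r / 2) (by positivity) (by linarith)) _).trans ?_
      rw [← add_assoc, ← ENNReal.ofReal_add (by positivity) (by positivity), div_div, pow_succ']
      refine add_le_add_left (ENNReal.ofReal_le_ofReal (le_of_eq ?_)) _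
      ring
  have h2 : Tendsto (fun N : ℕ => r / 2 ^ N) atTop (𝓝[>] (0 : ℝ)) := by
    refine tendsto_nhdsWithin_iff.2 ⟨?_, Eventually.of_forall fun N => ?_⟩
    · have := (tendsto_pow_atTop_nhds_zero_of_lt_one (r := (1 / 2 : ℝ)) (by norm_num)
        (by norm_num)).const_mul r
      rw [mul_zero] at this
      refine this.congr fun N => ?_
      rw [one_div, inv_pow, div_eq_mul_inv]
    · exact div_pos hr (by positivity)
  have h3 := (hℓ.comp h2).const_add (ENNReal.ofReal (2 * K * r))
  rw [add_zero] at h3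
  exact ge_of_tendsto' h3 fun N => h1 N r hr hr₀

theorem volume_ball_euc_ofReal (x : Euc n) {r : ℝ} (hr : 0 < r) :
    volume (ball x r) = ENNReal.ofReal (r ^ n * (volume (ball (0 : Euc n) 1)).toReal) := by
  rw [volume_ball_euc x hr, ENNReal.ofReal_mul (by positivity),
    ENNReal.ofReal_toReal measure_ball_lt_top.ne]

theorem toReal_volume_ball_pos : 0 < (volume (ball (0 : Euc n) 1)).toReal :=
  ENNReal.toReal_pos (measure_ball_pos volume 0 one_pos).ne' measure_ball_lt_top.ne

/-- One dyadic step in the growth estimate for the `L¹` average. -/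
theorem IsWeakGrad.average_step {w : Euc n → ℝ} {H : Fin n → Euc n → ℝ} (hwH : IsWeakGrad w H)
    (hw : LocallyIntegrable w) (hH : ∀ b, LocallyIntegrable (H b)) (x : Euc n) {r ε : ℝ}
    (hr : 0 < r) (hε : 0 < ε)
    (hS : ∑ b, ∫⁻ y in ball x (2 * r), ‖H b y‖ₑ ≤ ENNReal.ofReal (ε * r ^ n)) :
    (∫⁻ y in ball x r, ‖w y‖ₑ) / ENNReal.ofReal (r ^ n) ≤
      ENNReal.ofReal (poincareConst n 1 * 2 ^ n / (volume (ball (0 : Euc n) 1)).toReal * ε * r) +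
        (∫⁻ y in ball x (r / 2), ‖w y‖ₑ) / ENNReal.ofReal ((r / 2) ^ n) := by
  set V := (volume (ball (0 : Euc n) 1)).toReal with hV
  have hV0 : 0 < V := toReal_volume_ball_pos
  have hp2 : (1 : ℝ) * ((n : ℝ) - 1) < n := by linarith
  have hC := poincareConst_nonneg (n := n) le_rfl hp2
  have h1 := hwH.lintegral_rpow_sub_le le_rfl hp2 hw hH x hr
  simp only [ENNReal.rpow_one] at h1
  have h2 := volume_mul_lintegral_le (w := w) hw.aestronglyMeasurable
    (ball_subset_ball (x := x) (half_le_self hr.le))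
  rw [volume_ball_euc_ofReal x hr, volume_ball_euc_ofReal x (half_pos hr), ← hV] at h2
  have h3 : ENNReal.ofReal (poincareConst n 1 * r ^ (1 + n / 1 : ℝ)) *
      ∑ b, ∫⁻ y in ball x (2 * r), ‖H b y‖ₑ ≤
      ENNReal.ofReal (poincareConst n 1 * r ^ (1 + n) * (ε * r ^ n)) := by
    have e : r ^ (1 + n / 1 : ℝ) = r ^ (1 + n) := by
      rw [div_one, ← Real.rpow_natCast]
      push_cast
      rfl
    rw [e, ENNReal.ofReal_mul (p := poincareConst n 1 * r ^ (1 + n)) (by positivity)]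
    exact mul_le_mul_right hS _
  have h4 := h2.trans (add_le_add_left (h1.trans h3) _)
  have h5 := mul_le_mul_right h4 (ENNReal.ofReal (((r / 2) ^ n * V * r ^ n)⁻¹))
  generalize (∫⁻ y in ball x r, ‖w y‖ₑ) = a at h5 ⊢
  generalize (∫⁻ y in ball x (r / 2), ‖w y‖ₑ) = b at h5 ⊢
  have k1 : ENNReal.ofReal (((r / 2) ^ n * V * r ^ n)⁻¹) * ENNReal.ofReal ((r / 2) ^ n * V) =
      ENNReal.ofReal ((r ^ n)⁻¹) := by
    rw [← ENNReal.ofReal_mul (by positivity)]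
    congr 1
    field_simp
  have k2 : ENNReal.ofReal (((r / 2) ^ n * V * r ^ n)⁻¹) * ENNReal.ofReal (r ^ n * V) =
      ENNReal.ofReal (((r / 2) ^ n)⁻¹) := by
    rw [← ENNReal.ofReal_mul (by positivity)]
    congr 1
    field_simp
  have k3 : ENNReal.ofReal (((r / 2) ^ n * V * r ^ n)⁻¹) *
      ENNReal.ofReal (poincareConst n 1 * r ^ (1 + n) * (ε * r ^ n)) =
      ENNReal.ofReal (poincareConst n 1 * 2 ^ n / V * ε * r) := by
    rw [← ENNReal.ofReal_mul (by positivity)]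
    congr 1
    rw [div_pow]
    field_simp
    ring
  rw [mul_add, ← mul_assoc, k1, k3, ← mul_assoc, k2] at h5
  rw [div_eq_mul_inv a, div_eq_mul_inv b, ← ENNReal.ofReal_inv_of_pos (by positivity),
    ← ENNReal.ofReal_inv_of_pos (by positivity), mul_comm a, mul_comm b]
  exact h5

theorem IsWeakGrad.tendsto_eLpNorm {p : ℝ} (hp : 1 ≤ p) (hp2 : p * ((n : ℝ) - 1) < n)
    {w : Euc n → ℝ} {H : Fin n → Euc n → ℝ} (hwH : IsWeakGrad w H)
    (hw : LocallyIntegrable w) (hH : ∀ b, LocallyIntegrable (H b)) (x : Euc n)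
    (hw0 : Tendsto (fun r => (∫⁻ y in ball x r, ‖w y‖ₑ) / ENNReal.ofReal (r ^ n))
      (𝓝[>] (0 : ℝ)) (𝓝 0))
    (hH0 : ∀ b, Tendsto (fun r => (∫⁻ y in ball x r, ‖H b y‖ₑ) / ENNReal.ofReal (r ^ n))
      (𝓝[>] (0 : ℝ)) (𝓝 0)) :
    Tendsto (fun r => eLpNorm w (ENNReal.ofReal p) (volume.restrict (ball x r)) /
      ENNReal.ofReal (r ^ (1 + n / p))) (𝓝[>] (0 : ℝ)) (𝓝 0) := by
  have hp0 : 0 < p := by linarith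
  set V := (volume (ball (0 : Euc n) 1)).toReal with hV
  have hV0 : 0 < V := toReal_volume_ball_pos
  have hC := poincareConst_nonneg hp hp2
  have hC1 := poincareConst_nonneg (n := n) (p := 1) le_rfl (by linarith)
  set K₁ := 2 * (poincareConst n 1 * 2 ^ n / V) with hK₁
  set D : ℝ≥0∞ := (ENNReal.ofReal V ^ p)⁻¹ * (2 ^ (p - 1) * (ENNReal.ofReal (poincareConst n p) ^ p
    + ENNReal.ofReal K₁ ^ p * ENNReal.ofReal V)) with hD
  have hVp0 : ENNReal.ofReal V ^ p ≠ 0 := by simp [hV0]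
  have hDt : D ≠ ⊤ := by
    rw [hD]
    finiteness
  refine tendsto_div_ofReal_of_le (K := D ^ (1 / p)) (fun r hr => by positivity) (by finiteness)
    fun ε hε => ?_
  have hS : ∀ᶠ r in 𝓝[>] (0 : ℝ), ∑ b, ∫⁻ y in ball x (2 * r), ‖H b y‖ₑ ≤
      ENNReal.ofReal (ε * r ^ n) := by
    have h1 : Tendsto (fun r => (∑ b, ∫⁻ y in ball x r, ‖H b y‖ₑ) / ENNReal.ofReal (r ^ n))
        (𝓝[>] (0 : ℝ)) (𝓝 0) := by
      have := tendsto_finsetSum Finset.univ fun b _ => hH0 b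
      simpa only [Finset.sum_const_zero, ENNReal.div_eq_inv_mul, Finset.mul_sum] using this
    have h2 := (tendsto_const_mul_nhdsGT (zero_lt_two (α := ℝ))).eventually
      (eventually_le_of_tendsto_div (fun r hr => by positivity) h1
        (show 0 < ε / 2 ^ n by positivity))
    filter_upwards [h2] with r hr
    convert hr using 2
    rw [mul_pow]
    field_simp
  obtain ⟨r₀, hr₀, hr₀S⟩ := mem_nhdsGT_iff_exists_Ioo_subset.1 hS
  filter_upwards [Ioo_mem_nhdsGT hr₀] with r hr
  have hr0 : 0 < r := hr.1
  have hL := le_add_of_dyadic_step hw0 (K := K₁ / 2 * ε) (r₀ := r₀) (by positivity)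
    (fun r h1 h2 => by
      have := hwH.average_step hw hH x h1 hε (hr₀S ⟨h1, h2⟩)
      rw [← hV] at this
      convert this using 3
      rw [hK₁]
      ring) hr.1 hr.2
  have hL' : ∫⁻ y in ball x r, ‖w y‖ₑ ≤ ENNReal.ofReal K₁ * ENNReal.ofReal (ε * r * r ^ n) := by
    have := (ENNReal.div_le_iff (by simp [hr0]) ENNReal.ofReal_ne_top).1 hL
    refine this.trans (le_of_eq ?_)
    rw [← ENNReal.ofReal_mul (by positivity), ← ENNReal.ofReal_mul (by positivity)]
    congr 1
    ring
  have hI := hwH.lintegral_rpow_sub_le hp hp2 hw hH x hr0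
  have hI' : ∫⁻ z in ball x r, (∫⁻ y in ball x r, ‖w z - w y‖ₑ) ^ p ≤
      (ENNReal.ofReal (poincareConst n p) * (ENNReal.ofReal (ε * r ^ (1 + n / p)) *
        ENNReal.ofReal (r ^ n))) ^ p := by
    refine hI.trans (ENNReal.rpow_le_rpow ?_ hp0.le)
    refine (mul_le_mul_right (hr₀S hr) _).trans (le_of_eq ?_)
    rw [← ENNReal.ofReal_mul (by positivity), ← ENNReal.ofReal_mul (by positivity),
      ← ENNReal.ofReal_mul (by positivity)]
    congr 1
    ring
  set X := ENNReal.ofReal (ε * r ^ (1 + n / p)) with hX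
  set N := ENNReal.ofReal (r ^ n) with hN
  have hvol : volume (ball x r) = N * ENNReal.ofReal V := by
    rw [volume_ball_euc_ofReal x hr0, ENNReal.ofReal_mul (by positivity)]
  have hLX : (ENNReal.ofReal K₁ * ENNReal.ofReal (ε * r * r ^ n)) ^ p * (N * ENNReal.ofReal V) =
      ENNReal.ofReal K₁ ^ p * ENNReal.ofReal V * (X * N) ^ p := by
    have e : ENNReal.ofReal (ε * r * r ^ n) ^ p * N = (X * N) ^ p := by
      rw [hX, hN, ENNReal.ofReal_rpow_of_nonneg (by positivity) hp0.le,
        ← ENNReal.ofReal_mul (by positivity), ← ENNReal.ofReal_mul (by positivity),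
        ENNReal.ofReal_rpow_of_nonneg (by positivity) hp0.le]
      congr 1
      rw [Real.rpow_add hr0, Real.rpow_one, Real.mul_rpow (by positivity) (by positivity),
        Real.mul_rpow (x := ε * (r * r ^ (n / p : ℝ))) (by positivity) (by positivity), ← mul_assoc,
        Real.mul_rpow (x := ε * r) (by positivity) (by positivity), ← Real.rpow_mul hr0.le,
        div_mul_cancel₀ _ hp0.ne', Real.rpow_natCast]
      ring
    rw [ENNReal.mul_rpow_of_nonneg _ _ hp0.le, ← e]
    ring
  have hmain := rpow_volume_mul_lintegral_le hp (w := w) hw.aestronglyMeasurable (ball x r)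
  have hmain2 : (N ^ p * ENNReal.ofReal V ^ p) * ∫⁻ z in ball x r, ‖w z‖ₑ ^ p ≤
      (N ^ p * ENNReal.ofReal V ^ p) * (D * X ^ p) := by
    rw [hvol, ENNReal.mul_rpow_of_nonneg _ _ hp0.le] at hmain
    refine hmain.trans ?_
    calc _ ≤ 2 ^ (p - 1) * ((ENNReal.ofReal (poincareConst n p) * (X * N)) ^ p +
          (ENNReal.ofReal K₁ * ENNReal.ofReal (ε * r * r ^ n)) ^ p * (N * ENNReal.ofReal V)) := by
          gcongr
      _ = ((ENNReal.ofReal V ^ p) * (ENNReal.ofReal V ^ p)⁻¹) * (2 ^ (p - 1) *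
          (ENNReal.ofReal (poincareConst n p) ^ p + ENNReal.ofReal K₁ ^ p * ENNReal.ofReal V)) *
            (X * N) ^ p := by
          rw [hLX, ENNReal.mul_inv_cancel hVp0 (by finiteness),
            ENNReal.mul_rpow_of_nonneg _ (X * N) hp0.le]
          ring
      _ = _ := by
          rw [hD, ENNReal.mul_rpow_of_nonneg _ _ hp0.le]
          ring
  have hNp0 : N ^ p ≠ 0 := by simp [hN, hr0]
  have hmain3 := (ENNReal.mul_le_mul_iff_right (mul_ne_zero hNp0 hVp0) (by finiteness)).1 hmain2
  rw [eLpNorm_eq_lintegral_rpow_enorm_toReal (by simpa using hp0) ENNReal.ofReal_ne_top,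
    ENNReal.toReal_ofReal hp0.le]
  refine (ENNReal.rpow_le_rpow hmain3 (by positivity)).trans (le_of_eq ?_)
  rw [ENNReal.mul_rpow_of_nonneg _ _ (by positivity), ← ENNReal.rpow_mul,
    mul_one_div_cancel hp0.ne', ENNReal.rpow_one]

theorem tendsto_average_sub_affine {w : Euc n → ℝ} (x : Euc n) (T : Fin n → ℝ)
    (hwx : Tendsto (fun r => (∫⁻ y in ball x r, ‖w y - w x‖ₑ) / ENNReal.ofReal (r ^ n))
      (𝓝[>] (0 : ℝ)) (𝓝 0)) :
    Tendsto (fun r => (∫⁻ y in ball x r, ‖w y - (w x + ∑ b, (y b - x b) * T b)‖ₑ) /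
      ENNReal.ofReal (r ^ n)) (𝓝[>] (0 : ℝ)) (𝓝 0) := by
  set V := (volume (ball (0 : Euc n) 1)).toReal with hV
  set K := ∑ b, |T b| with hK
  have hK0 : 0 ≤ K := Finset.sum_nonneg fun b _ => abs_nonneg _
  have h1 : Tendsto (fun r : ℝ => ENNReal.ofReal (K * V * r)) (𝓝[>] 0) (𝓝 0) := by
    have h2 : Continuous fun r : ℝ => ENNReal.ofReal (K * V * r) :=
      ENNReal.continuous_ofReal.comp (continuous_const_mul _)
    have h3 := (h2.tendsto 0).mono_left (nhdsWithin_le_nhds (s := Set.Ioi 0))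
    simpa using h3
  have h4 := hwx.add h1
  rw [add_zero] at h4
  refine tendsto_of_tendsto_of_tendsto_of_le_of_le' tendsto_const_nhds h4
    (Eventually.of_forall fun r => zero_le) ?_
  filter_upwards [self_mem_nhdsWithin] with r hr
  have hr : 0 < r := hr
  have h5 : ∫⁻ y in ball x r, ‖w y - (w x + ∑ b, (y b - x b) * T b)‖ₑ ≤
      (∫⁻ y in ball x r, ‖w y - w x‖ₑ) + ENNReal.ofReal (K * V * r * r ^ n) := by
    calc _ ≤ ∫⁻ y in ball x r, (‖w y - w x‖ₑ + ENNReal.ofReal (K * r)) := by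
          refine setLIntegral_mono' measurableSet_ball fun y hy => ?_
          have e : w y - (w x + ∑ b, (y b - x b) * T b) =
            (w y - w x) - ∑ b, (y b - x b) * T b := by ring
          rw [e]
          refine enorm_sub_le.trans (add_le_add_right ?_ _)
          rw [← ofReal_norm]
          refine ENNReal.ofReal_le_ofReal ?_
          rw [hK, Finset.sum_mul]
          refine (norm_sum_le _ _).trans (Finset.sum_le_sum fun b _ => ?_)
          rw [norm_mul, Real.norm_eq_abs (T b), mul_comm]
          refine mul_le_mul_of_nonneg_left ?_ (abs_nonneg _)
          have := PiLp.norm_apply_le (y - x) b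
          rw [PiLp.sub_apply] at this
          exact this.trans (mem_ball_iff_norm.1 hy).le
      _ = _ := by
          rw [lintegral_add_right _ measurable_const, setLIntegral_const,
            volume_ball_euc_ofReal x hr, ← ENNReal.ofReal_mul (by positivity)]
          congr 2
          ring
  refine (ENNReal.div_le_div_right h5 _).trans (le_of_eq ?_)
  rw [ENNReal.add_div, ENNReal.ofReal_mul (q := r ^ n) (by positivity),
    ENNReal.mul_div_cancel_right (by simpa using pow_pos hr n) ENNReal.ofReal_ne_top]

/-- A locally integrable function with a locally integrable weak gradient is almost everywhere
`L^p` differentiable, with the weak gradient as derivative. -/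
theorem IsWeakGrad.ae_lpDiffAt {p : ℝ} (hp : 1 ≤ p) (hp2 : p * ((n : ℝ) - 1) < n)
    {w : Euc n → ℝ} {G : Fin n → Euc n → ℝ} (h : IsWeakGrad w G)
    (hw : LocallyIntegrable w) (hG : ∀ b, LocallyIntegrable (G b)) :
    ∀ᵐ x, LpDiffAt p w x fun b => G b x := by
  filter_upwards [ae_tendsto_lebesgue hw, ae_all_iff.2 fun b => ae_tendsto_lebesgue (hG b)]
    with x hx hGx
  refine ⟨w x, ?_⟩
  have ha := contDiff_affine (w x) x fun b => G b x
  have ha' : ∀ b, (fun y => fderiv ℝ (fun y : Euc n => w x + ∑ b, (y b - x b) * G b x) y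
      (stdVec n b)) = fun _ => G b x := fun b => by
    funext y
    exact fderiv_affine (w x) x (fun b => G b x) y b
  have h1 := isWeakGrad_of_contDiff ha
  have h2 := h.sub h1 hw ha.continuous.locallyIntegrable hG fun b => by
    rw [ha' b]
    exact continuous_const.locallyIntegrable
  refine IsWeakGrad.tendsto_eLpNorm hp hp2 h2 (hw.sub ha.continuous.locallyIntegrable)
    (fun b => (hG b).sub ?_) x ?_ fun b => ?_
  · rw [ha' b]
    exact continuous_const.locallyIntegrable
  · exact tendsto_average_sub_affine x _ hx
  · simpa only [fderiv_affine] using hGx b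

theorem ae_lpDiffAt_of_contDiff {p : ℝ} (hp : 1 ≤ p) (hp2 : p * ((n : ℝ) - 1) < n)
    {s : Euc n → ℝ} (hs : ContDiff ℝ ∞ s) :
    ∀ᵐ x, LpDiffAt p s x fun b => fderiv ℝ s x (stdVec n b) :=
  (isWeakGrad_of_contDiff hs).ae_lpDiffAt hp hp2 hs.continuous.locallyIntegrable fun _ =>
    (contDiff_fderiv_apply_const hs _).continuous.locallyIntegrable

end SobolevDiff

noncomputable section ConePotential

variable {n : ℕ}

/-- The kernel `t⁻ⁿ Ξ((y - z)/t)` at `a = (t, y)`. -/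
def scaledKer (Ξ : Euc n → ℝ) (z : Euc n) (a : ℝ × Euc n) : ℝ :=
  (a.1⁻¹) ^ n * Ξ (a.1⁻¹ • (a.2 - z))

/-- The potential of the measure `g ν` for the kernel `scaledKer Ξ`. -/
def pot (Ξ g : Euc n → ℝ) (ν : Measure (ℝ × Euc n)) (z : Euc n) : ℝ :=
  ∫ a, g a.2 * scaledKer Ξ z a ∂ν

theorem measurable_scaledKer {Ξ : Euc n → ℝ} (hΞ : Continuous Ξ) :
    Measurable (Function.uncurry (scaledKer Ξ)) := by
  unfold scaledKer
  refine Measurable.mul (by fun_prop) (hΞ.measurable.comp ?_)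
  exact Measurable.smul (f := fun q : Euc n × (ℝ × Euc n) => q.2.1⁻¹) (by fun_prop) (by fun_prop)

/-- `Ξ` is a continuous kernel bounded by `C` and supported in the open ball of radius `ρ`. -/
structure IsBoundedKernel (Ξ : Euc n → ℝ) (C ρ : ℝ) : Prop where
  isTestFun : IsTestFun n Ξ
  nonneg : 0 ≤ C
  pos : 0 < ρ
  le : ∀ x, ‖Ξ x‖ ≤ C
  lt : ∀ x, Ξ x ≠ 0 → ‖x‖ < ρ

theorem IsTestFun.exists_isBoundedKernel {Ξ : Euc n → ℝ} (h : IsTestFun n Ξ) :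
    ∃ C ρ, IsBoundedKernel Ξ C ρ := by
  obtain ⟨C, hC0, hC⟩ := h.exists_bound
  obtain ⟨R, hR0, hR⟩ := h.exists_support_subset
  exact ⟨C, R + 1, h, hC0, by linarith, hC, fun x hx => (hR x hx).trans_lt (lt_add_one R)⟩

theorem IsBoundedKernel.enorm_scaledKer_le {Ξ : Euc n → ℝ} {C ρ : ℝ} (h : IsBoundedKernel Ξ C ρ)
    (z : Euc n) {a : ℝ × Euc n} (ha : 0 < a.1) :
    ‖scaledKer Ξ z a‖ₑ ≤ ENNReal.ofReal C * coneKer ρ z a := by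
  by_cases h0 : Ξ (a.1⁻¹ • (a.2 - z)) = 0
  · simp [scaledKer, h0]
  · have h1 := h.lt _ h0
    rw [norm_smul, Real.norm_eq_abs, abs_of_pos (inv_pos.2 ha), inv_mul_lt_iff₀ ha,
      ← dist_eq_norm, dist_comm, mul_comm] at h1
    rw [coneKer, Set.indicator_of_mem (by exact h1), scaledKer, enorm_mul, mul_comm]
    rw [← ofReal_norm, ← ofReal_norm, Real.norm_of_nonneg (by positivity : (0 : ℝ) ≤ a.1⁻¹ ^ n)]
    exact mul_le_mul_left (ENNReal.ofReal_le_ofReal (h.le _)) _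

theorem lintegral_coneKer {ρ : ℝ} (hρ : 0 < ρ) {a : ℝ × Euc n} (ha : 0 < a.1) :
    ∫⁻ z, coneKer ρ z a = ENNReal.ofReal (ballConst n 1 * ρ ^ n) := by
  have h := lintegral_coneKer_rpow le_rfl hρ ha
  simp only [ENNReal.rpow_one, div_one, neg_add_cancel, Real.rpow_zero, mul_one,
    Real.rpow_natCast] at h
  exact h

variable {Ξ g : Euc n → ℝ} {C ρ : ℝ} {ν : Measure (ℝ × Euc n)}

theorem IsBoundedKernel.enorm_mul_scaledKer_le (h : IsBoundedKernel Ξ C ρ) (hg1 : ∀ y, ‖g y‖ ≤ 1)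
    (z : Euc n) {a : ℝ × Euc n} (ha : 0 < a.1) :
    ‖g a.2 * scaledKer Ξ z a‖ₑ ≤ ENNReal.ofReal C * coneKer ρ z a := by
  rw [enorm_mul]
  refine (mul_le_of_le_one_left zero_le ?_).trans (h.enorm_scaledKer_le z ha)
  rw [← ofReal_norm]
  exact ENNReal.ofReal_le_one.2 (hg1 _)

theorem IsBoundedKernel.integrable_prod [IsFiniteMeasure ν] (h : IsBoundedKernel Ξ C ρ)
    (hg : Measurable g) (hg1 : ∀ y, ‖g y‖ ≤ 1) (hν : ∀ᵐ a ∂ν, 0 < a.1) :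
    Integrable (fun q : Euc n × (ℝ × Euc n) => g q.2.2 * scaledKer Ξ q.1 q.2)
      (volume.prod ν) := by
  have hm : Measurable fun q : Euc n × (ℝ × Euc n) => g q.2.2 * scaledKer Ξ q.1 q.2 :=
    (hg.comp (measurable_snd.comp measurable_snd)).mul
      (measurable_scaledKer h.isTestFun.continuous)
  refine ⟨hm.aestronglyMeasurable, ?_⟩
  rw [hasFiniteIntegral_iff_enorm, lintegral_prod_symm _ hm.enorm.aemeasurable]
  have h1 : (∫⁻ a, (∫⁻ z, ‖g a.2 * scaledKer Ξ z a‖ₑ) ∂ν) ≤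
      ∫⁻ a, ENNReal.ofReal C * ENNReal.ofReal (ballConst n 1 * ρ ^ n) ∂ν := by
    refine lintegral_mono_ae ?_
    filter_upwards [hν] with a ha
    rw [← lintegral_coneKer h.pos ha, ← lintegral_const_mul' _ _ ENNReal.ofReal_ne_top]
    exact lintegral_mono fun z => h.enorm_mul_scaledKer_le hg1 z ha
  refine h1.trans_lt ?_
  rw [lintegral_const]
  finiteness

theorem IsBoundedKernel.integrable_pot [IsFiniteMeasure ν] (h : IsBoundedKernel Ξ C ρ)
    (hg : Measurable g) (hg1 : ∀ y, ‖g y‖ ≤ 1) (hν : ∀ᵐ a ∂ν, 0 < a.1) :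
    Integrable (pot Ξ g ν) :=
  (h.integrable_prod hg hg1 hν).integral_prod_left

theorem integral_scaledKer_mul (Ξ h : Euc n → ℝ) {a : ℝ × Euc n} (ha : 0 < a.1) :
    ∫ z, scaledKer Ξ z a * h z = avg Ξ a.1 h a.2 := by
  rw [avg_apply, ← integral_sub_left_eq_self (fun z => scaledKer Ξ z a * h z) volume a.2]
  have h1 := Measure.integral_comp_inv_smul volume (fun x => Ξ x * h (a.2 - a.1 • x)) a.1
  rw [finrank_euclideanSpace, Fintype.card_fin, abs_of_pos (by positivity), smul_eq_mul] at h1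
  rw [← inv_mul_eq_iff_eq_mul₀ (by positivity)] at h1
  rw [← h1, ← integral_const_mul]
  congr 1
  funext x
  rw [smul_inv_smul₀ ha.ne', scaledKer, sub_sub_cancel, inv_pow]
  ring

theorem IsBoundedKernel.integral_pot_mul [IsFiniteMeasure ν] (hΞ : IsBoundedKernel Ξ C ρ)
    (hg : Measurable g) (hg1 : ∀ y, ‖g y‖ ≤ 1) (hν : ∀ᵐ a ∂ν, 0 < a.1) {h : Euc n → ℝ}
    (hh : IsTestFun n h) :
    Integrable (fun a => g a.2 * avg Ξ a.1 h a.2) ν ∧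
      ∫ z, pot Ξ g ν z * h z = ∫ a, g a.2 * avg Ξ a.1 h a.2 ∂ν := by
  obtain ⟨B, hB0, hB⟩ := hh.exists_bound
  have h1 : Integrable (fun q : Euc n × (ℝ × Euc n) => (g q.2.2 * scaledKer Ξ q.1 q.2) * h q.1)
      (volume.prod ν) :=
    (hΞ.integrable_prod hg hg1 hν).mul_bdd (c := B)
      (hh.continuous.comp continuous_fst).aestronglyMeasurable
      (Eventually.of_forall fun q => hB q.1)
  have h2 : ∀ᵐ a ∂ν, ∫ z, (g a.2 * scaledKer Ξ z a) * h z = g a.2 * avg Ξ a.1 h a.2 := by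
    filter_upwards [hν] with a ha
    simp only [mul_assoc]
    rw [integral_const_mul, integral_scaledKer_mul Ξ h ha]
  refine ⟨h1.integral_prod_right.congr h2, ?_⟩
  rw [← integral_congr_ae h2, ← integral_integral_swap h1]
  simp only [pot, integral_mul_const]

theorem IsBoundedKernel.pot_ae_eq_add [IsFiniteMeasure ν] (h : IsBoundedKernel Ξ C ρ)
    (hg : Measurable g) (hg1 : ∀ y, ‖g y‖ ≤ 1) (hν : ∀ᵐ a ∂ν, 0 < a.1) {S : Set (ℝ × Euc n)}
    (hS : MeasurableSet S) :
    ∀ᵐ z, pot Ξ g ν z = pot Ξ g (ν.restrict S) z + pot Ξ g (ν.restrict Sᶜ) z := by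
  filter_upwards [(h.integrable_prod hg hg1 hν).prod_right_ae] with z hz
  exact (integral_add_compl hS hz).symm

theorem ae_prod_fst_mem (s : Set ℝ) (hs : MeasurableSet s) (σ : Measure (Euc n)) [SFinite σ] :
    ∀ᵐ a ∂((volume.restrict s).prod σ), a.1 ∈ s :=
  Measure.quasiMeasurePreserving_fst.ae (ae_restrict_mem hs)

theorem ae_tendsto_measure_closedBall (μ : Measure (Euc n)) [IsLocallyFiniteMeasure μ] :
    ∀ᵐ x, Tendsto (fun r => μ (closedBall x r) / ENNReal.ofReal (r ^ n)) (𝓝[>] (0 : ℝ))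
      (𝓝 (μ.rnDeriv volume x * volume (ball (0 : Euc n) 1))) := by
  filter_upwards [Besicovitch.ae_tendsto_rnDeriv μ (volume : Measure (Euc n))] with x hx
  have hV0 : volume (ball (0 : Euc n) 1) ≠ 0 := (measure_ball_pos volume 0 one_pos).ne'
  have hVt : volume (ball (0 : Euc n) 1) ≠ ⊤ := measure_ball_lt_top.ne
  refine (ENNReal.Tendsto.mul_const hx (Or.inr hVt)).congr' ?_
  filter_upwards [self_mem_nhdsWithin] with r hr
  have hr : 0 < r := hr
  rw [Measure.addHaar_closedBall volume _ hr.le, finrank_euclideanSpace, Fintype.card_fin,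
    div_eq_mul_inv, div_eq_mul_inv, ENNReal.mul_inv (Or.inr hVt) (Or.inr hV0), mul_assoc, mul_assoc,
    ENNReal.inv_mul_cancel hV0 hVt, mul_one]

theorem ae_tendsto_measure_ball_of_null (μ : Measure (Euc n)) [IsLocallyFiniteMeasure μ]
    {K : Set (Euc n)} (hK : MeasurableSet K) (hμ : μ K = 0) {c : ℝ} (hc : 0 < c) :
    ∀ᵐ x, x ∈ K → Tendsto (fun r => μ (ball x (c * r)) / ENNReal.ofReal (r ^ n)) (𝓝[>] (0 : ℝ))
      (𝓝 0) := by
  have h0 : ∀ᵐ x, x ∈ K → μ.rnDeriv volume x = 0 := by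
    have h1 : ∫⁻ x in K, μ.rnDeriv volume x = 0 :=
      le_antisymm ((Measure.setLIntegral_rnDeriv_le K).trans hμ.le) zero_le
    rw [lintegral_eq_zero_iff (Measure.measurable_rnDeriv μ volume)] at h1
    exact (ae_restrict_iff' hK).1 h1
  filter_upwards [h0, ae_tendsto_measure_closedBall μ] with x h0 hx hxK
  rw [h0 hxK, zero_mul] at hx
  have h1 := hx.comp (tendsto_const_mul_nhdsGT hc)
  have h2 := ENNReal.Tendsto.mul_const (b := ENNReal.ofReal (c ^ n)) h1
    (Or.inr ENNReal.ofReal_ne_top)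
  rw [zero_mul] at h2
  refine tendsto_of_tendsto_of_tendsto_of_le_of_le' tendsto_const_nhds h2
    (Eventually.of_forall fun _ => zero_le) ?_
  filter_upwards [self_mem_nhdsWithin] with r hr
  have hr : 0 < r := hr
  have e : ENNReal.ofReal ((c * r) ^ n) = ENNReal.ofReal (c ^ n) * ENNReal.ofReal (r ^ n) := by
    rw [← ENNReal.ofReal_mul (by positivity), mul_pow]
  simp only [Function.comp]
  have hcn : ENNReal.ofReal (c ^ n) ≠ 0 := by simpa using pow_pos hc n
  rw [e, div_eq_mul_inv, div_eq_mul_inv, ENNReal.mul_inv (Or.inl hcn)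
    (Or.inl ENNReal.ofReal_ne_top), mul_assoc, mul_right_comm, ENNReal.inv_mul_cancel hcn
    ENNReal.ofReal_ne_top, one_mul]
  exact mul_le_mul_left (measure_mono ball_subset_closedBall) _

theorem lintegral_rpow_bad_le {p : ℝ} (hp : 1 ≤ p) (hp2 : p * ((n : ℝ) - 1) < n)
    (σ : Measure (Euc n)) [IsFiniteMeasure σ] {F : Set (Euc n)} {c : ℝ} (hc : 0 < c) {x : Euc n}
    (hx : x ∈ F) {E : Set (Euc n)} (hE : MeasurableSet E) {r : ℝ} (hr : 0 < r)
    (hEr : E ⊆ ball x (2 * r)) {K : ℝ} (hK : 0 ≤ K) :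
    ∫⁻ a, ENNReal.ofReal (K * a.1 ^ (-n + n / p : ℝ))
      ∂(((volume.restrict (Set.Ioc 0 1)).prod σ).restrict
        ({a | a.1 ≤ c * infDist a.2 F} ∩ {a | a.2 ∈ E})) ≤
      ENNReal.ofReal (K * ((2 * c * r) ^ (1 - n + n / p : ℝ) / (1 - n + n / p))) * σ E := by
  have he := rpow_exponent hp hp2
  have hS : MeasurableSet {a : ℝ × Euc n | a.1 ≤ c * infDist a.2 F} :=
    measurableSet_le measurable_fst ((measurable_infDist.comp measurable_snd).const_mul c)
  have hE' : MeasurableSet {a : ℝ × Euc n | a.2 ∈ E} := measurable_snd hE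
  have hm : Measurable fun a : ℝ × Euc n => ENNReal.ofReal (K * a.1 ^ (-n + n / p : ℝ)) := by
    fun_prop
  rw [← lintegral_indicator (hS.inter hE'), lintegral_prod_symm _
    (hm.indicator (hS.inter hE')).aemeasurable]
  have h1 : ∀ y, ∫⁻ t in Set.Ioc (0 : ℝ) 1,
      ({a : ℝ × Euc n | a.1 ≤ c * infDist a.2 F} ∩ {a | a.2 ∈ E}).indicator
        (fun a => ENNReal.ofReal (K * a.1 ^ (-n + n / p : ℝ))) (t, y) ≤
      E.indicator (fun _ => ENNReal.ofReal (K * ((2 * c * r) ^ (1 - n + n / p : ℝ) /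
        (1 - n + n / p)))) y := by
    intro y
    by_cases hy : y ∈ E
    · rw [Set.indicator_of_mem hy]
      have hd : c * infDist y F ≤ 2 * c * r := by
        have h2 : infDist y F ≤ 2 * r := (infDist_le_dist_of_mem hx).trans (hEr hy).le
        nlinarith
      have h3 := lintegral_rpow_Ioc (e := (-n + n / p : ℝ)) (by linarith)
        (show 0 ≤ 2 * c * r by positivity)
      have e1 : (1 + (-n + n / p) : ℝ) = 1 - n + n / p := by ring
      rw [e1] at h3
      rw [ENNReal.ofReal_mul hK, ← h3, ← lintegral_const_mul' _ _ ENNReal.ofReal_ne_top,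
        ← lintegral_indicator measurableSet_Ioc, ← lintegral_indicator measurableSet_Ioc]
      refine lintegral_mono fun t => ?_
      by_cases ht : t ∈ Set.Ioc (0 : ℝ) 1
      · by_cases hS' : t ≤ c * infDist y F
        · rw [Set.indicator_of_mem ht, Set.indicator_of_mem (Set.mem_Ioc.2 ⟨ht.1, hS'.trans hd⟩),
            Set.indicator_of_mem (show (t, y) ∈ {a : ℝ × Euc n | a.1 ≤ c * infDist a.2 F} ∩
              {a | a.2 ∈ E} from ⟨hS', hy⟩), ENNReal.ofReal_mul hK]
        · rw [Set.indicator_of_mem ht, Set.indicator_of_notMem fun h => hS' h.1]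
          exact zero_le
      · rw [Set.indicator_of_notMem ht]
        exact zero_le
    · rw [Set.indicator_of_notMem hy]
      simp [hy]
  refine (lintegral_mono h1).trans (le_of_eq ?_)
  rw [lintegral_indicator_const hE]

theorem IsBoundedKernel.eLpNorm_bad_le {p : ℝ} (hp : 1 ≤ p) (hp2 : p * ((n : ℝ) - 1) < n)
    (hΞ : IsBoundedKernel Ξ C ρ) (hg1 : ∀ y, ‖g y‖ ≤ 1)
    (σ : Measure (Euc n)) [IsFiniteMeasure σ] {F : Set (Euc n)} {c : ℝ} (hc : 0 < c)
    (hρc : ρ * c ≤ 1 / 4) {x : Euc n} (hx : x ∈ F) {r : ℝ} (hr : 0 < r) :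
    eLpNorm (pot Ξ g (((volume.restrict (Set.Ioc 0 1)).prod σ).restrict
        {a | a.1 ≤ c * infDist a.2 F})) (ENNReal.ofReal p) (volume.restrict (ball x r)) ≤
      ENNReal.ofReal C * (ENNReal.ofReal (ballConst n p * ρ ^ (n / p : ℝ) *
        ((2 * c * r) ^ (1 - n + n / p : ℝ) / (1 - n + n / p))) *
          σ.restrict (closure F)ᶜ (ball x (2 * r))) := by
  have hp0 : 0 < p := by linarith
  have hρ := hΞ.pos
  have hb := ballConst_pos n p
  set S : Set (ℝ × Euc n) := {a | a.1 ≤ c * infDist a.2 F}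
  set E : Set (Euc n) := ball x (2 * r) ∩ (closure F)ᶜ
  set ν := (volume.restrict (Set.Ioc (0 : ℝ) 1)).prod σ
  have hE : MeasurableSet E := measurableSet_ball.inter isClosed_closure.measurableSet.compl
  have hS : MeasurableSet S :=
    measurableSet_le measurable_fst ((measurable_infDist.comp measurable_snd).const_mul c)
  have hE' : MeasurableSet {a : ℝ × Euc n | a.2 ∈ E} := measurable_snd hE
  have hν : ∀ᵐ a ∂ν, 0 < a.1 :=
    (ae_prod_fst_mem _ measurableSet_Ioc σ).mono fun a ha => ha.1
  have hpt : ∀ z ∈ ball x r, ‖pot Ξ g (ν.restrict S) z‖ₑ ≤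
      ENNReal.ofReal C * ∫⁻ a, coneKer ρ z a ∂(ν.restrict (S ∩ {a | a.2 ∈ E})) := by
    intro z hz
    refine (enorm_integral_le_lintegral_enorm _).trans ?_
    rw [← lintegral_const_mul' _ _ ENNReal.ofReal_ne_top, ← lintegral_indicator (hS.inter hE'),
      ← lintegral_indicator hS]
    refine lintegral_mono_ae ?_
    filter_upwards [hν] with a ha
    by_cases haS : a ∈ S
    · rw [Set.indicator_of_mem haS]
      by_cases haE : a.2 ∈ E
      · rw [Set.indicator_of_mem (show a ∈ S ∩ {a | a.2 ∈ E} from ⟨haS, haE⟩)]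
        exact hΞ.enorm_mul_scaledKer_le hg1 z ha
      · refine (hΞ.enorm_mul_scaledKer_le hg1 z ha).trans ?_
        rw [coneKer, Set.indicator_of_notMem, mul_zero]
        · exact zero_le
        intro hd
        refine haE ⟨?_, fun hcl => ?_⟩
        · have h1 : infDist a.2 F ≤ dist a.2 x := infDist_le_dist_of_mem hx
          have h2 : dist a.2 x ≤ dist z a.2 + dist z x := by
            rw [dist_comm z a.2]; exact dist_triangle _ _ _
          have h3 : dist z x < r := hz
          have h4 : dist z a.2 < ρ * a.1 := hd
          have h5 : a.1 ≤ c * infDist a.2 F := haS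
          have h6 : ρ * a.1 ≤ ρ * c * infDist a.2 F := by
            rw [mul_assoc]; exact mul_le_mul_of_nonneg_left h5 hρ.le
          have h7 : ρ * c * infDist a.2 F ≤ 1 / 4 * infDist a.2 F :=
            mul_le_mul_of_nonneg_right hρc infDist_nonneg
          rw [mem_ball]
          linarith
        · have h5 : a.1 ≤ c * infDist a.2 F := haS
          rw [(mem_closure_iff_infDist_zero ⟨x, hx⟩).1 hcl, mul_zero] at h5
          linarith
    · rw [Set.indicator_of_notMem haS]
      exact zero_le
  rw [eLpNorm_eq_lintegral_rpow_enorm_toReal (by simpa using hp0) ENNReal.ofReal_ne_top,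
    ENNReal.toReal_ofReal hp0.le]
  have h1 : ∫⁻ z in ball x r, ‖pot Ξ g (ν.restrict S) z‖ₑ ^ p ≤
      ENNReal.ofReal C ^ p * ∫⁻ z in ball x r,
        (∫⁻ a, coneKer ρ z a ∂(ν.restrict (S ∩ {a | a.2 ∈ E}))) ^ p := by
    rw [← lintegral_const_mul' _ _ (by finiteness)]
    refine setLIntegral_mono' measurableSet_ball fun z hz => ?_
    rw [← ENNReal.mul_rpow_of_nonneg _ _ hp0.le]
    exact ENNReal.rpow_le_rpow (hpt z hz) hp0.le
  have h2 := lintegral_rpow_coneKer_le hp hρ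
    (ν := ν.restrict (S ∩ {a | a.2 ∈ E})) (ae_restrict_of_ae hν) (ball x r)
  have h3 := lintegral_rpow_bad_le hp hp2 σ hc hx hE hr Set.inter_subset_left
    (K := ballConst n p * ρ ^ (n / p : ℝ)) (by positivity)
  have h4 := h1.trans (mul_le_mul_right (h2.trans (ENNReal.rpow_le_rpow h3 hp0.le)) _)
  rw [← ENNReal.mul_rpow_of_nonneg _ _ hp0.le] at h4
  refine (ENNReal.rpow_le_rpow h4 (by positivity)).trans (le_of_eq ?_)
  rw [← ENNReal.rpow_mul, mul_one_div_cancel hp0.ne', ENNReal.rpow_one,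
    Measure.restrict_apply measurableSet_ball]

theorem IsBoundedKernel.ae_lpDiffAt_bad {p : ℝ} (hp : 1 ≤ p) (hp2 : p * ((n : ℝ) - 1) < n)
    (hΞ : IsBoundedKernel Ξ C ρ) (hg1 : ∀ y, ‖g y‖ ≤ 1)
    (σ : Measure (Euc n)) [IsFiniteMeasure σ] (F : Set (Euc n)) {c : ℝ} (hc : 0 < c)
    (hρc : ρ * c ≤ 1 / 4) :
    ∀ᵐ x, x ∈ F → LpDiffAt p (pot Ξ g (((volume.restrict (Set.Ioc 0 1)).prod σ).restrict
        {a | a.1 ≤ c * infDist a.2 F})) x fun _ => 0 := by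
  have he := rpow_exponent hp hp2
  have hb := ballConst_pos n p
  have hρ := hΞ.pos
  filter_upwards [ae_tendsto_measure_ball_of_null (σ.restrict (closure F)ᶜ)
    (K := closure F) isClosed_closure.measurableSet (by simp [isClosed_closure.measurableSet])
    (zero_lt_two (α := ℝ))] with x hx hxF
  have hx := hx (subset_closure hxF)
  refine ⟨0, ?_⟩
  simp only [mul_zero, Finset.sum_const_zero, add_zero, sub_zero]
  set K := C * (ballConst n p * ρ ^ (n / p : ℝ) * ((2 * c) ^ (1 - n + n / p : ℝ) /
    (1 - n + n / p)))
  refine tendsto_div_ofReal_of_le (K := ENNReal.ofReal K) (fun r hr => by positivity)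
    ENNReal.ofReal_ne_top fun ε hε => ?_
  filter_upwards [eventually_le_of_tendsto_div (fun r hr => by positivity) hx hε,
    self_mem_nhdsWithin] with r hr1 hr
  have hr : 0 < r := hr
  refine (hΞ.eLpNorm_bad_le hp hp2 hg1 σ hc hρc hxF hr).trans ?_
  refine (mul_le_mul_right (mul_le_mul_right hr1 _) _).trans (le_of_eq ?_)
  have hC := hΞ.nonneg
  rw [← ENNReal.ofReal_mul (by positivity), ← ENNReal.ofReal_mul (by positivity),
    ← ENNReal.ofReal_mul (by positivity)]
  congr 1
  have e : r ^ (1 + n / p : ℝ) = r ^ (1 - n + n / p : ℝ) * r ^ n := by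
    rw [← Real.rpow_natCast r n, ← Real.rpow_add hr]
    congr 1
    ring
  rw [e, Real.mul_rpow (by positivity) hr.le]
  ring

end ConePotential

noncomputable section SquareEstimates

variable {n : ℕ}

theorem setLIntegral_enorm_le_eLpNorm_two {f : Euc n → ℝ} (hf : AEStronglyMeasurable f)
    (B : Set (Euc n)) :
    ∫⁻ x in B, ‖f x‖ₑ ≤ eLpNorm f 2 volume * volume B ^ (1 / 2 : ℝ) := by
  have h1 := eLpNorm_le_eLpNorm_mul_rpow_measure_univ (μ := volume.restrict B)
    (p := 1) (q := 2) (by norm_num) hf.restrict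
  rw [eLpNorm_one_eq_lintegral_enorm, Measure.restrict_apply_univ] at h1
  refine h1.trans ?_
  have e : (1 / (1 : ℝ≥0∞).toReal - 1 / (2 : ℝ≥0∞).toReal : ℝ) = 1 / 2 := by norm_num
  rw [e]
  exact mul_le_mul_left (eLpNorm_mono_measure f Measure.restrict_le_self) _

theorem IsTestFun.memLp_two {h : Euc n → ℝ} (hh : IsTestFun n h) : MemLp h 2 volume :=
  hh.continuous.memLp_of_hasCompactSupport hh.2

theorem exists_eLpNorm_two_dop_le {Q R : MvPolynomial (Fin n) ℝ} {m : ℕ} (hQ : Q.IsHomogeneous m)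
    (hR : R.IsHomogeneous m) (hell : ∀ ξ : Euc n, ξ ≠ 0 → pev Q ξ ≠ 0) (hm : m ≠ 0) :
    ∃ C : ℝ≥0∞, C ≠ ⊤ ∧ ∀ z : Euc n → ℝ, IsTestFun n z →
      eLpNorm (dop R z) 2 volume ≤ C * eLpNorm (dop Q z) 2 volume := by
  obtain ⟨C, hC0, hC⟩ := exists_l2_bound hQ hR hell hm
  refine ⟨ENNReal.ofReal (C ^ (1 / 2 : ℝ)), ENNReal.ofReal_ne_top, fun z hz => ?_⟩
  rw [(hz.dop R).memLp_two.eLpNorm_eq_integral_rpow_norm two_ne_zero ENNReal.ofNat_ne_top,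
    (hz.dop Q).memLp_two.eLpNorm_eq_integral_rpow_norm two_ne_zero ENNReal.ofNat_ne_top,
    ← ENNReal.ofReal_mul (by positivity)]
  refine ENNReal.ofReal_le_ofReal ?_
  simp only [ENNReal.toReal_ofNat, Real.rpow_ofNat, Real.norm_eq_abs, sq_abs]
  rw [← one_div, ← Real.mul_rpow hC0 (integral_nonneg fun x => sq_nonneg _)]
  exact Real.rpow_le_rpow (integral_nonneg fun x => sq_nonneg _) (hC z hz) (by norm_num)

theorem IsBoundedKernel.enorm_avg_one_le_lintegral {κ : Euc n → ℝ} {C ρ : ℝ}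
    (hκ : IsBoundedKernel κ C ρ) (h : Euc n → ℝ) (y : Euc n) :
    ‖avg κ 1 h y‖ₑ ≤ ENNReal.ofReal C * ∫⁻ x in ball 0 ρ, ‖h (y - x)‖ₑ := by
  rw [avg_apply]
  refine (enorm_integral_le_lintegral_enorm _).trans ?_
  rw [← lintegral_const_mul' _ _ ENNReal.ofReal_ne_top, ← lintegral_indicator measurableSet_ball]
  refine lintegral_mono fun x => ?_
  by_cases hx : κ x = 0
  · simp [hx]
  · rw [Set.indicator_of_mem (by simpa using hκ.lt x hx), enorm_mul, one_smul, ← ofReal_norm (κ x)]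
    exact mul_le_mul_left (ENNReal.ofReal_le_ofReal (hκ.le x)) _

theorem IsBoundedKernel.enorm_avg_one_le {κ : Euc n → ℝ} {C ρ : ℝ}
    (hκ : IsBoundedKernel κ C ρ) {h : Euc n → ℝ} (hh : IsTestFun n h) (y : Euc n) :
    ‖avg κ 1 h y‖ₑ ≤ ENNReal.ofReal C * volume (ball (0 : Euc n) ρ) ^ (1 / 2 : ℝ) *
      eLpNorm h 2 volume := by
  refine (hκ.enorm_avg_one_le_lintegral h y).trans ?_
  have h1 := setLIntegral_enorm_le_eLpNorm_two (f := fun x => h (y - x))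
    (hh.continuous.comp (by fun_prop)).aestronglyMeasurable (ball 0 ρ)
  have h2 := eLpNorm_comp_measurePreserving (p := 2) hh.continuous.aestronglyMeasurable
    (Measure.measurePreserving_sub_left (volume : Measure (Euc n)) y)
  have h3 : eLpNorm (fun x => h (y - x)) 2 volume = eLpNorm h 2 volume := h2
  rw [h3] at h1
  refine (mul_le_mul_right h1 _).trans (le_of_eq ?_)
  ring

theorem IsBoundedKernel.eLpNorm_avg_one_le {κ : Euc n → ℝ} {C ρ : ℝ}
    (hκ : IsBoundedKernel κ C ρ) {h : Euc n → ℝ} (hh : IsTestFun n h) :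
    eLpNorm (avg κ 1 h) 2 volume ≤ ENNReal.ofReal C * volume (ball (0 : Euc n) ρ) *
      eLpNorm h 2 volume := by
  set N := eLpNorm h 2 volume with hN
  by_cases hN0 : N = 0
  · rw [hN, eLpNorm_eq_zero_iff hh.continuous.aestronglyMeasurable two_ne_zero] at hN0
    have h1 : h = 0 := (hh.continuous.ae_eq_iff_eq volume continuous_zero).1 hN0
    have h2 : avg κ 1 h = 0 := by
      funext y
      simp [avg_apply, h1]
    rw [h2]
    simp
  have hNt : N ≠ ⊤ := hh.memLp_two.eLpNorm_ne_top
  have hpow : ∀ x : Euc n, ∫⁻ y, ‖h (y - x)‖ₑ ^ (2 : ℝ) = N ^ (2 : ℝ) := by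
    intro x
    rw [lintegral_sub_right_eq_self (fun y => ‖h y‖ₑ ^ (2 : ℝ)) x, hN,
      eLpNorm_eq_lintegral_rpow_enorm_toReal two_ne_zero ENNReal.ofNat_ne_top,
      ENNReal.toReal_ofNat, ← ENNReal.rpow_mul]
    norm_num
  have hm : Measurable (Function.uncurry fun y x : Euc n => ‖h (y - x)‖ₑ) :=
    (hh.continuous.comp (continuous_fst.sub continuous_snd)).measurable.enorm
  have h1 := lintegral_rpow_lintegral_le (μ := volume) (ν := volume.restrict (ball (0 : Euc n) ρ))
    (p := 2) one_le_two hm (measurable_const (a := N)) (Eventually.of_forall fun _ => hN0)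
    (Eventually.of_forall fun _ => hNt) (Eventually.of_forall fun x => (hpow x).le)
  rw [setLIntegral_const] at h1
  rw [eLpNorm_eq_lintegral_rpow_enorm_toReal two_ne_zero ENNReal.ofNat_ne_top,
    ENNReal.toReal_ofNat]
  have h2 : ∫⁻ y, ‖avg κ 1 h y‖ₑ ^ (2 : ℝ) ≤
      (ENNReal.ofReal C * (N * volume (ball (0 : Euc n) ρ))) ^ (2 : ℝ) := by
    rw [ENNReal.mul_rpow_of_nonneg _ _ zero_le_two]
    refine le_trans ?_ (mul_le_mul_right h1 _)
    rw [← lintegral_const_mul' _ _ (by finiteness)]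
    refine lintegral_mono fun y => ?_
    rw [← ENNReal.mul_rpow_of_nonneg _ _ zero_le_two]
    exact ENNReal.rpow_le_rpow (hκ.enorm_avg_one_le_lintegral h y) zero_le_two
  refine (ENNReal.rpow_le_rpow h2 (by norm_num)).trans (le_of_eq ?_)
  rw [← ENNReal.rpow_mul, mul_one_div_cancel two_ne_zero, ENNReal.rpow_one]
  ring

variable {Q R : MvPolynomial (Fin n) ℝ} {m : ℕ} {M φ : Euc n → ℝ}

theorem IsKernelPair.exists_eLpNorm_dop_eop_le (hK : IsKernelPair Q M φ)
    (hQ : Q.IsHomogeneous (m + 1)) (hR : R.IsHomogeneous (m + 1))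
    (hell : ∀ ξ : Euc n, ξ ≠ 0 → pev Q ξ ≠ 0) :
    ∃ C : ℝ≥0∞, C ≠ ⊤ ∧ ∀ h : Euc n → ℝ, IsTestFun n h →
      eLpNorm (eop M m 1 (dop R h)) 2 volume ≤ C * eLpNorm h 2 volume := by
  obtain ⟨C, hC, hCz⟩ := exists_eLpNorm_two_dop_le hQ hR hell (Nat.succ_ne_zero m)
  obtain ⟨B, ρ, hφ⟩ := hK.hφ.exists_isBoundedKernel
  have hVt : volume (ball (0 : Euc n) ρ) ≠ ⊤ := measure_ball_lt_top.ne
  refine ⟨C * (1 + ENNReal.ofReal B * volume (ball (0 : Euc n) ρ)), by finiteness, fun h hh => ?_⟩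
  rw [← dop_eop hK.hM hh]
  refine (hCz _ (isTestFun_eop hK.hM hh m 1)).trans ?_
  rw [hK.dop_eop_one hQ hh, mul_assoc]
  refine mul_le_mul_right ((eLpNorm_sub_le hh.continuous.aestronglyMeasurable
    (isTestFun_avg hK.hφ hh 1).continuous.aestronglyMeasurable one_le_two).trans ?_) _
  rw [add_mul, one_mul]
  exact add_le_add_right (hφ.eLpNorm_avg_one_le hh) _

theorem IsKernelPair.exists_enorm_eop_avg_le (hK : IsKernelPair Q M φ)
    (hR : R.IsHomogeneous (m + 1)) :
    ∃ C : ℝ≥0∞, C ≠ ⊤ ∧ ∀ h : Euc n → ℝ, IsTestFun n h → ∀ δ ≤ 1, ∀ y,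
      ‖eop M m δ (avg φ 1 (dop R h)) y‖ₑ ≤ C * eLpNorm h 2 volume := by
  obtain ⟨B, ρ, hψ⟩ := (hK.hφ.dop R).exists_isBoundedKernel
  have hVt : volume (ball (0 : Euc n) ρ) ≠ ⊤ := measure_ball_lt_top.ne
  have hI := (integrable_eop_weight hK.hM m 1).hasFiniteIntegral
  rw [hasFiniteIntegral_iff_enorm] at hI
  set I := ∫⁻ a : ℝ × Euc n, ‖a.1 ^ m * M a.2‖ₑ ∂((volume.restrict (Set.Ioc 0 1)).prod volume)
  refine ⟨I * (ENNReal.ofReal B * volume (ball (0 : Euc n) ρ) ^ (1 / 2 : ℝ)), by finiteness,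
    fun h hh δ hδ y => ?_⟩
  have h1 : avg φ 1 (dop R h) = avg (dop R φ) 1 h := by
    funext y
    simpa using pow_mul_avg_dop hR hK.hφ hh 1 y
  rw [h1, eop, shiftAvg]
  refine (enorm_integral_le_lintegral_enorm _).trans ?_
  have hle : (volume.restrict (Set.Ioc 0 δ)).prod (volume : Measure (Euc n)) ≤
      (volume.restrict (Set.Ioc 0 1)).prod volume :=
    Measure.prod_mono (Measure.restrict_mono (Set.Ioc_subset_Ioc_right hδ) le_rfl) le_rfl
  refine (lintegral_mono' hle le_rfl).trans ?_
  rw [mul_assoc, ← lintegral_mul_const' _ _ (by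
    have := hh.memLp_two.eLpNorm_ne_top
    finiteness)]
  refine lintegral_mono fun a => ?_
  rw [enorm_smul]
  exact mul_le_mul_right (hψ.enorm_avg_one_le hh _) _

end SquareEstimates

noncomputable section GoodPart

variable {n : ℕ}

/-- A cutoff height comparable to the distance to `F`. -/
def coneHeight (F : Set (Euc n)) (c ε : ℝ) (y : Euc n) : ℝ := c * (infDist y F + ε)

theorem measurable_coneHeight (F : Set (Euc n)) (c ε : ℝ) : Measurable (coneHeight F c ε) :=
  ((measurable_infDist.add_const ε).const_mul c)

theorem coneHeight_pos (F : Set (Euc n)) {c ε : ℝ} (hc : 0 < c) (hε : 0 < ε) (y : Euc n) :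
    0 < coneHeight F c ε y :=
  mul_pos hc (add_pos_of_nonneg_of_pos infDist_nonneg hε)

theorem coneKer_coneHeight_le {F : Set (Euc n)} {c ε ρ : ℝ} (hc : 0 < c) (hε : 0 < ε)
    (hρc : ρ * c ≤ 1 / 4) (z y : Euc n) :
    coneKer ρ z (coneHeight F c ε y, y) ≤ (ball z ((infDist z F + ε) / 3)).indicator
      (fun _ => ENNReal.ofReal ((3 / (2 * c * (infDist z F + ε))) ^ n)) y := by
  by_cases hy : dist z y < ρ * coneHeight F c ε y
  swap
  · simp [coneKer, hy]
  have h1 : infDist y F ≤ infDist z F + dist y z := infDist_le_infDist_add_dist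
  have h2 : infDist z F ≤ infDist y F + dist z y := infDist_le_infDist_add_dist
  rw [dist_comm y z] at h1
  have hd : 0 ≤ infDist y F := infDist_nonneg
  have hdz : 0 ≤ infDist z F := infDist_nonneg
  have h3 : dist z y < 1 / 4 * (infDist y F + ε) := by
    refine hy.trans_le ?_
    rw [coneHeight, ← mul_assoc]
    exact mul_le_mul_of_nonneg_right hρc (by positivity)
  have h4 : y ∈ ball z ((infDist z F + ε) / 3) := by
    rw [mem_ball, dist_comm]; linarith
  rw [Set.indicator_of_mem h4, coneKer, Set.indicator_of_mem (by exact hy)]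
  refine ENNReal.ofReal_le_ofReal (pow_le_pow_left₀ ?_ ?_ n)
  · exact inv_nonneg.2 (coneHeight_pos F hc hε y).le
  · rw [inv_le_comm₀ (coneHeight_pos F hc hε y) (by positivity), inv_div, coneHeight,
      div_le_iff₀ (by norm_num)]
    nlinarith

theorem lintegral_coneKer_coneHeight_le {F : Set (Euc n)} (hF : F.Nonempty) {c ε ρ lam : ℝ}
    (hc : 0 < c) (hε : 0 < ε) (hρc : ρ * c ≤ 1 / 4) {σ : Measure (Euc n)}
    (hlam : ∀ x ∈ F, ∀ r > 0, σ (ball x r) ≤ ENNReal.ofReal (lam * r ^ n)) (z : Euc n) :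
    ∫⁻ y, coneKer ρ z (coneHeight F c ε y, y) ∂σ ≤ ENNReal.ofReal (lam * (3 / c) ^ n) := by
  set D := infDist z F + ε with hD
  have hD0 : 0 < D := add_pos_of_nonneg_of_pos infDist_nonneg hε
  refine (lintegral_mono fun y => coneKer_coneHeight_le hc hε hρc z y).trans ?_
  rw [lintegral_indicator_const measurableSet_ball]
  obtain ⟨x, hxF, hx⟩ := (infDist_lt_iff hF).1 (show infDist z F < D by linarith)
  have h1 : ball z (D / 3) ⊆ ball x (2 * D) := by
    refine ball_subset_ball' ?_
    linarith
  refine (mul_le_mul_right ((measure_mono h1).trans (hlam x hxF _ (by positivity))) _).trans ?_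
  rw [← ENNReal.ofReal_mul (by positivity)]
  refine ENNReal.ofReal_le_ofReal (le_of_eq ?_)
  rw [mul_left_comm, ← mul_pow]
  congr 2
  rw [← hD]
  field_simp

variable {Q R : MvPolynomial (Fin n) ℝ} {m : ℕ} {M φ : Euc n → ℝ}

theorem IsBoundedKernel.enorm_avg_le_lintegral_coneKer {C ρ : ℝ} (hφ : IsBoundedKernel φ C ρ)
    {Λ δ : ℝ} (hδ : 0 < δ) (hδ1 : δ < 1) {y : Euc n} (hy : y ∈ ball (0 : Euc n) Λ)
    (Z : Euc n → ℝ) :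
    ‖avg φ δ Z y‖ₑ ≤ ∫⁻ z in ball 0 (Λ + ρ), ENNReal.ofReal C *
      (coneKer ρ z (δ, y) * ‖Z z‖ₑ) := by
  rw [← integral_scaledKer_mul φ Z (a := (δ, y)) hδ]
  refine (enorm_integral_le_lintegral_enorm _).trans ?_
  rw [← lintegral_indicator measurableSet_ball]
  refine lintegral_mono fun z => ?_
  have h2 := hφ.enorm_scaledKer_le z (a := (δ, y)) hδ
  by_cases hz : dist z y < ρ * δ
  · have hzB : z ∈ ball (0 : Euc n) (Λ + ρ) := by
      have h2 := dist_triangle z y 0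
      have h3 : ρ * δ ≤ ρ := by nlinarith [hφ.pos]
      rw [mem_ball] at hy ⊢
      linarith
    rw [Set.indicator_of_mem hzB, enorm_mul, ← mul_assoc]
    exact mul_le_mul_left h2 _
  · have h3 : coneKer ρ z (δ, y) = 0 := by simp [coneKer, hz]
    rw [h3, mul_zero, nonpos_iff_eq_zero, enorm_eq_zero] at h2
    simp [h2]

theorem measurable_coneKer_coneHeight (F : Set (Euc n)) (c ε ρ : ℝ) :
    Measurable fun q : Euc n × Euc n => coneKer ρ q.2 (coneHeight F c ε q.1, q.1) := by
  have hm : Measurable fun q : Euc n × Euc n => coneHeight F c ε q.1 :=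
    (measurable_coneHeight F c ε).comp measurable_fst
  have hS : MeasurableSet {q : Euc n × Euc n | dist q.2 q.1 < ρ * coneHeight F c ε q.1} :=
    measurableSet_lt (by fun_prop) (hm.const_mul ρ)
  exact Measurable.indicator (f := fun q : Euc n × Euc n =>
    ENNReal.ofReal ((coneHeight F c ε q.1)⁻¹ ^ n)) (by fun_prop) hS

theorem lintegral_lintegral_mul_le {α β : Type*} [MeasurableSpace α] [MeasurableSpace β]
    {μ : Measure α} {ν : Measure β} [SFinite μ] [SFinite ν] {K : β × α → ℝ≥0∞} (hK : Measurable K)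
    {w : α → ℝ≥0∞} (hw : Measurable w) {A : ℝ≥0∞} (hA : A ≠ ⊤)
    (h : ∀ z, ∫⁻ y, K (y, z) ∂ν ≤ A) :
    ∫⁻ y, (∫⁻ z, K (y, z) * w z ∂μ) ∂ν ≤ A * ∫⁻ z, w z ∂μ := by
  have h1 : Measurable fun q : β × α => K q * w q.2 := hK.mul (hw.comp measurable_snd)
  rw [lintegral_lintegral_swap h1.aemeasurable, ← lintegral_const_mul' _ _ hA]
  refine lintegral_mono fun z => ?_
  have h2 : Measurable fun y => K (y, z) := hK.comp (measurable_id.prodMk measurable_const)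
  rw [lintegral_mul_const _ h2]
  exact mul_le_mul_left (h z) _

theorem lintegral_lintegral_coneKer_le {F : Set (Euc n)} (hF : F.Nonempty) {c ε ρ lam : ℝ}
    (hc : 0 < c) (hε : 0 < ε) (hρc : ρ * c ≤ 1 / 4) {σ : Measure (Euc n)} [SFinite σ]
    (hlam : ∀ x ∈ F, ∀ r > 0, σ (ball x r) ≤ ENNReal.ofReal (lam * r ^ n))
    {w : Euc n → ℝ≥0∞} (hw : Measurable w) (μ : Measure (Euc n)) [SFinite μ] :
    ∫⁻ y, (∫⁻ z, coneKer ρ z (coneHeight F c ε y, y) * w z ∂μ) ∂σ ≤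
      ENNReal.ofReal (lam * (3 / c) ^ n) * ∫⁻ z, w z ∂μ :=
  lintegral_lintegral_mul_le (measurable_coneKer_coneHeight F c ε ρ) hw ENNReal.ofReal_ne_top
    (lintegral_coneKer_coneHeight_le hF hc hε hρc hlam)

theorem IsBoundedKernel.lintegral_enorm_avg_le {C ρ : ℝ} (hφ : IsBoundedKernel φ C ρ)
    {F : Set (Euc n)} (hF : F.Nonempty) {c ε lam Λ : ℝ}
    (hc : 0 < c) (hε : 0 < ε) (hρc : ρ * c ≤ 1 / 4) {σ : Measure (Euc n)} [SFinite σ]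
    (hσΛ : σ (ball 0 Λ)ᶜ = 0)
    (hlam : ∀ x ∈ F, ∀ r > 0, σ (ball x r) ≤ ENNReal.ofReal (lam * r ^ n))
    {Z : Euc n → ℝ} (hZ : Measurable Z) :
    ∫⁻ y in {y | coneHeight F c ε y < 1}, ‖avg φ (coneHeight F c ε y) Z y‖ₑ ∂σ ≤
      ENNReal.ofReal C * (ENNReal.ofReal (lam * (3 / c) ^ n) *
        ∫⁻ z in ball 0 (Λ + ρ), ‖Z z‖ₑ) := by
  have hS : MeasurableSet {y | coneHeight F c ε y < 1} :=
    measurableSet_lt (measurable_coneHeight F c ε) measurable_const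
  have hpt : ∀ᵐ y ∂(σ.restrict {y | coneHeight F c ε y < 1}),
      ‖avg φ (coneHeight F c ε y) Z y‖ₑ ≤ ENNReal.ofReal C *
        ∫⁻ z in ball 0 (Λ + ρ), coneKer ρ z (coneHeight F c ε y, y) * ‖Z z‖ₑ := by
    have h1 : ∀ᵐ y ∂(σ.restrict {y | coneHeight F c ε y < 1}), y ∈ ball (0 : Euc n) Λ :=
      ae_restrict_of_ae hσΛ
    filter_upwards [h1, ae_restrict_mem hS] with y hyΛ hy1
    rw [← lintegral_const_mul' _ _ ENNReal.ofReal_ne_top]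
    exact hφ.enorm_avg_le_lintegral_coneKer (coneHeight_pos F hc hε y) hy1 hyΛ Z
  refine (lintegral_mono_ae hpt).trans ?_
  rw [lintegral_const_mul' _ _ ENNReal.ofReal_ne_top]
  refine mul_le_mul_right ?_ _
  refine (lintegral_mono' Measure.restrict_le_self le_rfl).trans ?_
  exact lintegral_lintegral_coneKer_le hF hc hε hρc hlam hZ.enorm _

theorem setIntegral_Ioc_avg (hM : IsTestFun n M) {k : Euc n → ℝ} (hk : IsTestFun n k) {δ : ℝ}
    (hδ : 0 ≤ δ) (hδ1 : δ ≤ 1) (y : Euc n) :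
    ∫ t in Set.Ioc δ 1, t ^ m * avg M t k y = eop M m 1 k y - eop M m δ k y := by
  have hc : Continuous fun t : ℝ => t ^ m * avg M t k y :=
    (continuous_pow m).mul
      (continuous_iff_continuousAt.2 fun t => (hasDerivAt_avg hM hk y t).continuousAt)
  rw [eop_apply hM hk, eop_apply hM hk, ← intervalIntegral.integral_of_le hδ,
    ← intervalIntegral.integral_of_le zero_le_one, ← intervalIntegral.integral_of_le hδ1]
  exact (intervalIntegral.integral_interval_sub_left (hc.intervalIntegrable _ _)
    (hc.intervalIntegrable _ _)).symm

/-- The part of the cone over the unit interval that lies above `coneHeight`. -/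
def aboveCone (F : Set (Euc n)) (c ε : ℝ) : Set (ℝ × Euc n) := {a | coneHeight F c ε a.2 < a.1}

theorem measurableSet_aboveCone (F : Set (Euc n)) (c ε : ℝ) : MeasurableSet (aboveCone F c ε) :=
  measurableSet_lt ((measurable_coneHeight F c ε).comp measurable_snd) measurable_fst

theorem IsKernelPair.enorm_integral_aboveCone_le (hK : IsKernelPair Q M φ)
    (hQ : Q.IsHomogeneous (m + 1)) {q : MvPolynomial (Fin n) ℝ} (hq : q.IsHomogeneous m)
    {g : Euc n → ℝ} (hg : Measurable g) (hg1 : ∀ y, ‖g y‖ ≤ 1) {σ : Measure (Euc n)}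
    [IsFiniteMeasure σ] (F : Set (Euc n)) {c ε : ℝ} (hc : 0 < c) (hε : 0 < ε) (b : Fin n)
    {h : Euc n → ℝ} (hh : IsTestFun n h) :
    ‖∫ a in aboveCone F c ε, g a.2 * avg (dop q M) a.1 (dop (MvPolynomial.X b) h) a.2
        ∂((volume.restrict (Set.Ioc 0 1)).prod σ)‖ₑ ≤
      ∫⁻ y in {y | coneHeight F c ε y < 1},
        (‖avg φ (coneHeight F c ε y) (eop M m 1 (dop (q * MvPolynomial.X b) h)) y‖ₑ +
        ‖eop M m (coneHeight F c ε y) (avg φ 1 (dop (q * MvPolynomial.X b) h)) y‖ₑ) ∂σ := by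
  set k := dop (q * MvPolynomial.X b) h with hk
  have hkt : IsTestFun n k := hh.dop _
  have hS := measurableSet_aboveCone F c ε
  have h1 : ∀ t y, avg (dop q M) t (dop (MvPolynomial.X b) h) y = t ^ m * avg M t k y := by
    intro t y
    rw [← pow_mul_avg_dop hq hK.hM (hh.dop _), hk, dop_mul _ _ hh.contDiff]
  obtain ⟨C, ρ, hΞ⟩ := (hK.hM.dop q).exists_isBoundedKernel
  have hpi := (hΞ.integral_pot_mul (ν := (volume.restrict (Set.Ioc 0 1)).prod σ) hg hg1
    ((ae_prod_fst_mem _ measurableSet_Ioc σ).mono fun a ha => ha.1)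
    (hh.dop (MvPolynomial.X b))).1
  rw [← integral_indicator hS, integral_prod_symm _ (hpi.indicator hS)]
  refine (enorm_integral_le_lintegral_enorm _).trans ?_
  have hS1 : MeasurableSet {y | coneHeight F c ε y < 1} :=
    measurableSet_lt (measurable_coneHeight F c ε) measurable_const
  rw [← lintegral_indicator hS1]
  refine lintegral_mono fun y => ?_
  have hpos := coneHeight_pos F hc hε y
  have h2 : ∫ t in Set.Ioc 0 1, (aboveCone F c ε).indicator (fun a : ℝ × Euc n =>
      g a.2 * avg (dop q M) a.1 (dop (MvPolynomial.X b) h) a.2) (t, y) =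
      g y * ∫ t in Set.Ioc (coneHeight F c ε y) 1, t ^ m * avg M t k y := by
    have h3 : ∀ t : ℝ, (aboveCone F c ε).indicator (fun a : ℝ × Euc n =>
      g a.2 * avg (dop q M) a.1 (dop (MvPolynomial.X b) h) a.2) (t, y) =
      (Set.Ioi (coneHeight F c ε y)).indicator (fun t => g y * (t ^ m * avg M t k y)) t := by
      intro t
      simp only [Set.indicator, aboveCone, Set.mem_ofPred_eq, Set.mem_Ioi, h1]
    simp only [h3]
    rw [setIntegral_indicator measurableSet_Ioi, Set.Ioc_inter_Ioi, max_eq_right hpos.le,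
      integral_const_mul]
  rw [h2]
  by_cases hy : coneHeight F c ε y < 1
  · rw [Set.indicator_of_mem (by exact hy), setIntegral_Ioc_avg hK.hM hkt hpos.le hy.le,
      hK.eop_one_sub hQ hkt hpos.le, enorm_mul]
    refine (mul_le_mul_left (?_ : ‖g y‖ₑ ≤ 1) _).trans ?_
    · rw [← ofReal_norm, ← ENNReal.ofReal_one]
      exact ENNReal.ofReal_le_ofReal (hg1 y)
    · rw [one_mul]
      exact enorm_sub_le
  · rw [Set.Ioc_eq_empty hy]
    simp

end GoodPart

noncomputable section RieszGradient

variable {n : ℕ}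

/-- The submodule of real-valued test functions. -/
def testFunSubmodule (n : ℕ) : Submodule ℝ (Euc n → ℝ) where
  carrier := {h | IsTestFun n h}
  add_mem' hf hg := IsTestFun.add hf hg
  zero_mem' := ⟨contDiff_const, HasCompactSupport.zero⟩
  smul_mem' c _ hf := IsTestFun.const_smul c hf

/-- The inclusion of test functions into `L²`. -/
def testFunToLp (n : ℕ) : testFunSubmodule n →ₗ[ℝ] Lp ℝ 2 (volume : Measure (Euc n)) where
  toFun h := (IsTestFun.memLp_two h.2).toLp
  map_add' _ _ := rfl
  map_smul' _ _ := rfl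

/-- A linear functional on test functions that is bounded for the `L²` norm is represented by an
`L²` function. -/
theorem exists_memLp_two_of_bound (L : testFunSubmodule n →ₗ[ℝ] ℝ) {C : ℝ≥0∞} (hC : C ≠ ⊤)
    (hL : ∀ h : testFunSubmodule n, ‖L h‖ₑ ≤ C * eLpNorm (h : Euc n → ℝ) 2 volume) :
    ∃ G : Euc n → ℝ, MemLp G 2 volume ∧
      ∀ h : testFunSubmodule n, L h = ∫ x, G x * (h : Euc n → ℝ) x := by
  set ι := testFunToLp n with hι
  have hb : ∀ h, ‖L h‖ ≤ C.toReal * ‖ι h‖ := by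
    intro h
    have h1 := ENNReal.toReal_mono (ENNReal.mul_ne_top hC
      (IsTestFun.memLp_two h.2).eLpNorm_ne_top) (hL h)
    rw [toReal_enorm, ENNReal.toReal_mul] at h1
    exact h1.trans_eq (congrArg _ (Lp.norm_toLp _ (IsTestFun.memLp_two h.2)).symm)
  have hker : LinearMap.ker ι ≤ LinearMap.ker L := fun h hh => by
    have h2 := hb h
    rw [LinearMap.mem_ker.1 hh, norm_zero, mul_zero] at h2
    exact norm_le_zero_iff.1 h2
  let L' : LinearMap.range ι →ₗ[ℝ] ℝ :=
    (LinearMap.ker ι).liftQ L hker ∘ₗ ι.quotKerEquivRange.symm.toLinearMap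
  have hL' : ∀ h, L' ⟨ι h, LinearMap.mem_range_self ι h⟩ = L h := by
    intro h
    change (LinearMap.ker ι).liftQ L hker (ι.quotKerEquivRange.symm _) = _
    rw [LinearMap.quotKerEquivRange_symm_apply_image, Submodule.mkQ_apply, Submodule.liftQ_apply]
  obtain ⟨g, hg, -⟩ := exists_extension_norm_eq (LinearMap.range ι)
    (L'.mkContinuous C.toReal (by
      rintro ⟨_, h, rfl⟩
      rw [hL' h]
      exact hb h))
  set G := (InnerProductSpace.toDual ℝ (Lp ℝ 2 (volume : Measure (Euc n)))).symm g with hG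
  refine ⟨G, Lp.memLp G, fun h => ?_⟩
  have h3 : L h = g (ι h) := by
    rw [hg ⟨ι h, LinearMap.mem_range_self ι h⟩, ← hL' h]
    rfl
  rw [h3, ← InnerProductSpace.toDual_symm_apply, L2.inner_def]
  refine integral_congr_ae ?_
  filter_upwards [(IsTestFun.memLp_two h.2).coeFn_toLp] with x hx
  change ⟪G x, ((IsTestFun.memLp_two h.2).toLp : Euc n → ℝ) x⟫ = _
  rw [hx, real_inner_eq_re_inner]
  simp [mul_comm]

theorem exists_isWeakGrad_of_bound {w : Euc n → ℝ} (hw : LocallyIntegrable w volume)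
    (hb : ∀ b : Fin n, ∃ C : ℝ≥0∞, C ≠ ⊤ ∧ ∀ h : Euc n → ℝ, IsTestFun n h →
      ‖∫ x, w x * dop (MvPolynomial.X b) h x‖ₑ ≤ C * eLpNorm h 2 volume) :
    ∃ G : Fin n → Euc n → ℝ, IsWeakGrad w G ∧ ∀ b, LocallyIntegrable (G b) volume := by
  have hpi : ∀ (b : Fin n) (h : testFunSubmodule n),
      Integrable fun x => w x * dop (MvPolynomial.X b) (h : Euc n → ℝ) x := by
    intro b h
    refine (integrable_locallyIntegrable_mul hw (IsTestFun.dop (MvPolynomial.X b) h.2)).congr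
      (Eventually.of_forall fun x => ?_)
    simp [mul_comm]
  let L : Fin n → testFunSubmodule n →ₗ[ℝ] ℝ := fun b =>
    { toFun := fun h => -∫ x, w x * dop (MvPolynomial.X b) (h : Euc n → ℝ) x
      map_add' := by
        intro f g
        rw [← neg_add, ← integral_add (hpi b f) (hpi b g)]
        congr 2
        funext x
        rw [Submodule.coe_add, dop_add _ f.2.1 g.2.1, Pi.add_apply, mul_add]
      map_smul' := by
        intro c f
        rw [RingHom.id_apply, smul_neg, ← integral_smul]
        congr 2
        funext x
        rw [Submodule.coe_smul, dop_smul _ c f.2.1, Pi.smul_apply]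
        simp only [smul_eq_mul]
        ring }
  have hG : ∀ b, ∃ G : Euc n → ℝ, MemLp G 2 volume ∧
      ∀ h : testFunSubmodule n, L b h = ∫ x, G x * (h : Euc n → ℝ) x := by
    intro b
    obtain ⟨C, hC, hb⟩ := hb b
    refine exists_memLp_two_of_bound (L b) hC fun h => ?_
    change ‖-∫ x, w x * dop (MvPolynomial.X b) (h : Euc n → ℝ) x‖ₑ ≤ _
    rw [enorm_neg]
    exact hb h h.2
  choose G hG1 hG2 using hG
  refine ⟨G, fun b h hh => ?_, fun b => (hG1 b).locallyIntegrable one_le_two⟩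
  rw [← hG2 b ⟨h, hh⟩]
  have h1 := dop_X b hh.contDiff
  change _ = -(-∫ x, w x * dop (MvPolynomial.X b) h x)
  rw [neg_neg, h1]

end RieszGradient

noncomputable section PotentialDiff

variable {n : ℕ} {Q : MvPolynomial (Fin n) ℝ} {m : ℕ} {M φ : Euc n → ℝ}

theorem iUnion_aboveCone (F : Set (Euc n)) {c : ℝ} (hc : 0 < c) :
    ⋃ j : ℕ, aboveCone F c (1 / ((j : ℝ) + 1)) = {a : ℝ × Euc n | a.1 ≤ c * infDist a.2 F}ᶜ := by
  ext a
  simp only [Set.mem_iUnion, Set.mem_compl_iff, aboveCone, coneHeight, Set.mem_ofPred_eq, not_le]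
  constructor
  · rintro ⟨j, hj⟩
    refine lt_of_le_of_lt (mul_le_mul_of_nonneg_left ?_ hc.le) hj
    have : 0 < 1 / ((j : ℝ) + 1) := by positivity
    linarith
  · intro h
    obtain ⟨j, hj⟩ := exists_nat_one_div_lt (K := ℝ) (ε := (a.1 - c * infDist a.2 F) / c)
      (div_pos (by linarith) hc)
    refine ⟨j, ?_⟩
    rw [lt_div_iff₀ hc] at hj
    linarith

theorem monotone_aboveCone (F : Set (Euc n)) {c : ℝ} (hc : 0 < c) :
    Monotone fun j : ℕ => aboveCone F c (1 / ((j : ℝ) + 1)) := by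
  intro i j hij a ha
  have ha : coneHeight F c (1 / ((i : ℝ) + 1)) a.2 < a.1 := ha
  refine lt_of_le_of_lt ?_ ha
  refine mul_le_mul_of_nonneg_left ?_ hc.le
  have : 1 / ((j : ℝ) + 1) ≤ 1 / ((i : ℝ) + 1) := by
    refine one_div_le_one_div_of_le (by positivity) ?_
    have : (i : ℝ) ≤ j := by exact_mod_cast hij
    linarith
  linarith

theorem IsKernelPair.exists_enorm_integral_aboveCone_le (hK : IsKernelPair Q M φ)
    (hQ : Q.IsHomogeneous (m + 1)) (hell : ∀ ξ : Euc n, ξ ≠ 0 → pev Q ξ ≠ 0)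
    {q : MvPolynomial (Fin n) ℝ} (hq : q.IsHomogeneous m)
    {g : Euc n → ℝ} (hg : Measurable g) (hg1 : ∀ y, ‖g y‖ ≤ 1) {σ : Measure (Euc n)}
    [IsFiniteMeasure σ] {Λ : ℝ} (hσΛ : σ (ball 0 Λ)ᶜ = 0) {F : Set (Euc n)} (hF : F.Nonempty)
    {C ρ c lam : ℝ} (hφ : IsBoundedKernel φ C ρ) (hc : 0 < c) (hρc : ρ * c ≤ 1 / 4)
    (hlam : ∀ x ∈ F, ∀ r > 0, σ (ball x r) ≤ ENNReal.ofReal (lam * r ^ n)) (b : Fin n) :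
    ∃ B : ℝ≥0∞, B ≠ ⊤ ∧ ∀ h : Euc n → ℝ, IsTestFun n h → ∀ ε > 0,
      ‖∫ a in aboveCone F c ε, g a.2 * avg (dop q M) a.1 (dop (MvPolynomial.X b) h) a.2
        ∂((volume.restrict (Set.Ioc 0 1)).prod σ)‖ₑ ≤ B * eLpNorm h 2 volume := by
  have hR : (q * MvPolynomial.X b).IsHomogeneous (m + 1) := hq.mul (MvPolynomial.isHomogeneous_X _ b)
  obtain ⟨B1, hB1, h1⟩ := hK.exists_eLpNorm_dop_eop_le hQ hR hell
  obtain ⟨B2, hB2, h2⟩ := hK.exists_enorm_eop_avg_le hR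
  have hV : volume (ball (0 : Euc n) (Λ + ρ)) ≠ ⊤ := measure_ball_lt_top.ne
  have hσ : σ Set.univ ≠ ⊤ := measure_ne_top σ _
  refine ⟨ENNReal.ofReal C * (ENNReal.ofReal (lam * (3 / c) ^ n) *
    (B1 * volume (ball (0 : Euc n) (Λ + ρ)) ^ (1 / 2 : ℝ))) + B2 * σ Set.univ, by finiteness,
    fun h hh ε hε => ?_⟩
  refine (hK.enorm_integral_aboveCone_le hQ hq hg hg1 F hc hε b hh).trans ?_
  set k := dop (q * MvPolynomial.X b) h with hk
  have hZ : IsTestFun n (eop M m 1 k) := isTestFun_eop hK.hM (hh.dop _) m 1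
  set S := {y | coneHeight F c ε y < 1} with hS
  have hS1 : MeasurableSet S := measurableSet_lt (measurable_coneHeight F c ε) measurable_const
  have e1 := hφ.lintegral_enorm_avg_le hF hc hε hρc hσΛ hlam hZ.continuous.measurable
  have e2 : ∫⁻ y in S, ‖eop M m (coneHeight F c ε y) (avg φ 1 k) y‖ₑ ∂σ ≤
      B2 * σ Set.univ * eLpNorm h 2 volume := by
    have e3 : ∫⁻ y in S, ‖eop M m (coneHeight F c ε y) (avg φ 1 k) y‖ₑ ∂σ ≤
        ∫⁻ y in S, B2 * eLpNorm h 2 volume ∂σ := by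
      refine setLIntegral_mono measurable_const fun y hy => ?_
      have hy : coneHeight F c ε y < 1 := hy
      exact h2 h hh _ hy.le y
    refine e3.trans ?_
    rw [setLIntegral_const, mul_right_comm]
    exact mul_le_mul_left (mul_le_mul_right (measure_mono (Set.subset_univ _)) _) _
  have e4 : ∫⁻ z in ball 0 (Λ + ρ), ‖eop M m 1 k z‖ₑ ≤
      B1 * volume (ball (0 : Euc n) (Λ + ρ)) ^ (1 / 2 : ℝ) * eLpNorm h 2 volume := by
    refine (setLIntegral_enorm_le_eLpNorm_two hZ.continuous.aestronglyMeasurable _).trans ?_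
    rw [mul_right_comm]
    exact mul_le_mul_left (h1 h hh) _
  have e5 := e1.trans (mul_le_mul_right (mul_le_mul_right e4 _) _)
  obtain ⟨C', ρ', hΞ⟩ := (hK.hM.dop q).exists_isBoundedKernel
  rw [lintegral_add_left']
  · refine (add_le_add e5 e2).trans (le_of_eq ?_)
    ring
  · have e6 : Measurable fun y => ∫ z, scaledKer φ z (coneHeight F c ε y, y) * eop M m 1 k z := by
      have e7 : Measurable fun a : Euc n × Euc n =>
          scaledKer φ a.2 (coneHeight F c ε a.1, a.1) * eop M m 1 k a.2 := by
        have e8 : Measurable fun a : Euc n × Euc n => coneHeight F c ε a.1 :=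
          (measurable_coneHeight F c ε).comp measurable_fst
        refine Measurable.mul ?_ (hZ.continuous.measurable.comp measurable_snd)
        unfold scaledKer
        refine Measurable.mul (by fun_prop) (hφ.isTestFun.continuous.measurable.comp ?_)
        exact Measurable.smul (f := fun a : Euc n × Euc n => (coneHeight F c ε a.1)⁻¹)
          (by fun_prop) (by fun_prop)
      exact e7.stronglyMeasurable.integral_prod_right.measurable
    have e9 : (fun y => avg φ (coneHeight F c ε y) (eop M m 1 k) y) =
        fun y => ∫ z, scaledKer φ z (coneHeight F c ε y, y) * eop M m 1 k z :=
      funext fun y => (integral_scaledKer_mul φ _ (a := (coneHeight F c ε y, y))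
        (coneHeight_pos F hc hε y)).symm
    rw [← e9] at e6
    exact e6.enorm.aemeasurable

theorem IsKernelPair.ae_lpDiffAt_good {p : ℝ} (hp : 1 ≤ p) (hp2 : p * ((n : ℝ) - 1) < n)
    (hK : IsKernelPair Q M φ)
    (hQ : Q.IsHomogeneous (m + 1)) (hell : ∀ ξ : Euc n, ξ ≠ 0 → pev Q ξ ≠ 0)
    {q : MvPolynomial (Fin n) ℝ} (hq : q.IsHomogeneous m)
    {g : Euc n → ℝ} (hg : Measurable g) (hg1 : ∀ y, ‖g y‖ ≤ 1) {σ : Measure (Euc n)}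
    [IsFiniteMeasure σ] {Λ : ℝ} (hσΛ : σ (ball 0 Λ)ᶜ = 0) {F : Set (Euc n)} (hF : F.Nonempty)
    {C ρ c lam : ℝ} (hφ : IsBoundedKernel φ C ρ) (hc : 0 < c) (hρc : ρ * c ≤ 1 / 4)
    (hlam : ∀ x ∈ F, ∀ r > 0, σ (ball x r) ≤ ENNReal.ofReal (lam * r ^ n)) :
    ∀ᵐ x, ∃ T, LpDiffAt p (pot (dop q M) g (((volume.restrict (Set.Ioc 0 1)).prod σ).restrict
        {a | a.1 ≤ c * infDist a.2 F}ᶜ)) x T := by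
  obtain ⟨C', ρ', hΞ⟩ := (hK.hM.dop q).exists_isBoundedKernel
  set ν := (volume.restrict (Set.Ioc (0 : ℝ) 1)).prod σ with hν
  have hpos : ∀ᵐ a ∂ν, 0 < a.1 := (ae_prod_fst_mem _ measurableSet_Ioc σ).mono fun a ha => ha.1
  set S := {a : ℝ × Euc n | a.1 ≤ c * infDist a.2 F}ᶜ with hS
  have hpos' : ∀ᵐ a ∂(ν.restrict S), 0 < a.1 := ae_restrict_of_ae hpos
  have hpi := hΞ.integrable_pot hg hg1 hpos'
  obtain ⟨G, hG, hGl⟩ := exists_isWeakGrad_of_bound hpi.locallyIntegrable fun b => by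
    obtain ⟨B, hB, h⟩ := hK.exists_enorm_integral_aboveCone_le hQ hell hq hg hg1 hσΛ hF hφ hc hρc
      hlam b
    refine ⟨B, hB, fun h' hh => ?_⟩
    rw [(hΞ.integral_pot_mul hg hg1 hpos' (hh.dop (MvPolynomial.X b))).2]
    have hi := (hΞ.integral_pot_mul hg hg1 hpos (hh.dop (MvPolynomial.X b))).1
    have ht := tendsto_setIntegral_of_monotone (μ := ν)
      (fun j : ℕ => measurableSet_aboveCone F c (1 / ((j : ℝ) + 1)))
      (monotone_aboveCone F hc) hi.integrableOn
    rw [iUnion_aboveCone F hc] at ht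
    exact le_of_tendsto ((continuous_enorm.tendsto _).comp ht)
      (Eventually.of_forall fun j => h h' hh _ (by positivity))
  exact (hG.ae_lpDiffAt hp hp2 hpi.locallyIntegrable hGl).mono fun x hx => ⟨_, hx⟩

theorem IsKernelPair.ae_lpDiffAt_of_density {p : ℝ} (hp : 1 ≤ p) (hp2 : p * ((n : ℝ) - 1) < n)
    (hK : IsKernelPair Q M φ)
    (hQ : Q.IsHomogeneous (m + 1)) (hell : ∀ ξ : Euc n, ξ ≠ 0 → pev Q ξ ≠ 0)
    {q : MvPolynomial (Fin n) ℝ} (hq : q.IsHomogeneous m)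
    {g : Euc n → ℝ} (hg : Measurable g) (hg1 : ∀ y, ‖g y‖ ≤ 1) {σ : Measure (Euc n)}
    [IsFiniteMeasure σ] {Λ : ℝ} (hσΛ : σ (ball 0 Λ)ᶜ = 0) {F : Set (Euc n)} {lam : ℝ}
    (hlam : ∀ x ∈ F, ∀ r > 0, σ (ball x r) ≤ ENNReal.ofReal (lam * r ^ n)) :
    ∀ᵐ x, x ∈ F → ∃ T, LpDiffAt p (pot (dop q M) g ((volume.restrict (Set.Ioc 0 1)).prod σ)) x
      T := by
  rcases F.eq_empty_or_nonempty with rfl | hF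
  · simp
  obtain ⟨C', ρ', hΞ⟩ := (hK.hM.dop q).exists_isBoundedKernel
  obtain ⟨C, ρ, hφ⟩ := hK.hφ.exists_isBoundedKernel
  have hρ := hφ.pos
  have hρ' := hΞ.pos
  set c := 1 / (4 * (ρ + ρ')) with hcdef
  have hc : 0 < c := by positivity
  have hρc : ρ * c ≤ 1 / 4 := by
    rw [hcdef, mul_one_div, div_le_div_iff₀ (by positivity) (by norm_num)]
    linarith
  have hρc' : ρ' * c ≤ 1 / 4 := by
    rw [hcdef, mul_one_div, div_le_div_iff₀ (by positivity) (by norm_num)]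
    linarith
  have hpos : ∀ᵐ a ∂((volume.restrict (Set.Ioc (0 : ℝ) 1)).prod σ), 0 < a.1 :=
    (ae_prod_fst_mem _ measurableSet_Ioc σ).mono fun a ha => ha.1
  have hS : MeasurableSet {a : ℝ × Euc n | a.1 ≤ c * infDist a.2 F} :=
    measurableSet_le measurable_fst ((measurable_infDist.comp measurable_snd).const_mul c)
  have hsum := hΞ.pot_ae_eq_add hg hg1 hpos hS
  filter_upwards [hΞ.ae_lpDiffAt_bad hp hp2 hg1 σ F hc hρc',
    hK.ae_lpDiffAt_good hp hp2 hQ hell hq hg hg1 hσΛ hF hφ hc hρc hlam] with x hx ⟨T, hT⟩ hxF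
  refine ⟨_, ((hx hxF).add hp hT ?_ ?_).congr one_pos
    (ae_restrict_of_ae (hsum.mono fun z hz => hz.symm))⟩
  · exact (hΞ.integrable_pot hg hg1 (ae_restrict_of_ae hpos)).aestronglyMeasurable
  · exact (hΞ.integrable_pot hg hg1 (ae_restrict_of_ae hpos)).aestronglyMeasurable

theorem ae_exists_measure_ball_le (σ : Measure (Euc n)) [IsFiniteMeasure σ] :
    ∀ᵐ x, ∃ j : ℕ, ∀ r > 0, σ (ball x r) ≤ ENNReal.ofReal ((j : ℝ) * r ^ n) := by
  filter_upwards [ae_tendsto_measure_closedBall σ, Measure.rnDeriv_lt_top σ volume] with x hx hlt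
  set L := σ.rnDeriv volume x * volume (ball (0 : Euc n) 1) with hL
  have hLt : L < ⊤ := ENNReal.mul_lt_top hlt measure_ball_lt_top
  obtain ⟨i, hi⟩ := ENNReal.exists_nat_gt hLt.ne
  have h1 := hx.eventually_lt_const hi
  obtain ⟨r₀, hr₀, h2⟩ := mem_nhdsGT_iff_exists_Ioo_subset.1 h1
  have hr₀ : 0 < r₀ := hr₀
  obtain ⟨i', hi'⟩ := exists_nat_gt ((σ Set.univ).toReal / r₀ ^ n)
  refine ⟨i + i', fun r hr => ?_⟩
  have hrn : 0 < r ^ n := by positivity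
  by_cases hrr : r < r₀
  · have h3 : σ (closedBall x r) / ENNReal.ofReal (r ^ n) < i := h2 ⟨hr, hrr⟩
    have h4 := (ENNReal.div_le_iff (by simpa using hrn) ENNReal.ofReal_ne_top).1 h3.le
    refine (measure_mono ball_subset_closedBall).trans (h4.trans ?_)
    rw [← ENNReal.ofReal_natCast i, ← ENNReal.ofReal_mul (by positivity)]
    refine ENNReal.ofReal_le_ofReal ?_
    push_cast
    nlinarith [(Nat.cast_nonneg i' : (0 : ℝ) ≤ i')]
  · refine (measure_mono (Set.subset_univ _)).trans ?_
    rw [← ENNReal.ofReal_toReal (measure_ne_top σ Set.univ)]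
    refine ENNReal.ofReal_le_ofReal ?_
    rw [div_lt_iff₀ (by positivity)] at hi'
    have h5 : r₀ ^ n ≤ r ^ n := pow_le_pow_left₀ hr₀.le (not_lt.1 hrr) n
    push_cast
    nlinarith [(Nat.cast_nonneg i' : (0 : ℝ) ≤ i'), (Nat.cast_nonneg i : (0 : ℝ) ≤ i)]

theorem IsBoundedKernel.pot_restrict_ball {Ξ g : Euc n → ℝ} {C ρ : ℝ} (hΞ : IsBoundedKernel Ξ C ρ)
    (σ : Measure (Euc n)) [SFinite σ] {N : ℝ} {z : Euc n} (hz : z ∈ ball (0 : Euc n) N) :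
    pot Ξ g ((volume.restrict (Set.Ioc 0 1)).prod (σ.restrict (ball 0 (N + ρ)))) z =
      pot Ξ g ((volume.restrict (Set.Ioc 0 1)).prod σ) z := by
  have h1 : (volume.restrict (Set.Ioc (0 : ℝ) 1)).prod (σ.restrict (ball (0 : Euc n) (N + ρ))) =
      ((volume.restrict (Set.Ioc 0 1)).prod σ).restrict {a | a.2 ∈ ball (0 : Euc n) (N + ρ)} := by
    rw [← Measure.restrict_univ (μ := (volume.restrict (Set.Ioc (0 : ℝ) 1)) ),
      Measure.prod_restrict, Measure.restrict_univ]
    congr 1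
    ext a
    simp
  have hS : MeasurableSet {a : ℝ × Euc n | a.2 ∈ ball (0 : Euc n) (N + ρ)} :=
    measurable_snd measurableSet_ball
  rw [h1, pot, ← integral_indicator hS]
  refine integral_congr_ae ?_
  filter_upwards [ae_prod_fst_mem _ measurableSet_Ioc σ] with a ha
  by_cases haS : a.2 ∈ ball (0 : Euc n) (N + ρ)
  · rw [Set.indicator_of_mem (by exact haS)]
  · rw [Set.indicator_of_notMem (by exact haS)]
    have h2 := hΞ.enorm_scaledKer_le z ha.1
    have h3 : ¬ dist z a.2 < ρ * a.1 := by
      intro h4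
      refine haS ?_
      have h5 := dist_triangle_left a.2 0 z
      rw [mem_ball] at hz ⊢
      nlinarith [hΞ.pos, ha.2]
    have h4 : coneKer ρ z a = 0 := by simp [coneKer, h3]
    rw [h4, mul_zero, nonpos_iff_eq_zero, enorm_eq_zero] at h2
    rw [h2, mul_zero]

theorem IsKernelPair.ae_lpDiffAt_pot {p : ℝ} (hp : 1 ≤ p) (hp2 : p * ((n : ℝ) - 1) < n)
    (hK : IsKernelPair Q M φ)
    (hQ : Q.IsHomogeneous (m + 1)) (hell : ∀ ξ : Euc n, ξ ≠ 0 → pev Q ξ ≠ 0)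
    {q : MvPolynomial (Fin n) ℝ} (hq : q.IsHomogeneous m)
    {g : Euc n → ℝ} (hg : Measurable g) (hg1 : ∀ y, ‖g y‖ ≤ 1) (σ : Measure (Euc n))
    [IsLocallyFiniteMeasure σ] :
    ∀ᵐ x, ∃ T, LpDiffAt p (pot (dop q M) g ((volume.restrict (Set.Ioc 0 1)).prod σ)) x T := by
  obtain ⟨C, ρ, hΞ⟩ := (hK.hM.dop q).exists_isBoundedKernel
  have h1 : ∀ N : ℕ, ∀ᵐ x, x ∈ ball (0 : Euc n) N →
      ∃ T, LpDiffAt p (pot (dop q M) g ((volume.restrict (Set.Ioc 0 1)).prod σ)) x T := by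
    intro N
    have hfin : IsFiniteMeasure (σ.restrict (ball (0 : Euc n) (N + ρ))) :=
      isFiniteMeasure_restrict.2 measure_ball_lt_top.ne
    have hnull : σ.restrict (ball (0 : Euc n) (N + ρ)) (ball (0 : Euc n) (N + ρ))ᶜ = 0 := by
      rw [Measure.restrict_apply measurableSet_ball.compl]
      simp
    have h2 : ∀ j : ℕ, ∀ᵐ x : Euc n, (∀ r > 0, σ.restrict (ball (0 : Euc n) (N + ρ)) (ball x r) ≤
        ENNReal.ofReal ((j : ℝ) * r ^ n)) → ∃ T, LpDiffAt p (pot (dop q M) g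
          ((volume.restrict (Set.Ioc 0 1)).prod (σ.restrict (ball 0 (N + ρ))))) x T := fun j =>
      hK.ae_lpDiffAt_of_density hp hp2 hQ hell hq hg hg1 hnull
        (F := {x | ∀ r > 0, σ.restrict (ball (0 : Euc n) (N + ρ)) (ball x r) ≤
          ENNReal.ofReal ((j : ℝ) * r ^ n)}) fun x hx => hx
    filter_upwards [ae_all_iff.2 h2,
      ae_exists_measure_ball_le (σ.restrict (ball (0 : Euc n) (N + ρ)))] with x hx ⟨j, hj⟩ hxN
    obtain ⟨T, hT⟩ := hx j hj
    obtain ⟨s, hs, hsub⟩ := Metric.isOpen_iff.1 isOpen_ball x hxN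
    refine ⟨T, hT.congr hs ?_⟩
    refine (ae_restrict_mem measurableSet_ball).mono fun z hz => ?_
    exact hΞ.pot_restrict_ball σ (hsub hz)
  filter_upwards [ae_all_iff.2 h1] with x hx
  obtain ⟨N, hN⟩ := exists_nat_gt ‖x‖
  exact hx N (by simpa using hN)

end PotentialDiff

noncomputable section LocalPotential

variable {n : ℕ} {Ξ g : Euc n → ℝ} {C ρ : ℝ}

theorem IsBoundedKernel.locallyIntegrable_pot (hΞ : IsBoundedKernel Ξ C ρ) (hg : Measurable g)
    (hg1 : ∀ y, ‖g y‖ ≤ 1) (σ : Measure (Euc n)) [IsLocallyFiniteMeasure σ] :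
    LocallyIntegrable (pot Ξ g ((volume.restrict (Set.Ioc 0 1)).prod σ)) := by
  intro x
  obtain ⟨N, hN⟩ := exists_nat_gt ‖x‖
  have hfin : IsFiniteMeasure (σ.restrict (ball (0 : Euc n) (N + ρ))) :=
    isFiniteMeasure_restrict.2 measure_ball_lt_top.ne
  refine ⟨ball 0 N, isOpen_ball.mem_nhds (by simpa using hN), ?_⟩
  have h1 : Integrable (pot Ξ g
      ((volume.restrict (Set.Ioc 0 1)).prod (σ.restrict (ball 0 (N + ρ))))) :=
    hΞ.integrable_pot hg hg1
      ((ae_prod_fst_mem _ measurableSet_Ioc _).mono fun a ha => ha.1)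
  exact h1.integrableOn.congr_fun (fun z hz => hΞ.pot_restrict_ball σ hz) measurableSet_ball

theorem IsBoundedKernel.avg_eq_zero (hΞ : IsBoundedKernel Ξ C ρ) {h : Euc n → ℝ} {N : ℝ}
    (hN : ∀ x, h x ≠ 0 → ‖x‖ ≤ N) {t : ℝ} (ht : t ∈ Set.Ioc (0 : ℝ) 1) {y : Euc n}
    (hy : N + ρ ≤ ‖y‖) : avg Ξ t h y = 0 := by
  rw [avg_apply]
  refine integral_eq_zero_of_ae (Eventually.of_forall fun x => ?_)
  simp only [Pi.zero_apply, mul_eq_zero]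
  by_contra! h0
  have h1 := hΞ.lt x h0.1
  have h2 := hN _ h0.2
  have h3 := norm_sub_norm_le y (t • x)
  rw [norm_smul, Real.norm_of_nonneg ht.1.le] at h3
  nlinarith [ht.2, norm_nonneg x]

theorem IsBoundedKernel.integral_pot_mul_of_locallyFinite (hΞ : IsBoundedKernel Ξ C ρ)
    (hg : Measurable g) (hg1 : ∀ y, ‖g y‖ ≤ 1) (σ : Measure (Euc n)) [IsLocallyFiniteMeasure σ]
    {h : Euc n → ℝ} (hh : IsTestFun n h) :
    ∫ z, pot Ξ g ((volume.restrict (Set.Ioc 0 1)).prod σ) z * h z =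
      ∫ y, g y * (∫ t in Set.Ioc 0 1, avg Ξ t h y) ∂σ := by
  obtain ⟨R, hR0, hR⟩ := hh.exists_support_subset
  have hfin : IsFiniteMeasure (σ.restrict (ball (0 : Euc n) (R + 1 + ρ))) :=
    isFiniteMeasure_restrict.2 measure_ball_lt_top.ne
  obtain ⟨h1, h2⟩ := hΞ.integral_pot_mul hg hg1
    (ν := (volume.restrict (Set.Ioc 0 1)).prod (σ.restrict (ball (0 : Euc n) (R + 1 + ρ))))
    ((ae_prod_fst_mem _ measurableSet_Ioc _).mono fun a ha => ha.1) hh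
  have h3 : ∀ z, pot Ξ g ((volume.restrict (Set.Ioc 0 1)).prod σ) z * h z =
      pot Ξ g ((volume.restrict (Set.Ioc 0 1)).prod (σ.restrict (ball (0 : Euc n) (R + 1 + ρ)))) z
        * h z := by
    intro z
    by_cases hz : h z = 0
    · simp [hz]
    · rw [hΞ.pot_restrict_ball σ]
      have := hR z hz
      rw [mem_ball_zero_iff]
      linarith
  simp only [h3]
  rw [h2, integral_prod_symm _ h1]
  simp only [integral_const_mul]
  refine setIntegral_eq_integral_of_forall_compl_eq_zero fun y hy => ?_
  rw [mem_ball_zero_iff, not_lt] at hy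
  rw [setIntegral_eq_zero_of_forall_eq_zero, mul_zero]
  exact fun t ht => hΞ.avg_eq_zero hR ht (by linarith)

theorem integral_avg_one_mul {ψ h w : Euc n → ℝ} (hψ : IsTestFun n ψ) (hh : IsTestFun n h)
    (hw : LocallyIntegrable w) :
    ∫ y, avg ψ 1 h y * w y = ∫ z, h z * tconv (fun x => ψ (-x)) w z := by
  obtain ⟨R, hR0, hR⟩ := hψ.exists_support_subset
  obtain ⟨S, hS0, hS⟩ := hh.exists_support_subset
  obtain ⟨B, hB0, hB⟩ := hψ.exists_bound
  set wb : Euc n → ℝ := (closedBall (0 : Euc n) (R + S)).indicator w with hwb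
  have hwbi : Integrable wb :=
    (hw.integrableOn_isCompact (isCompact_closedBall _ _)).integrable_indicator
      measurableSet_closedBall
  have hprod : Integrable (fun a : Euc n × Euc n => ψ (a.1 - a.2) * (wb a.1 * h a.2))
      (volume.prod volume) :=
    (hwbi.mul_prod hh.integrable).bdd_mul (c := B)
      (hψ.continuous.comp (continuous_fst.sub continuous_snd)).aestronglyMeasurable
      (Eventually.of_forall fun a => hB _)
  have key : ∀ y z, ψ (y - z) * (wb y * h z) = ψ (y - z) * (w y * h z) := by
    intro y z
    by_cases h1 : ψ (y - z) = 0
    · simp [h1]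
    by_cases h2 : h z = 0
    · simp [h2]
    have h3 := hR _ h1
    have h4 := hS _ h2
    have h5 := norm_sub_norm_le y z
    rw [hwb, Set.indicator_of_mem]
    rw [mem_closedBall_zero_iff]
    linarith
  have hswap := integral_integral_swap (f := fun y z => ψ (y - z) * (wb y * h z)) hprod
  simp only [key] at hswap
  have e1 : ∀ y, ∫ z, ψ (y - z) * (w y * h z) = avg ψ 1 h y * w y := by
    intro y
    rw [avg_apply, ← integral_sub_left_eq_self (fun x => ψ x * h (y - (1 : ℝ) • x)) volume y,
      ← integral_mul_const]
    congr 1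
    ext z
    simp
    ring
  have e2 : ∀ z, ∫ y, ψ (y - z) * (w y * h z) = h z * tconv (fun x => ψ (-x)) w z := by
    intro z
    rw [tconv, ← integral_const_mul]
    congr 1
    ext y
    simp
    ring
  simpa only [e1, e2] using hswap

end LocalPotential

noncomputable section ScalarDerivative

variable {n k : ℕ} {V W : Type*}
  [NormedAddCommGroup V] [InnerProductSpace ℝ V] [FiniteDimensional ℝ V]
  [NormedAddCommGroup W] [InnerProductSpace ℝ W] [FiniteDimensional ℝ W]
  {ι κ : Type*} [Fintype ι] [DecidableEq ι] [Fintype κ] [DecidableEq κ]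

theorem exists_measurable_bounded_version {σ : Measure (Euc n)} {f : Euc n → ℝ}
    (hf : AEStronglyMeasurable f σ) (hf1 : ∀ᵐ x ∂σ, ‖f x‖ ≤ 1) :
    ∃ g : Euc n → ℝ, Measurable g ∧ (∀ y, ‖g y‖ ≤ 1) ∧ g =ᵐ[σ] f := by
  refine ⟨fun y => max (-1) (min 1 (hf.mk f y)), ?_, fun y => ?_, ?_⟩
  · have := hf.stronglyMeasurable_mk.measurable
    fun_prop
  · rw [Real.norm_eq_abs, abs_le]
    exact ⟨le_max_left _ _, max_le (by norm_num) (min_le_left _ _)⟩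
  · filter_upwards [hf.ae_eq_mk, hf1] with x hx hx1
    rw [Real.norm_eq_abs, abs_le] at hx1
    rw [← hx, min_eq_right hx1.2, max_eq_right hx1.1]

theorem exists_scalar_weakDeriv {A : CoeffOp n k V W} (hell : IsElliptic n k A) (hk : 1 ≤ k)
    {u : Euc n → V} {σ : Measure (Euc n)} {f : Euc n → W} (hu : LocallyIntegrable u volume)
    [IsLocallyFiniteMeasure σ] (hf : LocallyIntegrable f σ) (hf1 : ∀ᵐ x ∂σ, ‖f x‖ = 1)
    (hAu : HasDistribA n k A u σ f) {p : ℝ} (hp : 1 ≤ p) (hp2 : p * ((n : ℝ) - 1) < n)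
    (bV : OrthonormalBasis ι ℝ V) (bW : OrthonormalBasis κ ℝ W) (i₀ : ι)
    (J : Fin (k - 1) → Fin n) :
    ∃ v : Euc n → ℝ, LocallyIntegrable v volume ∧
      (∀ h : Euc n → ℝ, IsTestFun n h →
        ∫ x, dop (∏ i, MvPolynomial.X (J i)) h x * ⟪bV i₀, u x⟫ = ∫ x, h x * v x) ∧
      ∀ᵐ x, ∃ T, LpDiffAt p v x T := by
  obtain ⟨l, Q, P, hl, hQ, hQell, hP, hPQ⟩ := exists_elliptic_inverse hell hk bV bW i₀
  obtain ⟨m, hm⟩ : ∃ m, m = l + (k - 1) := ⟨_, rfl⟩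
  have hkm : k + l = m + 1 := by omega
  rw [hkm] at hQ
  obtain ⟨M, φ, hK⟩ := exists_isKernelPair hQ hQell
  set qJ : MvPolynomial (Fin n) ℝ := ∏ i, MvPolynomial.X (J i) with hqJ
  have hqJh : qJ.IsHomogeneous (k - 1) := isHomogeneous_prod_X J
  have hq : ∀ j, (P j * qJ).IsHomogeneous m := fun j => hm ▸ (hP j).mul hqJh
  have hg : ∀ j, ∃ g : Euc n → ℝ, Measurable g ∧ (∀ y, ‖g y‖ ≤ 1) ∧
      g =ᵐ[σ] fun x => ⟪bW j, f x⟫ := fun j => by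
    refine exists_measurable_bounded_version (hf.aestronglyMeasurable.const_inner) ?_
    filter_upwards [hf1] with x hx
    refine (norm_inner_le_norm _ _).trans ?_
    rw [hx, bW.orthonormal.1 j, one_mul]
  choose g hgm hg1 hgf using hg
  have hU : LocallyIntegrable (fun x => ⟪bV i₀, u x⟫) := fun x =>
    (hu x).imp fun s hs => ⟨hs.1, Integrable.const_inner (𝕜 := ℝ) _ hs.2⟩
  set w : κ → Euc n → ℝ := fun j =>
    pot (dop (P j * qJ) M) (g j) ((volume.restrict (Set.Ioc 0 1)).prod σ) with hw
  have hwl : ∀ j, LocallyIntegrable (w j) := fun j => by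
    obtain ⟨C, ρ, hΞ⟩ := (hK.hM.dop (P j * qJ)).exists_isBoundedKernel
    exact hΞ.locallyIntegrable_pot (hgm j) (hg1 j) σ
  have hψ : IsTestFun n fun x => dop qJ φ (-x) := by
    simpa using (hK.hφ.dop qJ).comp_sub 0
  set s : Euc n → ℝ := tconv (fun x => dop qJ φ (-x)) fun x => ⟪bV i₀, u x⟫ with hs
  have hsc : ContDiff ℝ ∞ s := contDiff_tconv hψ hU
  have hsl : LocallyIntegrable s := hsc.continuous.locallyIntegrable
  have hwsum : LocallyIntegrable (∑ j, w j) :=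
    Finset.sum_induction w (fun w => LocallyIntegrable w) (fun a b ha hb => ha.add hb)
      (locallyIntegrable_zero) fun j _ => hwl j
  have hwsum' : LocallyIntegrable fun x => (-1 : ℝ) ^ k * (∑ j, w j) x := hwsum.smul ((-1 : ℝ) ^ k)
  refine ⟨s + fun x => (-1 : ℝ) ^ k * (∑ j, w j) x, hsl.add hwsum', fun h hh => ?_, ?_⟩
  · have hh1 := hh.dop qJ
    have h1 := integral_inner_dop_eq hu hf hAu bV bW hPQ (isTestFun_eop hK.hM hh1 m 1)
    rw [hK.dop_eop_one hQ hh1] at h1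
    have e1 : ∀ y, avg φ 1 (dop qJ h) y = avg (dop qJ φ) 1 h y :=
      avg_one_dop hqJh hK.hφ hh
    have i1 : Integrable fun x => dop qJ h x * ⟪bV i₀, u x⟫ :=
      integrable_locallyIntegrable_mul hU hh1
    have i2 : Integrable fun x => avg (dop qJ φ) 1 h x * ⟪bV i₀, u x⟫ :=
      integrable_locallyIntegrable_mul hU (isTestFun_avg (hK.hφ.dop qJ) hh 1)
    simp only [Pi.sub_apply, e1, sub_mul] at h1
    rw [integral_sub i1 i2, sub_eq_iff_eq_add, integral_avg_one_mul (hK.hφ.dop qJ) hh hU] at h1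
    have e2 : ∀ j, ∫ x, dop (P j) (eop M m 1 (dop qJ h)) x * ⟪bW j, f x⟫ ∂σ =
        ∫ x, h x * w j x := by
      intro j
      obtain ⟨C, ρ, hΞ⟩ := (hK.hM.dop (P j * qJ)).exists_isBoundedKernel
      have h2 := hΞ.integral_pot_mul_of_locallyFinite (hgm j) (hg1 j) σ hh
      simp only [hw, mul_comm (h _)]
      rw [h2, dop_eop hK.hM hh1, ← dop_mul _ _ hh.contDiff]
      refine integral_congr_ae ?_
      filter_upwards [hgf j] with x hx
      rw [eop_dop_eq (hq j) hK.hM hh, ← hx, mul_comm]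
    simp only [e2] at h1
    rw [h1]
    have i3 : Integrable fun x => h x * s x := integrable_locallyIntegrable_mul hsl hh
    have i4 : ∀ j, Integrable fun x => h x * w j x := fun j =>
      integrable_locallyIntegrable_mul (hwl j) hh
    have i5 : Integrable fun x => h x * ((-1 : ℝ) ^ k * (∑ j, w j) x) :=
      integrable_locallyIntegrable_mul hwsum' hh
    simp only [Pi.add_apply, mul_add]
    rw [integral_add i3 i5, add_comm]
    congr 1
    rw [← integral_finsetSum _ fun j _ => i4 j, ← integral_const_mul]
    congr 1
    ext x
    rw [Finset.sum_apply, Finset.mul_sum, Finset.mul_sum, Finset.mul_sum]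
    exact Finset.sum_congr rfl fun j _ => by ring
  · have h1 : ∀ᵐ x, ∀ j, ∃ T, LpDiffAt p (w j) x T := ae_all_iff.2 fun j =>
      hK.ae_lpDiffAt_pot hp hp2 hQ hQell (hq j) (hgm j) (hg1 j) σ
    filter_upwards [h1, ae_lpDiffAt_of_contDiff hp hp2 hsc] with x hx hxs
    choose T hT using hx
    exact ⟨_, hxs.add hp ((LpDiffAt.sum hp Finset.univ hT
      fun j => (hwl j).aestronglyMeasurable).const_mul _) hsl.aestronglyMeasurable
      hwsum'.aestronglyMeasurable⟩

end ScalarDerivative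

noncomputable section Blowup

variable {n : ℕ} {η : Euc n → ℝ} {C : ℝ}

theorem IsBoundedKernel.enorm_integral_scaledKer_mul_le (hη : IsBoundedKernel η C 1)
    (μ : Measure (Euc n)) (F : Euc n → ℝ) (x : Euc n) {r : ℝ} (hr : 0 < r) :
    ‖∫ y, scaledKer η x (r, y) * F y ∂μ‖ₑ ≤
      ENNReal.ofReal C * ((∫⁻ y in ball x r, ‖F y‖ₑ ∂μ) / ENNReal.ofReal (r ^ n)) := by
  refine (enorm_integral_le_lintegral_enorm _).trans ?_
  have h1 : ∀ y, ‖scaledKer η x (r, y) * F y‖ₑ ≤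
      (ball x r).indicator (fun y => (ENNReal.ofReal C * ENNReal.ofReal (r⁻¹ ^ n)) * ‖F y‖ₑ) y := by
    intro y
    have h2 := hη.enorm_scaledKer_le x (a := (r, y)) hr
    rw [coneKer] at h2
    by_cases hy : y ∈ ball x r
    · rw [Set.indicator_of_mem (by simpa [dist_comm] using hy)] at h2
      rw [Set.indicator_of_mem hy, enorm_mul]
      exact mul_le_mul_left h2 _
    · rw [Set.indicator_of_notMem (by simpa [dist_comm] using hy), mul_zero, nonpos_iff_eq_zero,
        enorm_eq_zero] at h2
      simp [h2]
  refine (lintegral_mono h1).trans ?_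
  rw [lintegral_indicator measurableSet_ball, lintegral_const_mul' _ _ (by finiteness), inv_pow,
    ENNReal.ofReal_inv_of_pos (by positivity), mul_assoc, div_eq_mul_inv, mul_comm (∫⁻ _ in _, _ ∂_)]

theorem integral_scaledKer_right (η : Euc n → ℝ) (x : Euc n) {r : ℝ} (hr : 0 < r) :
    ∫ y, scaledKer η x (r, y) = ∫ z, η z := by
  simp only [scaledKer]
  rw [integral_const_mul, integral_sub_right_eq_self (fun y => η (r⁻¹ • y)) x,
    Measure.integral_comp_inv_smul, finrank_euclideanSpace, Fintype.card_fin,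
    abs_of_pos (by positivity), smul_eq_mul, ← mul_assoc, inv_pow,
    inv_mul_cancel₀ (by positivity), one_mul]

theorem isTestFun_scaledKer (hη : IsTestFun n η) (x : Euc n) (r : ℝ) (hr : 0 < r) :
    IsTestFun n fun y => scaledKer η x (r, y) := by
  obtain ⟨R, hR, hs⟩ := hη.exists_support_subset
  refine isTestFun_of_support (R := r * R + ‖x‖) ?_ fun y hy => ?_
  · have h1 : ContDiff ℝ ∞ fun y : Euc n => r⁻¹ • (y - x) :=
      (contDiff_id.sub contDiff_const).const_smul r⁻¹
    exact (contDiff_const (c := r⁻¹ ^ n)).mul (hη.contDiff.comp h1)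
  · have h1 := hs _ (right_ne_zero_of_mul hy)
    rw [norm_smul, Real.norm_of_nonneg (by positivity), inv_mul_le_iff₀ hr] at h1
    have h2 := norm_sub_norm_le y x
    simp only at h1
    linarith

theorem dop_X_scaledKer (hη : IsTestFun n η) (b : Fin n) (x : Euc n) (r : ℝ) (y : Euc n) :
    dop (MvPolynomial.X b) (fun y => scaledKer η x (r, y)) y =
      r⁻¹ * scaledKer (dop (MvPolynomial.X b) η) x (r, y) := by
  have h1 : (fun y => scaledKer η x (r, y)) =
      (r⁻¹ ^ n) • fun y => η ((-(r⁻¹ • x)) + r⁻¹ • y) := by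
    ext y
    simp only [scaledKer, Pi.smul_apply, smul_eq_mul]
    congr 2
    rw [smul_sub]
    abel
  have h2 : ContDiff ℝ ∞ fun y => η ((-(r⁻¹ • x)) + r⁻¹ • y) :=
    contDiff_comp_affine _ _ hη.contDiff
  rw [h1, dop_smul _ _ h2, dop_comp_affine _ (MvPolynomial.isHomogeneous_X ℝ b) _ _ hη.contDiff]
  simp only [scaledKer, Pi.smul_apply, smul_eq_mul, pow_one]
  rw [show -(r⁻¹ • x) + r⁻¹ • y = r⁻¹ • (y - x) by rw [smul_sub]; abel]
  ring

theorem tendsto_integral_scaledKer_of_enorm (hη : IsBoundedKernel η C 1) (μ : Measure (Euc n))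
    (F : Euc n → ℝ) (x : Euc n)
    (h : Tendsto (fun r => (∫⁻ y in ball x r, ‖F y‖ₑ ∂μ) / ENNReal.ofReal (r ^ n))
      (𝓝[>] (0 : ℝ)) (𝓝 0)) :
    Tendsto (fun r => ∫ y, scaledKer η x (r, y) * F y ∂μ) (𝓝[>] (0 : ℝ)) (𝓝 0) := by
  rw [tendsto_iff_enorm_sub_tendsto_zero]
  simp only [sub_zero]
  have h1 := ENNReal.Tendsto.const_mul (a := ENNReal.ofReal C) h (Or.inr ENNReal.ofReal_ne_top)
  rw [mul_zero] at h1
  refine tendsto_of_tendsto_of_tendsto_of_le_of_le' tendsto_const_nhds h1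
    (Eventually.of_forall fun _ => zero_le) ?_
  filter_upwards [self_mem_nhdsWithin] with r hr
  exact hη.enorm_integral_scaledKer_mul_le μ F x hr

theorem integrable_scaledKer_mul (hη : IsTestFun n η) {μ : Measure (Euc n)} {F : Euc n → ℝ}
    (hF : LocallyIntegrable F μ) (x : Euc n) {r : ℝ} (hr : 0 < r) :
    Integrable (fun y => scaledKer η x (r, y) * F y) μ :=
  integrable_locallyIntegrable_mul hF (isTestFun_scaledKer hη x r hr)

theorem ae_tendsto_integral_scaledKer_volume (hη : IsBoundedKernel η C 1) {F : Euc n → ℝ}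
    (hF : LocallyIntegrable F) :
    ∀ᵐ x, Tendsto (fun r => ∫ y, scaledKer η x (r, y) * F y) (𝓝[>] (0 : ℝ))
      (𝓝 (F x * ∫ z, η z)) := by
  filter_upwards [ae_tendsto_lebesgue hF] with x hx
  have h1 := (tendsto_integral_scaledKer_of_enorm hη volume (fun y => F y - F x) x hx).add_const
    (F x * ∫ z, η z)
  rw [zero_add] at h1
  refine h1.congr' ?_
  filter_upwards [self_mem_nhdsWithin] with r hr
  simp only [mul_sub]
  rw [integral_sub (integrable_scaledKer_mul hη.isTestFun hF x hr)
    (integrable_scaledKer_mul hη.isTestFun (locallyIntegrable_const (F x)) x hr), integral_mul_const,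
    integral_scaledKer_right _ _ hr]
  ring

theorem ae_tendsto_integral_scaledKer (hη : IsBoundedKernel η C 1) (σ : Measure (Euc n))
    [IsLocallyFiniteMeasure σ] {g : Euc n → ℝ} (hg : LocallyIntegrable g σ)
    (hg1 : ∀ᵐ y ∂σ, ‖g y‖ ≤ 1) :
    ∀ᵐ x, Tendsto (fun r => ∫ y, scaledKer η x (r, y) * g y ∂σ) (𝓝[>] (0 : ℝ))
      (𝓝 ((σ.rnDeriv volume x).toReal * g x * ∫ z, η z)) := by
  have hdec := σ.haveLebesgueDecomposition_add volume
  have hls : σ.singularPart volume ≤ σ := σ.singularPart_le volume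
  have hla : (volume : Measure (Euc n)).withDensity (σ.rnDeriv volume) ≤ σ :=
    σ.withDensity_rnDeriv_le volume
  have hm := σ.measurable_rnDeriv (volume : Measure (Euc n))
  have hlt := σ.rnDeriv_lt_top (volume : Measure (Euc n))
  have hG : LocallyIntegrable fun y => (σ.rnDeriv volume y).toReal * g y := by
    intro x
    obtain ⟨s, hs, hsg⟩ := hg x
    obtain ⟨t, hts, hto, hxt⟩ := _root_.mem_nhds_iff.1 hs
    refine ⟨t, hto.mem_nhds hxt, ?_⟩
    have h1 : Integrable g ((volume.withDensity (σ.rnDeriv volume)).restrict t) :=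
      (hsg.mono_set hts).mono_measure hla
    rw [restrict_withDensity hto.measurableSet] at h1
    exact (integrable_withDensity_iff_integrable_smul' hm (ae_restrict_of_ae hlt)).1 h1
  obtain ⟨K, hK, hK0, hK1⟩ := σ.mutuallySingular_singularPart (volume : Measure (Euc n))
  have hfin : IsLocallyFiniteMeasure (σ.singularPart volume) :=
    Measure.isLocallyFiniteMeasure_of_le hls
  have hKv : ∀ᵐ x, x ∈ K := hK1
  filter_upwards [ae_tendsto_integral_scaledKer_volume hη hG, hKv,
    ae_tendsto_measure_ball_of_null (σ.singularPart volume) hK hK0 one_pos] with x h1 hxK h2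
  have h3 := h2 hxK
  simp only [one_mul] at h3
  have h4 : Tendsto (fun r => (∫⁻ y in ball x r, ‖g y‖ₑ ∂(σ.singularPart volume)) /
      ENNReal.ofReal (r ^ n)) (𝓝[>] (0 : ℝ)) (𝓝 0) := by
    refine tendsto_of_tendsto_of_tendsto_of_le_of_le tendsto_const_nhds h3
      (fun _ => zero_le) fun r => ENNReal.div_le_div_right ?_ _
    refine (lintegral_mono_ae (g := fun _ => 1) ?_).trans (by simp)
    refine ae_restrict_of_ae ?_
    filter_upwards [hls.absolutelyContinuous.ae_le hg1] with y hy
    rw [← ofReal_norm]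
    exact ENNReal.ofReal_le_one.2 hy
  have h5 := (tendsto_integral_scaledKer_of_enorm hη (σ.singularPart volume) g x h4).add h1
  rw [zero_add] at h5
  refine h5.congr' ?_
  filter_upwards [self_mem_nhdsWithin] with r hr
  have hi := integrable_scaledKer_mul hη.isTestFun hg x hr
  conv_rhs => rw [hdec]
  rw [integral_add_measure (hi.mono_measure hls) (hi.mono_measure hla),
    integral_withDensity_eq_integral_toReal_smul hm hlt]
  congr 1
  refine integral_congr_ae (Eventually.of_forall fun y => ?_)
  simp only [smul_eq_mul]
  ring

end Blowup

noncomputable section ApproxGradient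

variable {n : ℕ} {η : Euc n → ℝ} {C p : ℝ}

theorem LpDiffAt.exists_tendsto_lintegral (hp : 1 ≤ p) {w : Euc n → ℝ} {x : Euc n} {T : Fin n → ℝ}
    (h : LpDiffAt p w x T) (hw : AEStronglyMeasurable w volume) :
    ∃ c, Tendsto (fun r => (∫⁻ y in ball x r, ‖w y - (c + ∑ b, (y b - x b) * T b)‖ₑ) /
      ENNReal.ofReal (r ^ (n + 1))) (𝓝[>] (0 : ℝ)) (𝓝 0) := by
  obtain ⟨c, hc⟩ := h
  have hp0 : 0 < p := by linarith
  have hp1 : 0 ≤ 1 - 1 / p := by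
    rw [sub_nonneg, div_le_one hp0]
    exact hp
  have hV := (toReal_volume_ball_pos (n := n)).le
  refine ⟨c, tendsto_div_ofReal_of_le (fun r hr => pow_pos hr _)
    (K := ENNReal.ofReal ((volume (ball (0 : Euc n) 1)).toReal ^ (1 - 1 / p)))
    ENNReal.ofReal_ne_top fun ε hε => ?_⟩
  filter_upwards [eventually_le_of_tendsto_div (fun r hr => Real.rpow_pos_of_pos hr _) hc hε,
    self_mem_nhdsWithin] with r hr hr0
  have hr0 : 0 < r := hr0
  have h1 := eLpNorm_le_eLpNorm_mul_rpow_measure_univ (p := 1) (q := ENNReal.ofReal p)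
    (μ := volume.restrict (ball x r)) (ENNReal.one_le_ofReal.2 hp)
    (hw.sub (continuous_affine c x T).aestronglyMeasurable).restrict
  rw [eLpNorm_one_eq_lintegral_enorm, Measure.restrict_apply_univ, ENNReal.toReal_one,
    ENNReal.toReal_ofReal hp0.le, div_one, volume_ball_euc_ofReal x hr0,
    ENNReal.ofReal_rpow_of_nonneg (by positivity) hp1, Real.mul_rpow (by positivity) hV] at h1
  refine h1.trans ((mul_le_mul_left hr _).trans ?_)
  rw [← ENNReal.ofReal_mul (by positivity), ← ENNReal.ofReal_mul (by positivity)]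
  refine ENNReal.ofReal_le_ofReal (le_of_eq ?_)
  have h2 : r ^ (1 + (n : ℝ) / p) * (r ^ n) ^ (1 - 1 / p) = r ^ (n + 1) := by
    rw [← Real.rpow_natCast r n, ← Real.rpow_mul hr0.le, ← Real.rpow_add hr0,
      ← Real.rpow_natCast r (n + 1)]
    congr 1
    push_cast
    ring
  rw [← h2]
  ring

theorem LpDiffAt.tendsto_integral_dop (hp : 1 ≤ p) {w : Euc n → ℝ} {x : Euc n} {T : Fin n → ℝ}
    (h : LpDiffAt p w x T) (hw : LocallyIntegrable w) (hη : IsTestFun n η) (b : Fin n)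
    (hη' : IsBoundedKernel (dop (MvPolynomial.X b) η) C 1) :
    Tendsto (fun r => ∫ y, dop (MvPolynomial.X b) (fun y => scaledKer η x (r, y)) y * w y)
      (𝓝[>] (0 : ℝ)) (𝓝 (-(T b * ∫ z, η z))) := by
  obtain ⟨c, hc⟩ := h.exists_tendsto_lintegral hp hw.aestronglyMeasurable
  set P : Euc n → ℝ := fun y => c + ∑ b, (y b - x b) * T b with hP
  have hPc : ContDiff ℝ ∞ P := contDiff_affine c x T
  have hPl : LocallyIntegrable P := hPc.continuous.locallyIntegrable
  have h1 : Tendsto (fun r => r⁻¹ * ∫ y, scaledKer (dop (MvPolynomial.X b) η) x (r, y) *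
      (w y - P y)) (𝓝[>] (0 : ℝ)) (𝓝 0) := by
    rw [tendsto_iff_enorm_sub_tendsto_zero]
    simp only [sub_zero]
    have h2 := ENNReal.Tendsto.const_mul (a := ENNReal.ofReal C) hc (Or.inr ENNReal.ofReal_ne_top)
    rw [mul_zero] at h2
    refine tendsto_of_tendsto_of_tendsto_of_le_of_le' tendsto_const_nhds h2
      (Eventually.of_forall fun _ => zero_le) ?_
    filter_upwards [self_mem_nhdsWithin] with r hr
    have hr : 0 < r := hr
    rw [enorm_mul, ← ofReal_norm, Real.norm_of_nonneg (by positivity)]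
    refine (mul_le_mul_right (hη'.enorm_integral_scaledKer_mul_le volume _ x hr) _).trans ?_
    rw [ENNReal.ofReal_inv_of_pos hr, pow_succ, ENNReal.ofReal_mul (by positivity),
      div_eq_mul_inv, div_eq_mul_inv, ENNReal.mul_inv (by simp) (by simp)]
    exact le_of_eq (by ring)
  have h3 := h1.sub_const (T b * ∫ z, η z)
  rw [zero_sub] at h3
  refine h3.congr' ?_
  filter_upwards [self_mem_nhdsWithin] with r hr
  have hs := isTestFun_scaledKer hη x r hr
  have h4 := integral_dop_mul (MvPolynomial.isHomogeneous_X ℝ b) hs hPc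
  rw [dop_X b hPc] at h4
  simp only [hP, fderiv_affine, integral_mul_const, integral_scaledKer_right η x hr] at h4
  have h5 : ∫ y, dop (MvPolynomial.X b) (fun y => scaledKer η x (r, y)) y * (w y - P y) =
      r⁻¹ * ∫ y, scaledKer (dop (MvPolynomial.X b) η) x (r, y) * (w y - P y) := by
    rw [← integral_const_mul]
    congr 1
    ext y
    rw [dop_X_scaledKer hη]
    ring
  rw [← h5]
  simp only [mul_sub]
  have i1 : Integrable fun y => dop (MvPolynomial.X b) (fun y => scaledKer η x (r, y)) y * w y :=
    integrable_locallyIntegrable_mul hw (hs.dop _)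
  have i2 : Integrable fun y => dop (MvPolynomial.X b) (fun y => scaledKer η x (r, y)) y * P y :=
    integrable_locallyIntegrable_mul hPl (hs.dop _)
  rw [integral_sub i1 i2, h4]
  ring

theorem exists_bump_kernel (n : ℕ) : ∃ η : Euc n → ℝ, (∃ C, IsBoundedKernel η C 1) ∧
    (∀ b, ∃ C, IsBoundedKernel (dop (MvPolynomial.X b) η) C 1) ∧ ∫ z, η z ≠ 0 := by
  let β : ContDiffBump (0 : Euc n) := ⟨1 / 4, 1 / 2, by norm_num, by norm_num⟩
  have hβ : IsTestFun n β := ⟨β.contDiff, β.hasCompactSupport⟩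
  have hker : ∀ f : Euc n → ℝ, IsTestFun n f → (∀ x, f x ≠ 0 → x ∈ tsupport β) →
      ∃ C, IsBoundedKernel f C 1 := by
    intro f hf hs
    obtain ⟨C, hC0, hC⟩ := hf.exists_bound
    refine ⟨C, hf, hC0, one_pos, hC, fun x hx => ?_⟩
    have h1 := hs x hx
    rw [β.tsupport_eq, mem_closedBall_zero_iff] at h1
    exact h1.trans_lt (by norm_num)
  refine ⟨β, hker β hβ fun x hx => subset_tsupport _ hx, fun b => hker _ (hβ.dop _) fun x hx =>
    tsupport_dop_subset _ β.contDiff (subset_tsupport _ hx), β.integral_pos.ne'⟩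

theorem ae_sum_approxGradient_eq (hp : 1 ≤ p) (σ : Measure (Euc n)) [IsLocallyFiniteMeasure σ]
    {g : Euc n → ℝ} (hg : LocallyIntegrable g σ) (hg1 : ∀ᵐ y ∂σ, ‖g y‖ ≤ 1)
    {ι : Type*} [Fintype ι] (a : ι → ℝ) (b : ι → Fin n) {w : ι → Euc n → ℝ}
    (hw : ∀ s, LocallyIntegrable (w s))
    (hid : ∀ h : Euc n → ℝ, IsTestFun n h →
      -∑ s, a s * ∫ y, dop (MvPolynomial.X (b s)) h y * w s y = ∫ y, h y * g y ∂σ) :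
    ∀ᵐ x, ∀ T : ι → Fin n → ℝ, (∀ s, LpDiffAt p (w s) x (T s)) →
      ∑ s, a s * T s (b s) = (σ.rnDeriv volume x).toReal * g x := by
  obtain ⟨η, ⟨C, hη⟩, hη', hη0⟩ := exists_bump_kernel n
  filter_upwards [ae_tendsto_integral_scaledKer hη σ hg hg1] with x hx T hT
  have h1 : ∀ s, Tendsto (fun r => ∫ y, dop (MvPolynomial.X (b s))
      (fun y => scaledKer η x (r, y)) y * w s y) (𝓝[>] (0 : ℝ)) (𝓝 (-(T s (b s) * ∫ z, η z))) :=
    fun s => by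
      obtain ⟨C', hC'⟩ := hη' (b s)
      exact (hT s).tendsto_integral_dop hp (hw s) hη.isTestFun (b s) hC'
  have h2 := (tendsto_finsetSum Finset.univ fun s _ => (h1 s).const_mul (a s)).neg
  have h3 := tendsto_nhds_unique (hx.congr' ?_) h2
  · refine mul_right_cancel₀ hη0 ?_
    rw [h3, Finset.sum_mul, ← Finset.sum_neg_distrib]
    exact Finset.sum_congr rfl fun s _ => by ring
  · filter_upwards [self_mem_nhdsWithin] with r hr
    exact (hid _ (isTestFun_scaledKer hη.isTestFun x r hr)).symm

end ApproxGradient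

noncomputable section Assembly

variable {n k : ℕ} {V W : Type*}
  [NormedAddCommGroup V] [InnerProductSpace ℝ V] [FiniteDimensional ℝ V]
  [NormedAddCommGroup W] [InnerProductSpace ℝ W] [FiniteDimensional ℝ W]
  {ι κ : Type*} [Fintype ι] [Fintype κ]

/-- All but the last entry of a multi-index. -/
def initIdx (K : Fin k → Fin n) (i : Fin (k - 1)) : Fin n := K ⟨i, by omega⟩

/-- The last entry of a multi-index. -/
def lastIdx (hk : 1 ≤ k) (K : Fin k → Fin n) : Fin n := K ⟨k - 1, by omega⟩

theorem initIdx_snocIdx (I : Fin (k - 1) → Fin n) (b : Fin n) :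
    initIdx (snocIdx n k I b) = I := by
  ext i
  simp [initIdx, snocIdx]

theorem lastIdx_snocIdx (hk : 1 ≤ k) (I : Fin (k - 1) → Fin n) (b : Fin n) :
    lastIdx hk (snocIdx n k I b) = b := by
  simp [lastIdx, snocIdx]

theorem prod_X_eq_initIdx_mul_lastIdx (hk : 1 ≤ k) (K : Fin k → Fin n) :
    (∏ i, MvPolynomial.X (K i) : MvPolynomial (Fin n) ℝ) =
      (∏ i, MvPolynomial.X (initIdx K i)) * MvPolynomial.X (lastIdx hk K) := by
  obtain ⟨k, rfl⟩ := Nat.exists_eq_add_of_le' hk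
  exact Fin.prod_univ_castSucc _

theorem HasDistribA.sum_integral_dop {A : CoeffOp n k V W} {u : Euc n → V}
    {σ : Measure (Euc n)} {f : Euc n → W} (hu : LocallyIntegrable u volume)
    (hAu : HasDistribA n k A u σ f) (bV : OrthonormalBasis ι ℝ V) (w₀ : W)
    {h : Euc n → ℝ} (hh : IsTestFun n h) :
    (-1) ^ k * ∑ K : Fin k → Fin n, ∑ i, ⟪w₀, A K (bV i)⟫ *
      ∫ x, dop (∏ l, MvPolynomial.X (K l)) h x * ⟪bV i, u x⟫ = ∫ x, h x * ⟪w₀, f x⟫ ∂σ := by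
  let L : ℝ →L[ℝ] W := (ContinuousLinearMap.id ℝ ℝ).smulRight w₀
  have hL : IsTestFun n (fun x => L (h x)) :=
    ⟨L.contDiff.comp hh.contDiff, hh.2.comp_left (map_zero _)⟩
  have h1 := hAu _ hL
  have h2 : ∀ x, ⟪f x, L (h x)⟫ = h x * ⟪w₀, f x⟫ := fun x => by
    simp [L, inner_smul_right, real_inner_comm]
  simp only [h2] at h1
  rw [← h1]
  congr 1
  refine Finset.sum_congr rfl fun K _ => ?_
  have hU : ∀ i, LocallyIntegrable fun x => ⟪bV i, u x⟫ := fun i x =>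
    (hu x).imp fun s hs => ⟨hs.1, Integrable.const_inner (𝕜 := ℝ) _ hs.2⟩
  have hi : ∀ i, Integrable fun x => ⟪w₀, A K (bV i)⟫ *
      (dop (∏ l, MvPolynomial.X (K l)) h x * ⟪bV i, u x⟫) := fun i =>
    (integrable_locallyIntegrable_mul (hU i) (hh.dop _)).const_mul _
  simp only [← integral_const_mul]
  rw [← integral_finsetSum _ fun i _ => hi i]
  congr 1
  ext x
  rw [LinearMap.adjoint_inner_right, dirDeriv_eq_dop K hL.contDiff,
    dop_clm_comp L _ hh.contDiff]
  conv_rhs => rw [← bV.sum_repr' (u x)]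
  rw [map_sum, sum_inner]
  refine Finset.sum_congr rfl fun i _ => ?_
  simp only [L, map_smul, ContinuousLinearMap.smulRight_apply,
    ContinuousLinearMap.id_apply, inner_smul_right, real_inner_comm w₀]
  ring

theorem smallO_of_lpDiffAt {p : ℝ} (hp : 1 ≤ p) (bV : OrthonormalBasis ι ℝ V)
    {w : ι → Euc n → ℝ} {x : Euc n} {T : ι → Fin n → ℝ} (h : ∀ i, LpDiffAt p (w i) x (T i))
    (hw : ∀ i, AEStronglyMeasurable (w i) volume) :
    ∃ c : V, SmallO (fun r => ((volume (ball x r))⁻¹ *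
      ∫⁻ y in ball x r, (‖(∑ i, w i y • bV i) -
        (c + ∑ b : Fin n, (y b - x b) • ∑ i, T i b • bV i)‖₊ : ℝ≥0∞) ^ p) ^ (1 / p)) 1 := by
  choose c hc using h
  have hp0 : 0 < p := by linarith
  have hV := toReal_volume_ball_pos (n := n)
  set F : Euc n → V := fun y => (∑ i, w i y • bV i) -
        ((∑ i, c i • bV i) + ∑ b : Fin n, (y b - x b) • ∑ i, T i b • bV i) with hF
  have hFe : F = ∑ i, fun y => (w i y - (c i + ∑ b, (y b - x b) * T i b)) • bV i := by
    ext1 y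
    have e : ∑ b, (y b - x b) • ∑ i, T i b • bV i =
        ∑ i, (∑ b, (y b - x b) * T i b) • bV i := by
      simp only [Finset.smul_sum, Finset.sum_smul, mul_smul]
      rw [Finset.sum_comm]
    rw [Finset.sum_apply, hF]
    beta_reduce
    rw [e, ← Finset.sum_add_distrib, ← Finset.sum_sub_distrib]
    exact Finset.sum_congr rfl fun i _ => by rw [sub_smul, add_smul]
  have hm : ∀ i, AEStronglyMeasurable (fun y => w i y - (c i + ∑ b, (y b - x b) * T i b)) volume :=
    fun i => (hw i).sub (continuous_affine (c i) x (T i)).aestronglyMeasurable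
  have h1 : ∀ r, eLpNorm F (ENNReal.ofReal p) (volume.restrict (ball x r)) ≤
      ∑ i, eLpNorm (fun y => w i y - (c i + ∑ b, (y b - x b) * T i b)) (ENNReal.ofReal p)
        (volume.restrict (ball x r)) := by
    intro r
    rw [hFe]
    refine (eLpNorm_sum_le (fun i _ => ((hm i).smul_const (bV i)).restrict)
      (ENNReal.one_le_ofReal.2 hp)).trans (Finset.sum_le_sum fun i _ => ?_)
    refine eLpNorm_mono fun y => ?_
    rw [norm_smul, bV.orthonormal.1 i, mul_one]
  have h2 : Tendsto (fun r => eLpNorm F (ENNReal.ofReal p) (volume.restrict (ball x r)) /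
      ENNReal.ofReal (r ^ (1 + (n : ℝ) / p))) (𝓝[>] (0 : ℝ)) (𝓝 0) := by
    have h3 := tendsto_finsetSum Finset.univ fun i _ => hc i
    rw [Finset.sum_const_zero] at h3
    refine tendsto_of_tendsto_of_tendsto_of_le_of_le tendsto_const_nhds h3
      (fun _ => zero_le) fun r => ?_
    simp only [div_eq_mul_inv]
    rw [← Finset.sum_mul]
    exact mul_le_mul_left (h1 r) _
  refine ⟨∑ i, c i • bV i, ?_⟩
  refine tendsto_div_ofReal_of_le (fun r hr => Real.rpow_pos_of_pos hr _)
    (K := ENNReal.ofReal ((volume (ball (0 : Euc n) 1)).toReal⁻¹ ^ (1 / p)))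
    ENNReal.ofReal_ne_top fun ε hε => ?_
  filter_upwards [eventually_le_of_tendsto_div (fun r hr => Real.rpow_pos_of_pos hr _) h2 hε,
    self_mem_nhdsWithin] with r hr hr0
  have hr0 : 0 < r := hr0
  rw [eLpNorm_eq_lintegral_rpow_enorm_toReal (by simpa using hp0) ENNReal.ofReal_ne_top,
    ENNReal.toReal_ofReal hp0.le] at hr
  rw [ENNReal.mul_rpow_of_nonneg _ _ (by positivity), volume_ball_euc_ofReal x hr0,
    ← ENNReal.ofReal_inv_of_pos (by positivity),
    ENNReal.ofReal_rpow_of_nonneg (by positivity) (by positivity)]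
  refine (mul_le_mul_right hr _).trans ?_
  rw [← ENNReal.ofReal_mul (by positivity), ← ENNReal.ofReal_mul (by positivity)]
  refine ENNReal.ofReal_le_ofReal (le_of_eq ?_)
  rw [mul_inv, Real.mul_rpow (by positivity) (by positivity), Real.inv_rpow (by positivity),
    ← Real.rpow_natCast r n, ← Real.rpow_mul hr0.le, Real.rpow_add hr0, mul_one_div]
  have h4 : r ^ ((n : ℝ) / p) ≠ 0 := (Real.rpow_pos_of_pos hr0 _).ne'
  field_simp

end Assembly

noncomputable section AssemblyFinal

variable {n k : ℕ} {V W : Type*}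
  [NormedAddCommGroup V] [InnerProductSpace ℝ V] [FiniteDimensional ℝ V]
  [NormedAddCommGroup W] [InnerProductSpace ℝ W] [FiniteDimensional ℝ W]
  {ι κ : Type*} [Fintype ι] [Fintype κ]

theorem isWeakDerivFamily_of_coordinates {m : ℕ} {u : Euc n → V} (hu : LocallyIntegrable u volume)
    (bV : OrthonormalBasis ι ℝ V) {w : (Fin m → Fin n) → ι → Euc n → ℝ}
    (hw : ∀ J i, LocallyIntegrable (w J i) volume)
    (hid : ∀ J i, ∀ h : Euc n → ℝ, IsTestFun n h →
      ∫ x, dop (∏ l, MvPolynomial.X (J l)) h x * ⟪bV i, u x⟫ = (-1) ^ m * ∫ x, h x * w J i x) :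
    IsWeakDerivFamily n m u fun J x => ∑ i, w J i x • bV i := by
  have hwV : ∀ J i, LocallyIntegrable (fun x => w J i x • bV i) volume := fun J i x =>
    (hw J i x).imp fun s hs => ⟨hs.1, Integrable.smul_const hs.2 _⟩
  have hU : ∀ i, LocallyIntegrable fun x => ⟪bV i, u x⟫ := fun i x =>
    (hu x).imp fun s hs => ⟨hs.1, Integrable.const_inner (𝕜 := ℝ) _ hs.2⟩
  refine ⟨fun J => ?_, fun J h hh => ?_⟩
  · have h1 : LocallyIntegrable (∑ i, fun x => w J i x • bV i) volume :=
      Finset.sum_induction (fun i x => w J i x • bV i) (fun v => LocallyIntegrable v volume)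
        (fun _ _ ha hb => ha.add hb) (locallyIntegrable_zero) fun i _ => hwV J i
    convert h1 using 1
    ext1 x
    rw [Finset.sum_apply]
  · rw [dirDeriv_eq_dop J hh.contDiff]
    have h1 : ∀ x, dop (∏ l, MvPolynomial.X (J l)) h x • u x =
        ∑ i, (dop (∏ l, MvPolynomial.X (J l)) h x * ⟪bV i, u x⟫) • bV i := fun x => by
      conv_lhs => rw [← bV.sum_repr' (u x)]
      simp only [Finset.smul_sum, smul_smul]
    have h2 : ∀ x, h x • ∑ i, w J i x • bV i = ∑ i, (h x * w J i x) • bV i := fun x => by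
      simp only [Finset.smul_sum, smul_smul]
    simp only [h1, h2]
    have h3 : ∀ i, Integrable fun x =>
        (dop (∏ l, MvPolynomial.X (J l)) h x * ⟪bV i, u x⟫) • bV i := fun i =>
      (integrable_locallyIntegrable_mul (hU i) (hh.dop _)).smul_const _
    have h4 : ∀ i, Integrable fun x => (h x * w J i x) • bV i := fun i =>
      (integrable_locallyIntegrable_mul (hw J i) hh).smul_const _
    rw [integral_finsetSum _ fun i _ => h3 i, integral_finsetSum _ fun i _ => h4 i,
      Finset.smul_sum]
    refine Finset.sum_congr rfl fun i _ => ?_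
    rw [integral_smul_const, integral_smul_const, hid J i h hh, smul_smul]

theorem HasDistribA.sum_integral_dop_X {A : CoeffOp n k V W} (hk : 1 ≤ k) {u : Euc n → V}
    {σ : Measure (Euc n)} {f : Euc n → W} (hu : LocallyIntegrable u volume)
    (hAu : HasDistribA n k A u σ f) (bV : OrthonormalBasis ι ℝ V)
    {w : (Fin (k - 1) → Fin n) → ι → Euc n → ℝ}
    (hid : ∀ J i, ∀ h : Euc n → ℝ, IsTestFun n h →
      ∫ x, dop (∏ l, MvPolynomial.X (J l)) h x * ⟪bV i, u x⟫ =
        (-1) ^ (k - 1) * ∫ x, h x * w J i x)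
    (w₀ : W) {h : Euc n → ℝ} (hh : IsTestFun n h) :
    -∑ s : (Fin k → Fin n) × ι, ⟪w₀, A s.1 (bV s.2)⟫ *
      ∫ x, dop (MvPolynomial.X (lastIdx hk s.1)) h x * w (initIdx s.1) s.2 x =
        ∫ x, h x * ⟪w₀, f x⟫ ∂σ := by
  rw [← hAu.sum_integral_dop hu bV w₀ hh, Fintype.sum_prod_type, ← Finset.sum_neg_distrib,
    Finset.mul_sum]
  refine Finset.sum_congr rfl fun K _ => ?_
  rw [← Finset.sum_neg_distrib, Finset.mul_sum]
  refine Finset.sum_congr rfl fun i _ => ?_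
  rw [prod_X_eq_initIdx_mul_lastIdx hk, dop_mul _ _ hh.contDiff, hid _ _ _ (hh.dop _)]
  obtain ⟨j, rfl⟩ := Nat.exists_eq_add_of_le' hk
  have h1 : ((-1 : ℝ) ^ j) * (-1) ^ j = 1 := by rw [← mul_pow]; norm_num
  simp only [add_tsub_cancel_right, pow_succ]
  linear_combination (⟪w₀, A K (bV i)⟫ * ∫ x, dop (MvPolynomial.X (lastIdx hk K)) h x *
    w (initIdx K) i x) * h1

end AssemblyFinal

end Auxiliary

/-- Lemma 2.4: if `𝒜` is elliptic and `u ∈ BV^𝒜_loc` (with polar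
decomposition `𝒜 u = f σ`), then for a.e. `x` the weak derivative `D^{k-1} u` is
`L^p`-differentiable at `x` for `1 ≤ p < n/(n-1)`, with approximate gradient
`∇^k u(x) = T` satisfying `𝒜^{ac} u (x) = A(T)`. -/
theorem statement11 (n k : ℕ) (hn : 1 ≤ n) (hk : 1 ≤ k) {V W : Type*}
    [NormedAddCommGroup V] [InnerProductSpace ℝ V] [FiniteDimensional ℝ V]
    [NormedAddCommGroup W] [InnerProductSpace ℝ W] [FiniteDimensional ℝ W]
    (A : CoeffOp n k V W) (hA : IsSymmetricOp n k A) (hell : IsElliptic n k A)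
    (u : Euc n → V) (σ : Measure (Euc n)) (f : Euc n → W)
    (hu : LocallyIntegrable u volume) (hσ : IsLocallyFiniteMeasure σ)
    (hf : LocallyIntegrable f σ) (hf1 : ∀ᵐ x ∂σ, ‖f x‖ = 1)
    (hAu : HasDistribA n k A u σ f)
    (p : ℝ) (hp1 : 1 ≤ p) (hp2 : p * ((n : ℝ) - 1) < n) :
    ∃ v : (Fin (k - 1) → Fin n) → Euc n → V, IsWeakDerivFamily n (k - 1) u v ∧
      ∀ᵐ x ∂(volume : Measure (Euc n)), ∃ T : (Fin k → Fin n) → V,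
        (∀ I : Fin (k - 1) → Fin n, ∃ c : V,
          SmallO (fun r => ((volume (ball x r))⁻¹ *
            ∫⁻ y in ball x r,
              (‖v I y - (c + ∑ b : Fin n, (y b - x b) • T (snocIdx n k I b))‖₊ : ℝ≥0∞) ^ p) ^
                (1 / p)) 1) ∧
        (σ.rnDeriv volume x).toReal • f x = ∑ J : Fin k → Fin n, A J (T J) := by
  have := hσ
  let bV := stdOrthonormalBasis ℝ V
  let bW := stdOrthonormalBasis ℝ W
  choose v₀ hv₀ hv₀' hv₀'' using fun (J : Fin (k - 1) → Fin n) i =>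
    exists_scalar_weakDeriv hell hk hu hf hf1 hAu hp1 hp2 bV bW i J
  obtain ⟨w, rfl⟩ : ∃ w : (Fin (k - 1) → Fin n) → _ → Euc n → ℝ,
      v₀ = fun J i y => (-1) ^ (k - 1) * w J i y := by
    refine ⟨fun J i y => (-1) ^ (k - 1) * v₀ J i y, ?_⟩
    ext J i y
    rw [← mul_assoc, ← mul_pow]
    norm_num
  have hsq : (-1 : ℝ) ^ (k - 1) * (-1) ^ (k - 1) = 1 := by rw [← mul_pow]; norm_num
  have hwe : ∀ J i, w J i = fun y => (-1) ^ (k - 1) * ((-1) ^ (k - 1) * w J i y) := fun J i => by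
    ext y
    rw [← mul_assoc, hsq, one_mul]
  have hw : ∀ J i, LocallyIntegrable (w J i) volume := fun J i => by
    rw [hwe]
    exact fun x => (hv₀ J i x).imp fun s hs => ⟨hs.1, Integrable.const_mul hs.2 _⟩
  have hid : ∀ J i, ∀ h : Euc n → ℝ, IsTestFun n h →
      ∫ x, dop (∏ l, MvPolynomial.X (J l)) h x * ⟪bV i, u x⟫ =
        (-1) ^ (k - 1) * ∫ x, h x * w J i x := fun J i h hh => by
    rw [hv₀' J i h hh, ← integral_const_mul]
    exact integral_congr_ae (ae_of_all _ fun x => by ring)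
  refine ⟨_, isWeakDerivFamily_of_coordinates hu bV hw hid, ?_⟩
  have hg : ∀ j, LocallyIntegrable (fun x => ⟪bW j, f x⟫) σ := fun j x =>
    (hf x).imp fun s hs => ⟨hs.1, Integrable.const_inner (𝕜 := ℝ) _ hs.2⟩
  have hg1 : ∀ j, ∀ᵐ y ∂σ, ‖⟪bW j, f y⟫‖ ≤ 1 := fun j => by
    filter_upwards [hf1] with y hy
    simpa [hy, bW.orthonormal.1 j] using norm_inner_le_norm (𝕜 := ℝ) (bW j) (f y)
  have hgrad := fun j => ae_sum_approxGradient_eq hp1 σ (hg j) (hg1 j)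
    (fun s : (Fin k → Fin n) × _ => ⟪bW j, A s.1 (bV s.2)⟫) (fun s => lastIdx hk s.1)
    (w := fun s => w (initIdx s.1) s.2) (fun s => hw _ _)
    (fun h hh => hAu.sum_integral_dop_X hk hu bV hid (bW j) hh)
  filter_upwards [ae_all_iff.2 hgrad, ae_all_iff.2 fun J => ae_all_iff.2 (hv₀'' J)] with x hx hd
  choose T₀ hT₀ using hd
  have hT : ∀ J i, LpDiffAt p (w J i) x fun b => (-1) ^ (k - 1) * T₀ J i b := fun J i => by
    rw [hwe]
    exact (hT₀ J i).const_mul _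
  refine ⟨fun K => ∑ i, ((-1) ^ (k - 1) * T₀ (initIdx K) i (lastIdx hk K)) • bV i, fun J => ?_, ?_⟩
  · simp only [initIdx_snocIdx, lastIdx_snocIdx]
    exact smallO_of_lpDiffAt hp1 bV (hT J) fun i => (hw J i).aestronglyMeasurable
  · refine bW.repr.injective (PiLp.ext fun j => ?_)
    rw [bW.repr_apply_apply, bW.repr_apply_apply, inner_smul_right, ← hx j _ fun s => hT _ _,
      Fintype.sum_prod_type, inner_sum]
    refine Finset.sum_congr rfl fun K _ => ?_
    rw [map_sum, inner_sum]
    refine Finset.sum_congr rfl fun i _ => ?_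
    rw [map_smul, inner_smul_right, mul_comm]
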